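/- Let d ≥ 2 be an integer and let b(n) = Σ_{i=1}^{ℓ} B_i(n) β_i^n be an exponential polynomial over K, with B_i ∈ K[T] nonzero and β_i ∈ K^*. Let Γ be the multiplicative subgroup of K^* generated by β_1,…,β_ℓ, and assume Γ ∩ k^* = {1}. If b(n) is a d-th power in K for infinitely many n ∈ ℕ, then there exist an exponential polynomial a(m) = Σ_{i=1}^{r} A_i(m) α_i^m over the algebraic closure of K (so A_i ∈ K̄[T] and α_i ∈ K̄^*) and a polynomial R ∈ k[T] such that b(m) = R(m)·a(m)^d for all m ∈ ℕ. -/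

import Mathlib

open scoped BigOperators Classical

namespace FunctionFieldGCD

variable {K : Type*} [Field K] {Point : Type*}

/-- Truncated order of vanishing `v_𝔭^0(f) = max {0, v_𝔭(f)}`. -/
noncomputable def v0 (v : Point → K → ℤ) (p : Point) (f : K) : ℤ := max 0 (v p f)

/-- The height `h(f) = Σ_𝔭 −min{0, v_𝔭(f)}` of `f`, counting poles with multiplicity. -/
noncomputable def height (v : Point → K → ℤ) (f : K) : ℤ := ∑ᶠ p : Point, max 0 (-(v p f))

/-- `min {v_𝔭^0(f), v_𝔭^0(g)}` with the convention `v_𝔭^0(0) = +∞`. -/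
noncomputable def minv0 (v : Point → K → ℤ) (p : Point) (f g : K) : ℤ :=
  if f = 0 then v0 v p g else if g = 0 then v0 v p f else min (v0 v p f) (v0 v p g)

/-- `N_{S,gcd}(f,g) = Σ_{𝔭∉S} min{v_𝔭^0(f), v_𝔭^0(g)}`. -/
noncomputable def NSgcd (v : Point → K → ℤ) (S : Set Point) (f g : K) : ℤ :=
  ∑ᶠ p ∈ Sᶜ, minv0 v p f g

/-- `h_gcd(f,g) = Σ_{𝔭} min{v_𝔭^0(f), v_𝔭^0(g)}`. -/
noncomputable def hgcd (v : Point → K → ℤ) (f g : K) : ℤ :=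
  ∑ᶠ p : Point, minv0 v p f g

/-- `N_S(f)`: number of zeros of `f` outside `S`, with multiplicity. -/
noncomputable def NS (v : Point → K → ℤ) (S : Set Point) (f : K) : ℤ :=
  ∑ᶠ p ∈ Sᶜ, v0 v p f

/-- `N̄_S(f)`: number of zeros of `f` outside `S`, without multiplicity. -/
noncomputable def NSbar (v : Point → K → ℤ) (S : Set Point) (f : K) : ℤ :=
  ∑ᶠ p ∈ Sᶜ, min 1 (v0 v p f)

/-- membership in the group `O_S^*` of `S`-units. -/
def IsSUnit (v : Point → K → ℤ) (S : Set Point) (f : K) : Prop :=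
  f ≠ 0 ∧ ∀ p ∉ S, v p f = 0

/-- `f` is a constant, i.e. belongs to (the image of) `k`. -/
def IsConst (k : Type*) [Field k] [Algebra k K] (f : K) : Prop :=
  ∃ c : k, algebraMap k K c = f

/-- Projective height of a finite tuple: `h(f_0,…,f_m) = Σ_𝔭 −min_j v_𝔭(f_j)`. -/
noncomputable def heightProj {ι : Type*} [Fintype ι] (v : Point → K → ℤ) (f : ι → K) : ℤ :=
  ∑ᶠ p : Point,
    -(if h : (Finset.univ : Finset ι).Nonempty then Finset.univ.inf' h fun j => v p (f j) else 0)

/-- `v_𝔭(F) = min_{i ∈ I_F} v_𝔭(a_i)` for a multivariable polynomial `F = Σ a_i x^i`. -/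
noncomputable def vPoly {n : ℕ} (v : Point → K → ℤ) (p : Point) (F : MvPolynomial (Fin n) K) :
    ℤ :=
  if h : F.support.Nonempty then F.support.inf' h fun mm => v p (MvPolynomial.coeff mm F) else 0

/-- The height `h(F) = Σ_𝔭 −v_𝔭(F)` of a multivariable polynomial. -/
noncomputable def hPoly {n : ℕ} (v : Point → K → ℤ) (F : MvPolynomial (Fin n) K) : ℤ :=
  ∑ᶠ p : Point, -(vPoly v p F)

/-- The relevant height `h̃(F) = Σ_𝔭 −min{0, v_𝔭(F)}` of a multivariable polynomial. -/
noncomputable def htilde {n : ℕ} (v : Point → K → ℤ) (F : MvPolynomial (Fin n) K) : ℤ :=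
  ∑ᶠ p : Point, max 0 (-(vPoly v p F))

/-- `max_{1≤i≤n} h(g_i)` (heights are nonnegative, so the `toNat` is harmless). -/
noncomputable def maxHeight {n : ℕ} (v : Point → K → ℤ) (g : Fin n → K) : ℤ :=
  ((Finset.univ.sup fun i => (height v (g i)).toNat : ℕ) : ℤ)

/-- `u^m = u_1^{m_1} ⋯ u_n^{m_n}` for an integer exponent vector `m`. -/
noncomputable def prodZPow {n : ℕ} (u : Fin n → K) (mm : Fin n → ℤ) : K :=
  ∏ j, u j ^ mm j

/-- Coprimality of multivariable polynomials: no common non-unit factor. -/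
def CoprimePoly {n : ℕ} (F G : MvPolynomial (Fin n) K) : Prop :=
  ∀ P : MvPolynomial (Fin n) K, P ∣ F → P ∣ G → IsUnit P

/-- `P` is a monomial `a·x^i`. -/
def IsMonomialPoly {n : ℕ} (P : MvPolynomial (Fin n) K) : Prop :=
  ∃ (mm : Fin n →₀ ℕ) (a : K), P = MvPolynomial.monomial mm a

/-- Axioms expressing that `K`, equipped with the family of normalized order functions
`v_𝔭` indexed by the points `𝔭 ∈ C(k)` of a smooth projective curve `C` of genus `genus`
over the algebraically closed field `k`, is the function field `k(C)`. -/
structure IsFunctionField (k : Type*) [Field k] [Algebra k K]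
    (v : Point → K → ℤ) (genus : ℕ) : Prop where
  v_mul : ∀ (p : Point) (f g : K), f ≠ 0 → g ≠ 0 → v p (f * g) = v p f + v p g
  v_add : ∀ (p : Point) (f g : K), f ≠ 0 → g ≠ 0 → f + g ≠ 0 → min (v p f) (v p g) ≤ v p (f + g)
  v_one : ∀ p : Point, v p (1 : K) = 0
  v_algebraMap : ∀ (p : Point) (c : k), c ≠ 0 → v p (algebraMap k K c) = 0
  exists_uniformizer : ∀ p : Point, ∃ f : K, f ≠ 0 ∧ v p f = 1
  finite_support : ∀ f : K, f ≠ 0 → {p : Point | v p f ≠ 0}.Finite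
  sum_v : ∀ f : K, f ≠ 0 → ∑ᶠ p : Point, v p f = 0
  const_of_nonneg : ∀ f : K, f ≠ 0 → (∀ p : Point, 0 ≤ v p f) → ∃ c : k, algebraMap k K c = f
  riemann_roch : ∀ D : Point →₀ ℤ, 2 * (genus : ℤ) - 2 < D.sum (fun _ d => d) →
    (Module.finrank k
        (Submodule.span k {f : K | f = 0 ∨ ∀ p : Point, -(D p) ≤ v p f}) : ℤ)
      = D.sum (fun _ d => d) + 1 - genus

/-- Axioms for the global derivation `η ↦ η' = dη/dt` on `K` determined by an element
`t` as in Proposition 12 (`dt p` plays the role of `v_𝔭(d_𝔭 t)`). -/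
structure IsGoodDerivation (k : Type*) [Field k] [Algebra k K]
    (v : Point → K → ℤ) (genus : ℕ) (D : K → K) (dt : Point → ℤ) : Prop where
  map_add : ∀ f g : K, D (f + g) = D f + D g
  leibniz : ∀ f g : K, D (f * g) = f * D g + g * D f
  map_const : ∀ c : k, D (algebraMap k K c) = 0
  ker_const : ∀ f : K, D f = 0 → ∃ c : k, algebraMap k K c = f
  v_D_of_vne : ∀ f : K, f ≠ 0 → ∀ p : Point, v p f ≠ 0 →
    D f ≠ 0 ∧ v p (D f) = v p f - 1 - dt p
  v_D_of_veq : ∀ f : K, f ≠ 0 → ∀ p : Point, v p f = 0 → D f ≠ 0 → -(dt p) ≤ v p (D f)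
  sum_dt : ∑ᶠ p : Point, max 0 (dt p) ≤ 3 * (genus : ℤ)

/-- `D_u(F) = Σ_{i∈I_F} ((a_i u^i)' / u^i)·x^i`. -/
noncomputable def Du {n : ℕ} (D : K → K) (u : Fin n → K) (F : MvPolynomial (Fin n) K) :
    MvPolynomial (Fin n) K :=
  ∑ mm ∈ F.support,
    MvPolynomial.monomial mm
      ((D (MvPolynomial.coeff mm F * ∏ j, u j ^ mm j)) / ∏ j, u j ^ mm j)



universe uk uK uP


/-- Abstract package: places of a function field together with a derivation. -/
structure FFD (k : Type uk) (K : Type uK) [Field k] [Field K] [Algebra k K] where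
  Pl : Type uK
  v : Pl → K → ℤ
  v_mul : ∀ (p : Pl) (f g : K), f ≠ 0 → g ≠ 0 → v p (f * g) = v p f + v p g
  v_add : ∀ (p : Pl) (f g : K), f ≠ 0 → g ≠ 0 → f + g ≠ 0 → min (v p f) (v p g) ≤ v p (f + g)
  v_const : ∀ (p : Pl) (c : k), c ≠ 0 → v p (algebraMap k K c) = 0
  unif : ∀ p : Pl, ∃ f : K, f ≠ 0 ∧ v p f = 1
  fin : ∀ f : K, f ≠ 0 → {p : Pl | v p f ≠ 0}.Finite
  sum : ∀ f : K, f ≠ 0 → ∑ᶠ p : Pl, v p f = 0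
  ne : Nonempty Pl
  res : ∀ (p : Pl) (f : K), f ≠ 0 → 0 ≤ v p f →
    ∃ c : k, algebraMap k K c = f ∨ 0 < v p (f - algebraMap k K c)
  D : Derivation k K K
  ker : ∀ f, D f = 0 → ∃ c : k, algebraMap k K c = f
  c : Pl → ℕ
  c_fin : {p | c p ≠ 0}.Finite
  hc : ∀ p f, f ≠ 0 → 0 ≤ v p f → D f = 0 ∨ -(c p : ℤ) ≤ v p (D f)

namespace FFD
variable {k : Type uk} {K : Type uK} [Field k] [Field K] [Algebra k K] (X : FFD k K)

/-- `f` has order at least `n` at `p`. -/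
def G (p : X.Pl) (f : K) (n : ℤ) : Prop := f = 0 ∨ n ≤ X.v p f

variable {X} {p : X.Pl}

lemma G.mono {f : K} {n m : ℤ} (h : X.G p f n) (hm : m ≤ n) : X.G p f m :=
  h.imp id (fun h => hm.trans h)

lemma G.zero {n : ℤ} : X.G p 0 n := Or.inl rfl

lemma G.le {f : K} {n : ℤ} (h : X.G p f n) (hf : f ≠ 0) : n ≤ X.v p f := h.resolve_left hf

lemma G.self (f : K) : X.G p f (X.v p f) := Or.inr le_rfl

lemma v_one : X.v p 1 = 0 := by
  have := X.v_const p 1 one_ne_zero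
  simpa using this

lemma G.const (c : k) : X.G p (algebraMap k K c) 0 := by
  by_cases h : c = 0
  · left; simp [h]
  · right; rw [X.v_const p c h]

lemma G.one : X.G p 1 0 := Or.inr (by rw [v_one])

lemma G.natCast (n : ℕ) : X.G p (n : K) 0 := by
  simpa using G.const (X := X) (p := p) (n : k)

lemma G.add {f g : K} {n : ℤ} (hf : X.G p f n) (hg : X.G p g n) : X.G p (f + g) n := by
  by_cases h1 : f = 0
  · simpa [h1] using hg
  by_cases h2 : g = 0
  · simpa [h2] using hf
  by_cases h3 : f + g = 0
  · exact Or.inl h3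
  · exact Or.inr ((le_min (hf.le h1) (hg.le h2)).trans (X.v_add p f g h1 h2 h3))

lemma G.mul {f g : K} {n m : ℤ} (hf : X.G p f n) (hg : X.G p g m) : X.G p (f * g) (n + m) := by
  by_cases h1 : f = 0
  · left; simp [h1]
  by_cases h2 : g = 0
  · left; simp [h2]
  right; rw [X.v_mul p f g h1 h2]; exact add_le_add (hf.le h1) (hg.le h2)

lemma G.neg {f : K} {n : ℤ} (hf : X.G p f n) : X.G p (-f) n := by
  have := (G.const (X := X) (p := p) (-1 : k)).mul hf
  simpa using this

lemma G.sub {f g : K} {n : ℤ} (hf : X.G p f n) (hg : X.G p g n) : X.G p (f - g) n := by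
  rw [sub_eq_add_neg]; exact hf.add hg.neg

lemma G.sum' {ι : Type*} (s : Finset ι) (f : ι → K) {n : ℤ} (h : ∀ i ∈ s, X.G p (f i) n) :
    X.G p (∑ i ∈ s, f i) n := by
  induction s using Finset.induction_on with
  | empty => simpa using G.zero
  | insert a s ha ih =>
    rw [Finset.sum_insert ha]
    exact (h a (by simp)).add (ih fun i hi => h i (by simp [hi]))

lemma G.prod {ι : Type*} (s : Finset ι) (f : ι → K) (n : ι → ℤ) (h : ∀ i ∈ s, X.G p (f i) (n i)) :
    X.G p (∏ i ∈ s, f i) (∑ i ∈ s, n i) := by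
  induction s using Finset.induction_on with
  | empty => simpa using G.one
  | insert a s ha ih =>
    rw [Finset.prod_insert ha, Finset.sum_insert ha]
    exact (h a (by simp)).mul (ih fun i hi => h i (by simp [hi]))

lemma v_inv {f : K} (hf : f ≠ 0) : X.v p f⁻¹ = - X.v p f := by
  have := X.v_mul p f f⁻¹ hf (inv_ne_zero hf)
  rw [mul_inv_cancel₀ hf, v_one] at this
  omega

lemma v_pow {f : K} (hf : f ≠ 0) (n : ℕ) : X.v p (f ^ n) = n * X.v p f := by
  induction n with
  | zero => simp [v_one]
  | succ n ih => rw [pow_succ, X.v_mul p _ _ (pow_ne_zero _ hf) hf, ih]; push_cast; ring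

lemma v_zpow {f : K} (hf : f ≠ 0) (n : ℤ) : X.v p (f ^ n) = n * X.v p f := by
  cases n with
  | ofNat n => simpa using v_pow hf n
  | negSucc n => rw [zpow_negSucc, v_inv (pow_ne_zero _ hf), v_pow hf, Int.negSucc_eq]; push_cast; ring

lemma v_prod {ι : Type*} (s : Finset ι) (f : ι → K) (h : ∀ i ∈ s, f i ≠ 0) :
    X.v p (∏ i ∈ s, f i) = ∑ i ∈ s, X.v p (f i) := by
  induction s using Finset.induction_on with
  | empty => simpa using v_one
  | insert a s ha ih =>
    rw [Finset.prod_insert ha, Finset.sum_insert ha, X.v_mul, ih]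
    · intro i hi; exact h i (by simp [hi])
    · exact h a (by simp)
    · exact Finset.prod_ne_zero_iff.2 fun i hi => h i (by simp [hi])

/-- general bound for derivations -/
lemma G.deriv {f : K} {n : ℤ} (h : X.G p f n) : X.G p (X.D f) (n - 1 - X.c p) := by
  by_cases hf : f = 0
  · left; simp [hf]
  obtain ⟨π, hπ, hv⟩ := X.unif p
  set a := X.v p f with ha
  have hna : n ≤ a := h.le hf
  have hw0 : f * (π ^ a)⁻¹ ≠ 0 := mul_ne_zero hf (inv_ne_zero (zpow_ne_zero _ hπ))
  have hvw : X.v p (f * (π ^ a)⁻¹) = 0 := by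
    rw [X.v_mul p _ _ hf (inv_ne_zero (zpow_ne_zero _ hπ)), v_inv (zpow_ne_zero _ hπ),
      v_zpow hπ, hv, ← ha]; ring
  set w := f * (π ^ a)⁻¹
  have hfw : f = π ^ a * w := by
    simp only [w]; field_simp
  have hDw : X.G p (X.D w) (-(X.c p : ℤ)) := X.hc p w hw0 hvw.ge
  have hDπ : X.G p (X.D π) (-(X.c p : ℤ)) := X.hc p π hπ (by omega)
  have hz : X.D (π ^ a) = algebraMap k K (a : k) * π ^ (a - 1) * X.D π := by
    rw [Derivation.leibniz_zpow]; simp [mul_assoc]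
  have h1 : X.G p (π ^ a * X.D w) (a - 1 - X.c p) := by
    refine ((G.self (X := X) (p := p) (π ^ a)).mul hDw).mono ?_
    rw [v_zpow hπ, hv]; omega
  have h2 : X.G p (w * X.D (π ^ a)) (a - 1 - X.c p) := by
    rw [hz]
    refine ((G.self (X := X) (p := p) w).mul (((G.const (X := X) (p := p) (a : k)).mul
      (G.self (X := X) (p := p) (π ^ (a-1)))).mul hDπ)).mono ?_
    rw [v_zpow hπ, hv, hvw]; omega
  have : X.D f = π ^ a * X.D w + w * X.D (π ^ a) := by
    rw [hfw, Derivation.leibniz]; simp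
  rw [this]
  exact (h1.add h2).mono (by omega)

lemma G.deriv0 {f : K} (h : X.G p f 0) (hp : X.c p = 0) : X.G p (X.D f) 0 := by
  by_cases hf : f = 0
  · left; simp [hf]
  have := X.hc p f hf (h.le hf)
  rw [hp] at this; simpa [G] using this

lemma G.iter {f : K} {n : ℤ} (h : X.G p f n) (i : ℕ) :
    X.G p (X.D^[i] f) (n - i * (1 + X.c p)) := by
  induction i with
  | zero => simpa using h
  | succ i ih =>
    rw [Function.iterate_succ_apply']
    refine ih.deriv.mono ?_
    push_cast; linarith

lemma G.iter0 {f : K} (h : X.G p f 0) (hp : X.c p = 0) (i : ℕ) : X.G p (X.D^[i] f) 0 := by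
  induction i with
  | zero => simpa using h
  | succ i ih => rw [Function.iterate_succ_apply']; exact ih.deriv0 hp

/-- sum formula in finite form -/
lemma sum_finset {f : K} (hf : f ≠ 0) (T : Finset X.Pl) (hT : ∀ p ∉ T, X.v p f = 0) :
    ∑ p ∈ T, X.v p f = 0 := by
  rw [← X.sum f hf, finsum_eq_sum_of_support_subset]
  intro p hp
  by_contra h
  exact hp (hT p (by simpa using h))

lemma sum_le {f : K} (hf : f ≠ 0) (T : Finset X.Pl) (hT : ∀ p ∉ T, X.G p f 0) :
    ∑ p ∈ T, X.v p f ≤ 0 := by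
  set U := T ∪ (X.fin f hf).toFinset
  have h1 : ∑ p ∈ U, X.v p f = 0 := sum_finset hf U (by
    intro p hp; by_contra h; exact hp (by simp [U, h]))
  rw [← h1]
  refine Finset.sum_le_sum_of_subset_of_nonneg (by simp [U]) ?_
  intro p _ hp; exact (hT p hp).le hf

/-- total zero estimates -/
lemma sum_zero_le {f : K} (hf : f ≠ 0) (S T : Finset X.Pl) (hST : Disjoint S T) (g w : X.Pl → ℤ)
    (h0 : ∀ p ∉ S, X.G p f 0) (hg : ∀ p ∈ T, X.G p f (g p)) (hw : ∀ p ∈ S, X.G p f (w p)) :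
    ∑ p ∈ T, g p + ∑ p ∈ S, w p ≤ 0 := by
  have h1 : ∑ p ∈ S ∪ T, X.v p f ≤ 0 := sum_le hf _ (by
    intro p hp; exact h0 p (by simp at hp; tauto))
  rw [Finset.sum_union hST] at h1
  have h2 : ∑ p ∈ T, g p ≤ ∑ p ∈ T, X.v p f := Finset.sum_le_sum fun p hp => (hg p hp).le hf
  have h3 : ∑ p ∈ S, w p ≤ ∑ p ∈ S, X.v p f := Finset.sum_le_sum fun p hp => (hw p hp).le hf
  linarith

lemma const_of (X : FFD k K) (f : K) (hf : f ≠ 0) (h : ∀ p : X.Pl, 0 ≤ X.v p f) :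
    ∃ c : k, algebraMap k K c = f := by
  obtain ⟨p⟩ := X.ne
  obtain ⟨c, hc | hc⟩ := X.res p f hf (h p)
  · exact ⟨c, hc⟩
  by_cases h0 : f - algebraMap k K c = 0
  · exact ⟨c, (sub_eq_zero.1 h0).symm⟩
  have h1 : ∀ q, X.G q (f - algebraMap k K c) 0 := fun q => G.sub (Or.inr (h q)) (G.const c)
  have := sum_le h0 {p} (fun q _ => h1 q)
  simp at this
  omega

lemma exists_pole (X : FFD k K) (f : K) (h : ∀ c : k, algebraMap k K c ≠ f) :
    ∃ p, X.v p f < 0 := by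
  by_contra hc
  push Not at hc
  obtain ⟨c, hc⟩ := X.const_of f (fun h0 => h 0 (by simp [h0])) hc
  exact h c hc

/-- bounded by a divisor -/
def Bd (X : FFD k K) (E : X.Pl →₀ ℕ) (f : K) : Prop := ∀ p, X.G p f (-(E p : ℤ))

/-- degree of a divisor -/
def dg (E : X.Pl →₀ ℕ) : ℕ := E.sum fun _ n => n

lemma Bd.mono {E F : X.Pl →₀ ℕ} {f : K} (h : X.Bd E f) (hEF : E ≤ F) : X.Bd F f := by
  intro p; refine (h p).mono ?_; have := hEF p; omega

lemma exists_Bd (f : K) : ∃ E : X.Pl →₀ ℕ, X.Bd E f := by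
  by_cases hf : f = 0
  · exact ⟨0, fun p => Or.inl hf⟩
  refine ⟨Finsupp.onFinset (X.fin f hf).toFinset (fun p => (X.v p f).natAbs) ?_, ?_⟩
  · intro p hp; simpa using hp
  · intro p; right; simp; exact neg_abs_le _

lemma exists_Bd_finset (s : Finset K) : ∃ E : X.Pl →₀ ℕ, ∀ f ∈ s, X.Bd E f := by
  induction s using Finset.induction_on with
  | empty => exact ⟨0, by simp⟩
  | insert a s ha ih =>
    obtain ⟨E, hE⟩ := ih
    obtain ⟨F, hF⟩ := exists_Bd (X := X) a
    refine ⟨E + F, fun f hf => ?_⟩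
    rcases Finset.mem_insert.1 hf with rfl | hf
    · exact hF.mono le_add_self
    · exact (hE f hf).mono le_self_add

lemma Bd.le_dg {E : X.Pl →₀ ℕ} {f : K} (h : X.Bd E f) (hf : f ≠ 0) (T : Finset X.Pl) (hT : ∀ p ∈ T, 0 ≤ X.v p f) :
    ∑ p ∈ T, X.v p f ≤ dg E := by
  have := sum_zero_le hf (E.support \ T) T Finset.sdiff_disjoint (fun p => X.v p f) (fun p => -(E p:ℤ))
    (fun p hp => by
      by_cases h2 : p ∈ T
      · exact Or.inr (hT p h2)
      · have : E p = 0 := by simpa [h2] using hp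
        have h3 := h p; rw [this] at h3; simpa using h3)
    (fun p hp => G.self f) (fun p hp => h p)
  have h2 : ∑ p ∈ E.support \ T, (E p : ℤ) ≤ dg E := by
    unfold dg Finsupp.sum; push_cast
    exact Finset.sum_le_sum_of_subset_of_nonneg Finset.sdiff_subset (by intros; positivity)
  rw [Finset.sum_neg_distrib] at this; linarith

lemma Bd.v_le {E : X.Pl →₀ ℕ} {f : K} (h : X.Bd E f) (hf : f ≠ 0) (p : X.Pl) : X.v p f ≤ dg E := by
  by_cases h0 : 0 ≤ X.v p f
  · simpa using h.le_dg hf {p} (by simpa using h0)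
  · have : (0:ℤ) ≤ dg E := by positivity
    omega

lemma Bd.abs_le {E : X.Pl →₀ ℕ} {f : K} (h : X.Bd E f) (hf : f ≠ 0) (p : X.Pl) : |X.v p f| ≤ dg E := by
  have h1 := (h p).le hf
  have h2 : E p ≤ dg E := by
    by_cases hp : p ∈ E.support
    · exact Finset.single_le_sum (f := fun p => E p) (fun _ _ => Nat.zero_le _) hp
    · simp at hp; omega
  rw [_root_.abs_le]; exact ⟨by omega, h.v_le hf p⟩

lemma Bd.add {E : X.Pl →₀ ℕ} {f g : K} (h : X.Bd E f) (h' : X.Bd E g) : X.Bd E (f + g) :=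
  fun p => (h p).add (h' p)
lemma Bd.sub {E : X.Pl →₀ ℕ} {f g : K} (h : X.Bd E f) (h' : X.Bd E g) : X.Bd E (f - g) :=
  fun p => (h p).sub (h' p)
lemma Bd.mul {E F : X.Pl →₀ ℕ} {f g : K} (h : X.Bd E f) (h' : X.Bd F g) : X.Bd (E + F) (f * g) :=
  fun p => ((h p).mul (h' p)).mono (by simp only [Finsupp.add_apply]; push_cast; omega)
lemma Bd.sum {ι : Type*} {E : X.Pl →₀ ℕ} (s : Finset ι) (f : ι → K) (h : ∀ i ∈ s, X.Bd E (f i)) :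
    X.Bd E (∑ i ∈ s, f i) := fun p => G.sum' s f fun i hi => h i hi p
lemma Bd.const {E : X.Pl →₀ ℕ} (c : k) : X.Bd E (algebraMap k K c) :=
  fun p => (G.const c).mono (by omega)
lemma Bd.smul {E : X.Pl →₀ ℕ} {f : K} (c : k) (h : X.Bd E f) : X.Bd E (algebraMap k K c * f) := by
  simpa using (Bd.const (E := 0) c).mul h
lemma Bd.natCast_mul {E : X.Pl →₀ ℕ} {f : K} (n : ℕ) (h : X.Bd E f) : X.Bd E (n * f) := by
  simpa using h.smul (n : k)

/-- the divisor of bad derivation places -/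
noncomputable def cdiv (X : FFD k K) : X.Pl →₀ ℕ :=
  Finsupp.onFinset X.c_fin.toFinset X.c (by intro p hp; simpa using hp)

lemma Bd.deriv {E : X.Pl →₀ ℕ} {f : K} (h : X.Bd E f) : X.Bd (E + E + (X.cdiv + X.cdiv)) (X.D f) := by
  intro p
  have hcd : X.cdiv p = X.c p := rfl
  by_cases h0 : E p = 0 ∧ X.c p = 0
  · have h1 := h p
    rw [h0.1] at h1
    refine (G.deriv0 (by simpa using h1) h0.2).mono (by omega)
  · refine (h p).deriv.mono ?_
    simp only [Finsupp.add_apply, hcd]; push_cast; omega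

end FFD

namespace FFD
variable {k : Type uk} {K : Type uK} [Field k] [Field K] [Algebra k K] {X : FFD k K} {p : X.Pl}

/-- Leibniz coefficients -/
noncomputable def lz (X : FFD k K) (φ : K) : ℕ → ℕ → K
  | 0, l => if l = 0 then φ else 0
  | (i+1), l => X.D (lz X φ i l) + (if l = 0 then 0 else lz X φ i (l-1))

lemma lz_zero (φ : K) (i l : ℕ) (h : i < l) : X.lz φ i l = 0 := by
  induction i generalizing l with
  | zero => simp [lz]; omega
  | succ i ih =>
    rw [lz, ih l (by omega), if_neg (by omega), ih (l-1) (by omega)]; simp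

lemma lz_diag (φ : K) (i : ℕ) : X.lz φ i i = φ := by
  induction i with
  | zero => simp [lz]
  | succ i ih => rw [lz, lz_zero _ _ _ (by omega)]; simp [ih]

lemma lz_sum (φ h : K) (i N : ℕ) (hN : i < N) :
    X.D^[i] (φ * h) = ∑ l ∈ Finset.range N, X.lz φ i l * X.D^[l] h := by
  induction i generalizing N with
  | zero =>
    rw [Finset.sum_eq_single 0]
    · simp [lz]
    · intro b _ hb; simp [lz, hb]
    · intro h; exact absurd (Finset.mem_range.2 hN) h
  | succ i ih =>
    obtain ⟨N, rfl⟩ : ∃ M, N = M + 1 := ⟨N - 1, by omega⟩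
    rw [Function.iterate_succ_apply', ih N (by omega), map_sum]
    have e1 : ∀ l, X.D (X.lz φ i l * X.D^[l] h) =
        X.D (X.lz φ i l) * X.D^[l] h + X.lz φ i l * X.D^[l+1] h := by
      intro l; rw [Derivation.leibniz, Function.iterate_succ_apply']; simp; ring
    simp only [e1, lz, add_mul, Finset.sum_add_distrib]
    congr 1
    · rw [Finset.sum_range_succ, lz_zero (X := X) φ i N (by omega)]; simp
    · rw [Finset.sum_range_succ']; simp

/-- Wronskian -/
noncomputable def wr (X : FFD k K) {N : ℕ} (f : Fin N → K) : K :=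
  Matrix.det (Matrix.of fun (s i : Fin N) => X.D^[(i:ℕ)] (f s))

lemma wr_mul {N : ℕ} (φ : K) (f : Fin N → K) : X.wr (fun s => φ * f s) = X.wr f * φ ^ N := by
  have : (Matrix.of fun (s i : Fin N) => X.D^[(i:ℕ)] (φ * f s)) =
      (Matrix.of fun (s i : Fin N) => X.D^[(i:ℕ)] (f s)) *
      (Matrix.of fun (l i : Fin N) => X.lz φ i l) := by
    ext s i
    rw [Matrix.mul_apply]
    simp only [Matrix.of_apply]
    rw [lz_sum φ (f s) i N i.2, ← Fin.sum_univ_eq_sum_range (fun l => X.lz φ i l * X.D^[l] (f s))]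
    exact Finset.sum_congr rfl fun _ _ => mul_comm _ _
  unfold wr
  rw [this, Matrix.det_mul, Matrix.det_of_isUpperTriangular (M := Matrix.of fun (l i : Fin N) => X.lz φ i l)]
  · simp [lz_diag]
  · intro i j hij
    exact lz_zero _ _ _ hij

lemma iter_algebraMap_mul (c : k) (f : K) (i : ℕ) :
    X.D^[i] (algebraMap k K c * f) = algebraMap k K c * X.D^[i] f := by
  induction i with
  | zero => rfl
  | succ i ih => simp [Function.iterate_succ_apply', ih]

lemma iter_sum {ι : Type*} (s : Finset ι) (f : ι → K) (i : ℕ) :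
    X.D^[i] (∑ j ∈ s, f j) = ∑ j ∈ s, X.D^[i] (f j) := by
  induction i with
  | zero => rfl
  | succ i ih => simp [Function.iterate_succ_apply', ih]

lemma wr_ne_zero {N : ℕ} (f : Fin N → K) (hf : LinearIndependent k f) : X.wr f ≠ 0 := by
  induction N with
  | zero => simp [wr]
  | succ N ih =>
    intro h0
    have ih' := ih (fun s => f s.castSucc) (hf.comp _ (Fin.castSucc_injective N))
    have key : ∀ c : Fin N → K, (∀ i : ℕ, i < N → ∑ s, c s * X.D^[i] (f s.castSucc) = 0) → c = 0 := by
      intro c hc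
      by_contra hne
      apply ih'
      unfold wr
      rw [← Matrix.exists_vecMul_eq_zero_iff]
      refine ⟨c, hne, ?_⟩
      ext i
      simpa [Matrix.vecMul, dotProduct] using hc i i.2
    obtain ⟨c, hc0, hc⟩ := Matrix.exists_vecMul_eq_zero_iff.2 h0
    have hc1 : ∀ i : ℕ, i < N + 1 → ∑ s, c s * X.D^[i] (f s) = 0 := by
      intro i hi
      have := congrFun hc ⟨i, hi⟩
      simpa [Matrix.vecMul, dotProduct] using this
    have hl : c (Fin.last N) ≠ 0 := by
      intro hl
      have : (fun s : Fin N => c s.castSucc) = 0 := by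
        apply key
        intro i hi
        have := hc1 i (by omega)
        rw [Fin.sum_univ_castSucc, hl] at this
        simpa using this
      apply hc0
      ext s
      refine Fin.lastCases hl (fun s => congrFun this s) s
    set e : Fin N → K := fun s => c s.castSucc / c (Fin.last N) with he
    have he1 : ∀ i : ℕ, i < N + 1 → ∑ s, e s * X.D^[i] (f s.castSucc) + X.D^[i] (f (Fin.last N)) = 0 := by
      intro i hi
      have := hc1 i hi
      rw [Fin.sum_univ_castSucc] at this
      have h2 := congrArg (fun x => x / c (Fin.last N)) this
      simp only [add_div, Finset.sum_div, zero_div] at h2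
      rw [← h2]
      congr 1
      · refine Finset.sum_congr rfl fun s _ => ?_
        rw [he]; ring
      · field_simp
    have hDe : (fun s => X.D (e s)) = 0 := by
      apply key
      intro i hi
      have h1 := congrArg X.D (he1 i (by omega))
      have h2 := he1 (i+1) (by omega)
      simp only [Function.iterate_succ_apply'] at h2
      simp only [map_add, map_sum, Derivation.leibniz, map_zero, Finset.sum_add_distrib, smul_eq_mul] at h1
      have h3 : ∑ s, X.D (e s) * X.D^[i] (f s.castSucc) = ∑ s, X.D^[i] (f s.castSucc) * X.D (e s) :=
        Finset.sum_congr rfl fun _ _ => mul_comm _ _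
      rw [h3]
      linear_combination h1 - h2
    choose a ha using fun s => X.ker (e s) (congrFun hDe s)
    have h0 := he1 0 (by omega)
    simp only [Function.iterate_zero, id] at h0
    have := Fintype.linearIndependent_iff.1 hf (Fin.snoc a 1) (by
      rw [Fin.sum_univ_castSucc]
      simp only [Fin.snoc_castSucc, Fin.snoc_last, Algebra.smul_def, ha, map_one, one_mul]
      exact h0) (Fin.last N)
    simp at this

lemma G.det {N : ℕ} (M : Matrix (Fin N) (Fin N) K) (w e : Fin N → ℤ)
    (h : ∀ s i, X.G p (M s i) (w s + e i)) : X.G p M.det (∑ s, w s + ∑ i, e i) := by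
  rw [Matrix.det_apply]
  refine G.sum' _ _ fun σ _ => ?_
  have h1 : X.G p (∏ i, M (σ i) i) (∑ s, w s + ∑ i, e i) := by
    have := G.prod (X := X) (p := p) Finset.univ (fun i => M (σ i) i) (fun i => w (σ i) + e i)
      (fun i _ => h _ _)
    rwa [Finset.sum_add_distrib, Equiv.sum_comp σ w] at this
  rcases Int.units_eq_one_or (Equiv.Perm.sign σ) with h2 | h2 <;> rw [h2]
  · simpa using h1
  · simpa using h1.neg

lemma wr_G {N : ℕ} (f : Fin N → K) (w : Fin N → ℤ) (h : ∀ s, X.G p (f s) (w s)) :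
    X.G p (X.wr f) (∑ s, w s - N * N * (1 + X.c p)) := by
  have := G.det (X := X) (p := p) (Matrix.of fun (s i : Fin N) => X.D^[(i:ℕ)] (f s)) w
    (fun i => - (N * (1 + X.c p))) (fun s i => by
      refine ((h s).iter i).mono ?_
      have : ((i:ℕ):ℤ) ≤ N := by exact_mod_cast i.2.le
      have : ((i:ℕ):ℤ) * (1 + X.c p) ≤ N * (1 + X.c p) := by gcongr
      linarith)
  refine this.mono ?_
  simp only [Finset.sum_const, Finset.card_univ, Fintype.card_fin, nsmul_eq_mul]
  apply le_of_eq; ring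

lemma wr_G0 {N : ℕ} (f : Fin N → K) (hp : X.c p = 0) (g : ℕ) (h : ∀ s, X.G p (f s) g) :
    X.G p (X.wr f) (N * g) := by
  obtain ⟨π, hπ, hv⟩ := X.unif p
  have hπg := pow_ne_zero g hπ
  have hfe : f = fun s => π ^ g * (f s * (π ^ g)⁻¹) := by
    ext s; field_simp
  have h0 : ∀ s, X.G p (f s * (π ^ g)⁻¹) 0 := by
    intro s
    refine ((h s).mul (G.self ((π ^ g)⁻¹))).mono ?_
    rw [v_inv hπg, v_pow hπ, hv]; simp
  rw [hfe, wr_mul]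
  have h1 : X.G p (X.wr fun s => f s * (π ^ g)⁻¹) 0 := by
    have := G.det (X := X) (p := p) (Matrix.of fun (s i : Fin N) => X.D^[(i:ℕ)] (f s * (π ^ g)⁻¹)) 0 0
      (fun s i => by simpa using (h0 s).iter0 hp i)
    simpa [wr] using this
  refine (h1.mul (G.self ((π ^ g) ^ N))).mono ?_
  rw [v_pow hπg, v_pow hπ, hv]; simp

/-- expansion in a larger spanning family -/
lemma wr_expand {N : ℕ} {Y : Type*} [Fintype Y] (f : Fin N → K) (e : Y → K) (c : Fin N → Y → k)
    (hf : ∀ s, f s = ∑ y, algebraMap k K (c s y) * e y) (w : Y → ℤ) (B : ℤ)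
    (hw : ∀ y, X.G p (e y) (w y))
    (hB : ∀ φ : Fin N → Y, Function.Injective φ → B ≤ ∑ s, w (φ s)) :
    X.G p (X.wr f) (B - N * N * (1 + X.c p)) := by
  have e1 : X.wr f = ∑ φ : Fin N → Y, (∏ s, algebraMap k K (c s (φ s))) * X.wr (fun s => e (φ s)) := by
    unfold wr
    have : (Matrix.of fun (s i : Fin N) => X.D^[(i:ℕ)] (f s)) =
        fun s => ∑ y, (algebraMap k K (c s y)) • (fun i : Fin N => X.D^[(i:ℕ)] (e y)) := by
      ext s i
      simp [hf, iter_sum, iter_algebraMap_mul, Finset.sum_apply, Algebra.smul_def]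
    rw [this]
    have h2 := (Matrix.detRowAlternating (R := K) (n := Fin N)).toMultilinearMap.map_sum
      (fun s y => (algebraMap k K (c s y)) • (fun i : Fin N => X.D^[(i:ℕ)] (e y)))
    refine h2.trans ?_
    refine Finset.sum_congr rfl fun φ _ => ?_
    rw [MultilinearMap.map_smul_univ]
    rfl
  rw [e1]
  refine G.sum' _ _ fun φ _ => ?_
  by_cases hφ : Function.Injective φ
  · have h1 : X.G p (∏ s, algebraMap k K (c s (φ s))) 0 := by
      simpa using G.prod (X := X) (p := p) Finset.univ (fun s => algebraMap k K (c s (φ s))) 0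
        (fun s _ => G.const _)
    refine (h1.mul (wr_G (fun s => e (φ s)) (fun s => w (φ s)) fun s => hw _)).mono ?_
    have := hB φ hφ
    linarith
  · left
    have : X.wr (fun s => e (φ s)) = 0 := by
      unfold Function.Injective at hφ
      push Not at hφ
      obtain ⟨a, b, h1, h2⟩ := hφ
      refine Matrix.det_zero_of_row_eq h2 ?_
      ext i; simp [h1]
    simp [this]

/-- replace one row by the sum -/
lemma wr_sum_row {N : ℕ} (f : Fin N → K) (j : Fin N) : X.wr (Function.update f j (∑ s, f s)) = X.wr f := by
  unfold wr
  have : (Matrix.of fun (s i : Fin N) => X.D^[(i:ℕ)] (Function.update f j (∑ s, f s) s)) =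
    (Matrix.of fun (s i : Fin N) => X.D^[(i:ℕ)] (f s)).updateRow j
      (∑ s, (1 : Fin N → K) s • (Matrix.of fun (s i : Fin N) => X.D^[(i:ℕ)] (f s)) s) := by
    ext s i
    by_cases hs : s = j
    · subst hs; simp [iter_sum]; erw [Finset.sum_apply]; rfl
    · simp [hs]
  rw [this, Matrix.det_updateRow_sum]
  simp

end FFD

namespace FFD
variable {k : Type uk} {K : Type uK} [Field k] [Field K] [Algebra k K] {X : FFD k K} {p : X.Pl}

lemma D_mul_pow (a g : K) (hg : g ≠ 0) (n : ℕ) :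
    X.D (a * g ^ n) = (X.D a + n * (X.D g / g) * a) * g ^ n := by
  rw [Derivation.leibniz, Derivation.leibniz_pow]
  simp only [smul_eq_mul, nsmul_eq_mul]
  rcases n with _ | n
  · simp
  · simp only [Nat.add_sub_cancel]; rw [pow_succ]; field_simp; ring

lemma const_of_wr {f g : K} (hg : g ≠ 0) (h : g * X.D f - X.D g * f = 0) :
    ∃ c : k, f = algebraMap k K c * g := by
  have : X.D (f / g) = 0 := by
    rw [div_eq_mul_inv, Derivation.leibniz, Derivation.leibniz_inv]
    simp only [smul_eq_mul, neg_mul, mul_neg]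
    field_simp
    linear_combination h
  obtain ⟨c, hc⟩ := X.ker _ this
  exact ⟨c, by rw [hc]; field_simp⟩

/-- independence of exponential sums with bounded coefficients -/
lemma ind {ι : Type*} (J : Finset ι) (g : ι → K) (hg0 : ∀ j ∈ J, g j ≠ 0)
    (hg : ∀ i ∈ J, ∀ j ∈ J, i ≠ j → ∀ c : k, algebraMap k K c ≠ g i / g j) (E : X.Pl →₀ ℕ) :
    ∃ n0 : ℕ, ∀ n ≥ n0, ∀ a : ι → K, (∀ j ∈ J, X.Bd E (a j)) → ∑ j ∈ J, a j * g j ^ n = 0 →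
      ∀ j ∈ J, a j = 0 := by
  induction J using Finset.induction_on generalizing E with
  | empty => exact ⟨0, by simp⟩
  | insert t J ht ih =>
    have hg0' : ∀ j ∈ J, g j ≠ 0 := fun j hj => hg0 j (by simp [hj])
    have ih := ih hg0' (fun i hi j hj => hg i (by simp [hi]) j (by simp [hj]))
    obtain ⟨F, hF⟩ := exists_Bd_finset (X := X) ((insert t J).image fun j => X.D (g j) / g j)
    set E' := E + E + (X.cdiv + X.cdiv) with hE'
    obtain ⟨n1, h1⟩ := ih E
    obtain ⟨n2, h2⟩ := ih (E + (E' + (F + E)))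
    refine ⟨max (max n1 n2) (2 * dg E + 1), fun n hn a ha hs => ?_⟩
    have hgt : g t ≠ 0 := hg0 t (by simp)
    have haJ : ∀ j ∈ J, X.Bd E (a j) := fun j hj => ha j (by simp [hj])
    have hat : X.Bd E (a t) := ha t (by simp)
    rw [Finset.sum_insert ht] at hs
    have suf : a t = 0 := by
      by_contra hat0
      set L : ι → K := fun j => X.D (a j) + n * (X.D (g j) / g j) * a j with hL
      have hLB : ∀ j ∈ insert t J, X.Bd (E' + (F + E)) (L j) := by
        intro j hj
        refine Bd.add ((ha j hj).deriv.mono le_self_add) ?_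
        rw [mul_assoc]
        refine (Bd.natCast_mul n ((hF _ (Finset.mem_image_of_mem _ hj)).mul (ha j hj))).mono le_add_self
      have hDs : L t * g t ^ n + ∑ j ∈ J, L j * g j ^ n = 0 := by
        have := congrArg X.D hs
        rw [map_add, map_sum, D_mul_pow _ _ hgt, map_zero] at this
        rw [← this]
        congr 1
        exact Finset.sum_congr rfl fun j hj => (D_mul_pow _ _ (hg0' j hj) n).symm
      have hz := h2 n (by omega) (fun j => a t * L j - L t * a j) (fun j hj => by
        refine Bd.sub (hat.mul (hLB j (by simp [hj]))) ?_
        rw [mul_comm]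
        exact (haJ j hj).mul (hLB t (by simp))) (by
        have : ∑ j ∈ J, (a t * L j - L t * a j) * g j ^ n =
          a t * ∑ j ∈ J, L j * g j ^ n - L t * ∑ j ∈ J, a j * g j ^ n := by
          rw [Finset.mul_sum, Finset.mul_sum, ← Finset.sum_sub_distrib]
          exact Finset.sum_congr rfl fun j _ => by ring
        rw [this]
        linear_combination a t * hDs - L t * hs)
      have hall : ∀ j ∈ J, a j = 0 := by
        intro j hj
        by_contra haj
        have hgj := hg0' j hj
        have hwr : (a t * g t ^ n) * X.D (a j * g j ^ n) - X.D (a t * g t ^ n) * (a j * g j ^ n) = 0 := by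
          rw [D_mul_pow _ _ hgt, D_mul_pow _ _ hgj]
          have := hz j hj
          simp only [hL] at this
          linear_combination g t ^ n * g j ^ n * this
        have hne : a t * g t ^ n ≠ 0 := mul_ne_zero hat0 (pow_ne_zero _ hgt)
        obtain ⟨c, hc⟩ := const_of_wr hne hwr
        have hc0 : c ≠ 0 := by
          rintro rfl
          simp [haj, hgj] at hc
        obtain ⟨p, hp⟩ := X.exists_pole _ (hg j (by simp [hj]) t (by simp) (fun h => ht (h ▸ hj)))
        rw [div_eq_mul_inv, X.v_mul p _ _ hgj (inv_ne_zero hgt), v_inv hgt] at hp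
        have hv := congrArg (X.v p) hc
        rw [X.v_mul p _ _ haj (pow_ne_zero _ hgj), X.v_mul p _ _ (by simpa using hc0) hne,
          X.v_mul p _ _ hat0 (pow_ne_zero _ hgt), v_pow hgj, v_pow hgt, X.v_const p c hc0] at hv
        have b1 := (haJ j hj).abs_le haj p
        have b2 := hat.abs_le hat0 p
        rw [_root_.abs_le] at b1 b2
        have h3 : (n:ℤ) * (X.v p (g j) + -X.v p (g t)) ≤ n * (-1) :=
          mul_le_mul_of_nonneg_left (by omega) (by positivity)
        have h4 : (2 * dg E + 1 : ℤ) ≤ n := by exact_mod_cast (le_max_right _ _).trans hn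
        linarith
      rw [Finset.sum_eq_zero (fun j hj => by rw [hall j hj, zero_mul]), add_zero] at hs
      exact hat0 ((mul_eq_zero.1 hs).resolve_right (pow_ne_zero _ hgt))
    intro j hj
    rcases Finset.mem_insert.1 hj with rfl | hj
    · exact suf
    · rw [suf, zero_mul, zero_add] at hs
      exact h1 n (by omega) a haJ hs j hj

lemma Bd.eval {E : X.Pl →₀ ℕ} (A : Polynomial K) (h : ∀ i, X.Bd E (A.coeff i)) (n : ℕ) :
    X.Bd E (A.eval (n:K)) := by
  rw [Polynomial.eval_eq_sum, Polynomial.sum]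
  refine Bd.sum _ _ fun i _ => ?_
  rw [mul_comm, ← Nat.cast_pow]
  exact Bd.natCast_mul _ (h i)

lemma G.eval0 (A : Polynomial K) (h : ∀ i, X.G p (A.coeff i) 0) (n : ℕ) :
    X.G p (A.eval (n:K)) 0 := by
  rw [Polynomial.eval_eq_sum, Polynomial.sum]
  refine G.sum' _ _ fun i _ => ?_
  simpa using (h i).mul (G.natCast (X := X) (p := p) (n ^ i))

lemma exists_Bd_coeff (s : Finset (Polynomial K)) :
    ∃ E : X.Pl →₀ ℕ, ∀ A ∈ s, ∀ i, X.Bd E (A.coeff i) := by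
  obtain ⟨E, hE⟩ := exists_Bd_finset (X := X) (s.biUnion fun A => A.support.image A.coeff)
  refine ⟨E, fun A hA i => ?_⟩
  by_cases hi : A.coeff i = 0
  · rw [hi]; exact fun p => G.zero
  · exact hE _ (Finset.mem_biUnion.2 ⟨A, hA, Finset.mem_image_of_mem _ (by simpa using hi)⟩)

lemma eval_ne_zero [CharZero K] (A : Polynomial K) (hA : A ≠ 0) :
    ∃ n0 : ℕ, ∀ n ≥ n0, A.eval (n:K) ≠ 0 := by
  have : {n : ℕ | A.eval (n:K) = 0}.Finite := by
    have h := (A.roots.toFinset.finite_toSet).preimage (f := fun n : ℕ => (n:K)) (Nat.cast_injective.injOn)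
    refine h.subset fun n hn => ?_
    simpa [hA] using hn
  obtain ⟨m, hm⟩ := this.bddAbove
  refine ⟨m + 1, fun n hn h => ?_⟩
  have := hm h; omega

lemma eval_ne_zero_finset [CharZero K] {ι : Type*} (J : Finset ι) (A : ι → Polynomial K) (hA : ∀ j ∈ J, A j ≠ 0) :
    ∃ n0 : ℕ, ∀ n ≥ n0, ∀ j ∈ J, (A j).eval (n:K) ≠ 0 := by
  obtain ⟨n0, h⟩ := eval_ne_zero (∏ j ∈ J, A j) (Finset.prod_ne_zero_iff.2 hA)
  refine ⟨n0, fun n hn j hj => ?_⟩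
  have := h n hn
  rw [Polynomial.eval_prod, Finset.prod_ne_zero_iff] at this
  exact this j hj

/-- main lower bound -/
lemma low [CharZero K] {N : ℕ} (g : Fin N → K) (hg0 : ∀ j, g j ≠ 0)
    (hg : ∀ i j, i ≠ j → ∀ c : k, algebraMap k K c ≠ g i / g j) (A : Fin N → Polynomial K)
    (hA : ∀ j, A j ≠ 0) (hN : 2 ≤ N) (S : Finset X.Pl)
    (hSg : ∀ p ∉ S, ∀ j, X.v p (g j) = 0) (hSc : ∀ p ∉ S, X.c p = 0)
    (hSA : ∀ p ∉ S, ∀ j i, X.G p ((A j).coeff i) 0) :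
    ∃ (C : ℤ) (n0 : ℕ), ∀ n ≥ n0, ∑ j, (A j).eval (n:K) * g j ^ n ≠ 0 ∧
      ∑ p ∈ S, X.v p (∑ j, (A j).eval (n:K) * g j ^ n) ≤ C - n := by
  obtain ⟨E, hE⟩ := exists_Bd_coeff (X := X) (Finset.univ.image A)
  have hE : ∀ j i, X.Bd E ((A j).coeff i) := fun j => hE _ (by simp)
  obtain ⟨n1, h1⟩ := ind Finset.univ g (fun j _ => hg0 j) (fun i _ j _ => hg i j) E
  obtain ⟨n2, h2⟩ := eval_ne_zero_finset Finset.univ A (fun j _ => hA j)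
  have hmin : ∀ p, ∃ j, ∀ i, X.v p (g j) ≤ X.v p (g i) := fun p => by
    have := Finset.exists_min_image (Finset.univ : Finset (Fin N)) (fun j => X.v p (g j))
      ⟨⟨0, by omega⟩, by simp⟩
    obtain ⟨j, _, hj⟩ := this
    exact ⟨j, fun i => hj i (by simp)⟩
  choose jm hjm using hmin
  have hNN : 0 < N := by omega
  have hsumg : ∀ j, ∑ p ∈ S, X.v p (g j) = 0 := fun j => sum_finset (hg0 j) S fun p hp => hSg p hp j
  have hminsum : ∑ p ∈ S, X.v p (g (jm p)) ≤ -1 := by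
    let a : Fin N := ⟨0, by omega⟩
    let b : Fin N := ⟨1, by omega⟩
    have hab : a ≠ b := by simp [a, b]
    obtain ⟨q, hq⟩ := X.exists_pole _ (hg a b hab)
    rw [div_eq_mul_inv, X.v_mul q _ _ (hg0 a) (inv_ne_zero (hg0 b)), v_inv (hg0 b)] at hq
    have hqS : q ∈ S := by
      by_contra h; rw [hSg q h, hSg q h] at hq; omega
    have : ∑ p ∈ S, X.v p (g (jm p)) < ∑ p ∈ S, X.v p (g b) := by
      refine Finset.sum_lt_sum (fun p _ => hjm p b) ⟨q, hqS, ?_⟩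
      have := hjm q a; omega
    rw [hsumg] at this; omega
  refine ⟨∑ p ∈ S, (N * E p + N * N * (1 + X.c p) : ℤ), max n1 n2, fun n hn => ?_⟩
  have hev : ∀ j, (A j).eval (n:K) ≠ 0 := fun j => h2 n (by omega) j (by simp)
  have hevB : ∀ j, X.Bd E ((A j).eval (n:K)) := fun j => Bd.eval _ (hE j) n
  set f : Fin N → K := fun j => (A j).eval (n:K) * g j ^ n with hf
  have hsum0 : ∑ j, f j ≠ 0 := fun h0 =>
    hev ⟨0, hNN⟩ (h1 n (by omega) (fun j => (A j).eval (n:K)) (fun j _ => hevB j) h0 _ (by simp))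
  refine ⟨hsum0, ?_⟩
  have hli : LinearIndependent k f := by
    rw [Fintype.linearIndependent_iff]
    intro c hc j
    have := h1 n (by omega) (fun j => algebraMap k K (c j) * (A j).eval (n:K))
      (fun j _ => (hevB j).smul _) (by
        rw [← hc]; refine Finset.sum_congr rfl fun j _ => ?_
        rw [Algebra.smul_def, hf]; ring) j (by simp)
    simpa [hev j] using this
  have hW := wr_ne_zero (X := X) f hli
  have hout : ∀ p ∉ S, X.G p (X.wr f) 0 := by
    intro p hp
    simpa using wr_G0 f (hSc p hp) 0 (fun s => by
      have := (G.eval0 (A s) (hSA p hp s) n).mul (G.self (X := X) (p := p) (g s ^ n))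
      rw [v_pow (hg0 s), hSg p hp] at this
      simpa using this)
  set P := ∑ j, f j with hP
  have hin : ∀ p ∈ S, X.G p (X.wr f) (X.v p P + ∑ s, (n * X.v p (g s) - E p) - (n * X.v p (g (jm p)) - E p)
      - N * N * (1 + X.c p)) := by
    intro p _
    rw [← wr_sum_row f (jm p)]
    refine (wr_G _ (Function.update (fun s => (n * X.v p (g s) - E p : ℤ)) (jm p) (X.v p P)) ?_).mono ?_
    · intro s
      by_cases hs : s = jm p
      · subst hs; simp only [Function.update_self]; exact G.self _
      · simp only [Function.update_of_ne hs]
        refine ((hevB s p).mul (G.self (g s ^ n))).mono ?_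
        rw [v_pow (hg0 s)]; linarith
    · rw [Finset.sum_update_of_mem (Finset.mem_univ _)]
      have := Finset.sum_erase_add Finset.univ (fun s => (n * X.v p (g s) - E p : ℤ)) (Finset.mem_univ (jm p))
      rw [← Finset.erase_eq]; linarith
  have := sum_zero_le hW S ∅ (by simp) 0 _ hout (by simp) hin
  simp only [Finset.sum_empty, zero_add, Finset.sum_sub_distrib, Finset.sum_add_distrib, ← Finset.mul_sum] at this
  rw [Finset.sum_comm] at this
  simp only [hsumg, Finset.sum_const, nsmul_eq_mul, ← Finset.mul_sum, Finset.card_univ, Fintype.card_fin, mul_zero, mul_one] at this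
  simp only [Finset.sum_add_distrib, ← Finset.mul_sum, Finset.sum_const, nsmul_eq_mul, mul_one]
  have h5 : (n:ℤ) * ∑ p ∈ S, X.v p (g (jm p)) ≤ n * (-1) := mul_le_mul_of_nonneg_left hminsum (by positivity)
  have h6 : (0:ℤ) ≤ ∑ p ∈ S, (E p:ℤ) := Finset.sum_nonneg fun _ _ => by positivity
  linarith

/-- dimension of spaces of bounded functions -/
lemma finrank_le (p : X.Pl) (M : ℕ) (L : Submodule k K) [FiniteDimensional k L] (a : ℤ)
    (h1 : ∀ f ∈ L, X.G p f a) (h2 : ∀ f ∈ L, f ≠ 0 → X.v p f < a + M) : Module.finrank k L ≤ M := by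
  induction M generalizing L a with
  | zero =>
    have : L = ⊥ := by
      rw [Submodule.eq_bot_iff]; intro f hf
      by_contra h0
      have := h2 f hf h0
      have := (h1 f hf).le h0
      simp at *; omega
    subst this; simp
  | succ M ih =>
    let L1 : Submodule k K :=
      { carrier := {f | f ∈ L ∧ X.G p f (a+1)}
        add_mem' := fun ha hb => ⟨L.add_mem ha.1 hb.1, ha.2.add hb.2⟩
        zero_mem' := ⟨L.zero_mem, G.zero⟩
        smul_mem' := fun c f hf => ⟨L.smul_mem c hf.1, by
          rw [Algebra.smul_def]; simpa using (G.const c).mul hf.2⟩ }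
    have hle : L1 ≤ L := fun f hf => hf.1
    have : FiniteDimensional k L1 := Submodule.finiteDimensional_of_le hle
    have h3 := ih L1 (a+1) (fun f hf => hf.2) (fun f hf h0 => by
      have := h2 f hf.1 h0; push_cast at this; linarith)
    by_cases hL : L ≤ L1
    · have := Submodule.finrank_mono hL
      omega
    obtain ⟨f0, hf0, hf1⟩ := SetLike.not_le_iff_exists.1 hL
    have hf00 : f0 ≠ 0 := fun h => hf1 (h ▸ L1.zero_mem)
    have hv : X.v p f0 = a := by
      have := (h1 f0 hf0).le hf00
      by_contra hne
      exact hf1 ⟨hf0, Or.inr (by omega)⟩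
    have hsup : L ≤ L1 ⊔ Submodule.span k {f0} := by
      intro f hf
      by_cases hfz : f = 0
      · rw [hfz]; exact Submodule.zero_mem _
      have hv1 : 0 ≤ X.v p (f / f0) := by
        rw [div_eq_mul_inv, X.v_mul p _ _ hfz (inv_ne_zero hf00), v_inv hf00]
        have := (h1 f hf).le hfz
        omega
      obtain ⟨c, hc⟩ := X.res p (f / f0) (div_ne_zero hfz hf00) hv1
      have hG : X.G p (f / f0 - algebraMap k K c) 1 := by
        rcases hc with hc | hc
        · left; rw [hc, sub_self]
        · right; omega
      rw [Submodule.mem_sup]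
      refine ⟨f - c • f0, ⟨L.sub_mem hf (L.smul_mem _ hf0), ?_⟩, c • f0,
        Submodule.smul_mem _ _ (Submodule.mem_span_singleton_self _), by ring⟩
      have : f - c • f0 = f0 * (f / f0 - algebraMap k K c) := by
        rw [Algebra.smul_def]; field_simp
      rw [this]
      refine ((G.self f0).mul hG).mono ?_
      rw [hv]
    have h4 := Submodule.finrank_mono hsup
    have h5 := Submodule.finrank_add_le_finrank_add_finrank L1 (Submodule.span k {f0})
    have h6 := finrank_span_singleton (K := k) hf00
    omega

lemma Bd.finrank {E : X.Pl →₀ ℕ} (L : Submodule k K) [FiniteDimensional k L] (h : ∀ f ∈ L, X.Bd E f) :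
    Module.finrank k L ≤ 2 * dg E + 1 := by
  obtain ⟨p⟩ := X.ne
  refine finrank_le p _ L (-(dg E:ℤ)) (fun f hf => ?_) (fun f hf h0 => ?_)
  · by_cases h0 : f = 0
    · exact Or.inl h0
    · exact Or.inr (_root_.abs_le.1 ((h f hf).abs_le h0 p)).1
  · have := (_root_.abs_le.1 ((h f hf).abs_le h0 p)).2
    push_cast; omega

lemma dg_add (E F : X.Pl →₀ ℕ) : dg (E + F) = dg E + dg F :=
  Finsupp.sum_add_index' (fun _ => rfl) (fun _ _ _ => rfl)

lemma dg_nsmul (n : ℕ) (E : X.Pl →₀ ℕ) : dg (n • E) = n * dg E := by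
  induction n with
  | zero => simp [dg]
  | succ n ih => rw [add_smul, one_smul, dg_add, ih]; ring

/-- small growth -/
lemma exists_growth (X : FFD k K) (Z : Finset K) : ∃ (L L' : Submodule k K), FiniteDimensional k L ∧ FiniteDimensional k L' ∧
    0 < Module.finrank k L ∧ Module.finrank k L' ≤ 2 * Module.finrank k L ∧
    ∀ x ∈ L, ∀ z ∈ Z, x * z ∈ L' := by
  let V : Submodule k K := Submodule.span k (insert 1 (Z : Set K))
  have hfg : V.FG := ⟨insert 1 Z, by simp [V]⟩
  have hfd : ∀ n, FiniteDimensional k (V ^ n : Submodule k K) := fun n =>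
    Module.Finite.iff_fg.2 (hfg.pow n)
  have h1V : (1:K) ∈ V := Submodule.subset_span (by simp)
  obtain ⟨E, hE⟩ := exists_Bd_finset (X := X) (insert 1 Z)
  have hVE : ∀ n, ∀ f ∈ (V ^ n : Submodule k K), X.Bd (n • E) f := by
    intro n
    induction n with
    | zero =>
      intro f hf
      rw [pow_zero, Submodule.mem_one] at hf
      obtain ⟨c, rfl⟩ := hf
      exact Bd.const c
    | succ n ih =>
      intro f hf
      rw [pow_succ] at hf
      refine Submodule.mul_induction_on hf (fun x hx y hy => ?_) (fun x y hx hy => hx.add hy)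
      rw [add_smul, one_smul]
      refine (ih x hx).mul ?_
      refine Submodule.span_induction (p := fun y _ => X.Bd E y) ?_ ?_ ?_ ?_ hy
      · intro z hz; exact hE z (by simpa using hz)
      · exact fun p => G.zero
      · intro x y _ _ hx hy; exact hx.add hy
      · intro c x _ hx; rw [Algebra.smul_def]; exact hx.smul c
  have h1n : ∀ n, (1:K) ∈ V ^ n := fun n => by
    simpa using Submodule.pow_mem_pow V h1V n
  have hpos : ∀ n, 0 < Module.finrank k (V ^ n : Submodule k K) := fun n => by
    have := hfd n
    rw [Module.finrank_pos_iff]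
    exact ⟨⟨⟨1, h1n n⟩, 0, fun h => one_ne_zero (congrArg Subtype.val h)⟩⟩
  suffices h : ∃ n, Module.finrank k (V ^ (n+1) : Submodule k K) ≤ 2 * Module.finrank k (V ^ n : Submodule k K) by
    obtain ⟨n, hn⟩ := h
    refine ⟨V ^ n, V ^ (n+1), hfd _, hfd _, hpos n, hn, fun x hx z hz => ?_⟩
    rw [pow_succ]
    exact Submodule.mul_mem_mul hx (Submodule.subset_span (by simp [hz]))
  by_contra hcon
  push Not at hcon
  have hexp : ∀ n, 2 ^ n ≤ Module.finrank k (V ^ n : Submodule k K) := by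
    intro n
    induction n with
    | zero => rw [pow_zero (2:ℕ)]; exact hpos 0
    | succ n ih => have := hcon n; rw [pow_succ]; omega
  have hle : ∀ n, 2 ^ n ≤ 2 * (n * dg E) + 1 := fun n => by
    have := hfd n
    have := Bd.finrank _ (hVE n)
    rw [dg_nsmul] at this
    exact (hexp n).trans this
  set m := dg E
  have h1 := hle (2 * (m + 3))
  have h2 : (m + 3) < 2 ^ (m + 3) := Nat.lt_two_pow_self
  have h3 : (m+3+1)^2 ≤ 2 ^ (2 * (m + 3)) := by
    rw [mul_comm, pow_mul]; exact Nat.pow_le_pow_left h2 2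
  have : m + 4 ≤ 2 ^ (m+3) := by omega
  have h4 : 8 * (m + 1) ≤ 2 ^ (m+3) := by
    rw [pow_add]; have : m < 2 ^ m := Nat.lt_two_pow_self
    omega
  have h5 : (m+4) * (8 * (m+1)) ≤ 2 ^ (2 * (m+3)) := by
    rw [two_mul, pow_add]; exact Nat.mul_le_mul this h4
  nlinarith

end FFD


section rank
variable {R : Type uK} [CommRing R] [IsDomain R] {r : ℕ}

/-- exponent vector -/
noncomputable def ex (e : Fin r → ℕ) : Fin r →₀ ℕ := Finsupp.equivFunOnFinite.symm e

lemma ex_apply (e : Fin r → ℕ) (i : Fin r) : ex e i = e i := rfl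

lemma card_Iic_ex (e : Fin r → ℕ) : (Finset.Iic (ex e)).card = ∏ i, (e i + 1) := by
  rw [Finsupp.card_Iic]
  rw [Finset.prod_subset (Finset.subset_univ _)]
  · simp [ex_apply]
  · intro i _ hi
    simp at hi; simp [hi]

/-- polynomials in a box -/
noncomputable abbrev Bs (R : Type uK) [CommRing R] (e : Fin r → ℕ) : Submodule R (MvPolynomial (Fin r) R) :=
  MvPolynomial.restrictSupport R (Set.Iic (ex e))

lemma mem_Bs (e : Fin r → ℕ) (P : MvPolynomial (Fin r) R) :
    P ∈ Bs R e ↔ ∀ i, P.degreeOf i ≤ e i := by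
  rw [MvPolynomial.mem_restrictSupport_iff]
  simp only [MvPolynomial.degreeOf_le_iff]
  constructor
  · intro h i m hm; exact h hm i
  · intro h m hm i; exact h i m hm

instance (e : Fin r → ℕ) : Module.Free R (Bs R e) :=
  Module.Free.of_basis (MvPolynomial.basisRestrictSupport R (Set.Iic (ex e)))

instance (e : Fin r → ℕ) : Module.Finite R (Bs R e) := by
  have : Finite (Set.Iic (ex e)) := (Finset.Iic (ex e)).finite_toSet.subset (by intro x; simp)
  exact Module.Finite.of_basis (MvPolynomial.basisRestrictSupport R (Set.Iic (ex e)))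

lemma finrank_Bs (e : Fin r → ℕ) : Module.finrank R (Bs R e) = ∏ i, (e i + 1) := by
  rw [Module.finrank_eq_nat_card_basis (MvPolynomial.basisRestrictSupport R (Set.Iic (ex e))),
    ← card_Iic_ex, Nat.card_congr (Equiv.setCongr (Finset.coe_Iic (ex e)).symm)]
  simp

set_option maxHeartbeats 1000000 in
lemma rank_lemma [IsNoetherianRing R] [UniqueFactorizationMonoid R]
    (H G : MvPolynomial (Fin r) R) (hH : H ≠ 0) (hrel : IsRelPrime H G)
    (hdeg : ∀ i, G.degreeOf i ≤ H.degreeOf i) (m : ℕ) (hm : ∀ i, 2 * H.degreeOf i ≤ m) :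
    ∃ (bot : Finset (Fin r →₀ ℕ)) (δ : R) (μ : (Fin r →₀ ℕ) → (Fin r →₀ ℕ) → R)
      (A B : (Fin r →₀ ℕ) → MvPolynomial (Fin r) R), δ ≠ 0 ∧
      (∀ j ∈ Finset.Iic (ex fun _ : Fin r => m), MvPolynomial.monomial j δ =
        ∑ i ∈ bot, MvPolynomial.monomial i (μ j i) + (A j * H + B j * G)) ∧
      bot.card + 2 * ∏ i, (m - H.degreeOf i + 1) ≤ (m + 1) ^ r + ∏ i, (m - 2 * H.degreeOf i + 1) := by
  set f : Fin r → ℕ := fun i => H.degreeOf i with hf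
  set U := Bs R (fun _ : Fin r => m) with hU
  set V := Bs R (fun i => m - f i)
  set V2 := Bs R (fun i => m - 2 * f i)
  let Ψ0 : (V × V) →ₗ[R] MvPolynomial (Fin r) R :=
    (LinearMap.mulRight R H ∘ₗ V.subtype).coprod (LinearMap.mulRight R G ∘ₗ V.subtype)
  have hΨ0 : ∀ x, Ψ0 x = x.1.1 * H + x.2.1 * G := fun x => rfl
  have hΨU : ∀ x, Ψ0 x ∈ U := by
    intro x
    rw [hΨ0]
    have a1 : ∀ (P Q : MvPolynomial (Fin r) R), P ∈ V → (∀ i, Q.degreeOf i ≤ f i) → P * Q ∈ U := by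
      intro P Q hP hQ
      rw [mem_Bs] at hP ⊢
      intro i
      have h1 := MvPolynomial.degreeOf_mul_le i P Q
      have h2 := hP i
      have h3 := hQ i
      have h4 := hm i
      simp only [hf] at h2 h3 h4 ⊢
      omega
    exact U.add_mem (a1 _ _ x.1.2 fun i => le_rfl) (a1 _ _ x.2.2 hdeg)
  let Ψ : (V × V) →ₗ[R] U := Ψ0.codRestrict U hΨU
  have hker : Module.finrank R (LinearMap.ker Ψ) ≤ ∏ i, (m - 2 * f i + 1) := by
    rw [← finrank_Bs (R := R)]
    let Θ : V2 →ₗ[R] (MvPolynomial (Fin r) R × MvPolynomial (Fin r) R) :=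
      (LinearMap.mulRight R (-G) ∘ₗ V2.subtype).prod (LinearMap.mulRight R H ∘ₗ V2.subtype)
    let inc : (LinearMap.ker Ψ) →ₗ[R] (MvPolynomial (Fin r) R × MvPolynomial (Fin r) R) :=
      (V.subtype.prodMap V.subtype) ∘ₗ (LinearMap.ker Ψ).subtype
    have hinc : Function.Injective inc := by
      rintro ⟨⟨⟨a, ha⟩, ⟨b, hb⟩⟩, h⟩ ⟨⟨⟨a', ha'⟩, ⟨b', hb'⟩⟩, h'⟩ he
      simpa [inc] using he
    have hle : LinearMap.range inc ≤ LinearMap.range Θ := by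
      rintro _ ⟨⟨⟨⟨a, ha⟩, ⟨b, hb⟩⟩, h⟩, rfl⟩
      have h0 : a * H + b * G = 0 := by
        have := congrArg Subtype.val (LinearMap.mem_ker.1 h)
        simpa [Ψ, hΨ0] using this
      have hd : H ∣ b := by
        refine hrel.dvd_of_dvd_mul_right (y := b) ⟨-a, ?_⟩
        linear_combination h0
      obtain ⟨c, rfl⟩ := hd
      have hac : a = -(G * c) := by
        have : (a + G * c) * H = 0 := by linear_combination h0
        have := (mul_eq_zero.1 this).resolve_right hH
        linear_combination this
      have hc : c ∈ V2 := by
        rw [mem_Bs] at hb ⊢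
        intro i
        by_cases hc0 : c = 0
        · simp [hc0]
        have h1 := hb i
        rw [MvPolynomial.degreeOf_mul_eq hH hc0] at h1
        simp only [hf] at *
        omega
      refine ⟨⟨c, hc⟩, ?_⟩
      simp [Θ, inc, hac, mul_comm]
    rw [← LinearMap.finrank_range_of_inj hinc]
    refine (Submodule.finrank_mono hle).trans ?_
    exact LinearMap.finrank_range_le Θ
  have hrn := Submodule.finrank_quotient_add_finrank (LinearMap.ker Ψ)
  rw [Ψ.quotKerEquivRange.finrank_eq] at hrn
  rw [Module.finrank_prod, finrank_Bs] at hrn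
  have hq := Submodule.finrank_quotient_add_finrank (LinearMap.range Ψ)
  have hUr : Module.finrank R U = (m + 1) ^ r := by rw [finrank_Bs]; simp
  rw [hUr] at hq
  set J := Finset.Iic (ex fun _ : Fin r => m) with hJ
  have hmonU : ∀ j : J, ∀ a : R, MvPolynomial.monomial j.1 a ∈ U := by
    intro j a
    rw [hU, MvPolynomial.monomial_mem_restrictSupport]
    left; exact Finset.mem_Iic.1 j.2
  let vv : J → (U ⧸ LinearMap.range Ψ) := fun j =>
    (LinearMap.range Ψ).mkQ ⟨MvPolynomial.monomial j.1 1, hmonU j 1⟩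
  obtain ⟨s, hs1, hs2⟩ := exists_maximal_linearIndepOn R vv
  have hcard : s.toFinset.card ≤ Module.finrank R (U ⧸ LinearMap.range Ψ) := by
    have := LinearIndependent.fintype_card_le_finrank hs1
    rwa [← Set.toFinset_card] at this
  have hex : ∀ j : J, ∃ a : R, a ≠ 0 ∧ a • vv j ∈ Submodule.span R (vv '' s) := by
    intro j
    by_cases hj : j ∈ s
    · exact ⟨1, one_ne_zero, by rw [one_smul]; exact Submodule.subset_span ⟨j, hj, rfl⟩⟩
    · exact hs2 j hj
  choose a ha0 ha using hex
  set δ := ∏ j, a j with hδ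
  have hδ0 : δ ≠ 0 := Finset.prod_ne_zero_iff.2 fun j _ => ha0 j
  have key : ∀ j : J, ∃ (μ : J → R) (A B : MvPolynomial (Fin r) R), MvPolynomial.monomial j.1 δ =
      ∑ i ∈ s.toFinset, MvPolynomial.monomial i.1 (μ i) + (A * H + B * G) := by
    intro j
    have h1 : δ • vv j ∈ Submodule.span R (vv '' s) := by
      rw [hδ, ← Finset.mul_prod_erase Finset.univ a (Finset.mem_univ j), mul_comm, mul_smul]
      exact Submodule.smul_mem _ _ (ha j)
    have h2 : vv '' s = vv '' (s.toFinset : Set J) := by simp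
    rw [h2, Submodule.mem_span_image_finset_iff_exists_fun'] at h1
    obtain ⟨μ, hμ⟩ := h1
    have h3 : (LinearMap.range Ψ).mkQ (δ • ⟨MvPolynomial.monomial j.1 1, hmonU j 1⟩ -
        ∑ i ∈ s.toFinset, μ i • ⟨MvPolynomial.monomial i.1 1, hmonU i 1⟩) = 0 := by
      rw [map_sub, map_smul, map_sum, sub_eq_zero]
      simp only [map_smul]
      exact hμ.symm
    rw [Submodule.mkQ_apply, Submodule.Quotient.mk_eq_zero] at h3
    obtain ⟨x, hx⟩ := h3
    refine ⟨μ, x.1.1, x.2.1, ?_⟩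
    have h4 := congrArg Subtype.val hx
    simp only [Submodule.coe_sub, Submodule.coe_smul, AddSubmonoidClass.coe_finsetSum] at h4
    have h5 : (Ψ x).1 = x.1.1 * H + x.2.1 * G := rfl
    rw [h5] at h4
    have h6 : ∀ (i : J) (c : R), MvPolynomial.monomial i.1 c = c • MvPolynomial.monomial i.1 (1:R) := by
      intro i c; rw [MvPolynomial.smul_monomial]; simp
    rw [h4, h6]
    simp only [h6 _ (μ _)]
    ring
  choose μ A B hμ using key
  refine ⟨s.toFinset.map (Function.Embedding.subtype _), δ,
    fun j i => if hj : j ∈ J then (if hi : i ∈ J then μ ⟨j, hj⟩ ⟨i, hi⟩ else 0) else 0,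
    fun j => if hj : j ∈ J then A ⟨j, hj⟩ else 0, fun j => if hj : j ∈ J then B ⟨j, hj⟩ else 0,
    hδ0, fun j hj => ?_, ?_⟩
  · rw [hμ ⟨j, hj⟩, Finset.sum_map]
    simp [hj]
  · rw [Finset.card_map]
    change _ + 2 * ∏ i, (m - f i + 1) ≤ _ + ∏ i, (m - 2 * f i + 1)
    rw [← hUr]
    omega

lemma prod_ineq {ι : Type*} (s : Finset ι) (y : ι → ℝ) (h0 : ∀ i ∈ s, 0 ≤ y i) (h1 : ∀ i ∈ s, y i ≤ 1/2) :
    1 - 2 * ∏ i ∈ s, (1 - y i) + ∏ i ∈ s, (1 - 2 * y i) ≤ (∑ i ∈ s, y i) ^ 2 := by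
  have h2 : ∏ i ∈ s, (1 - 2 * y i) ≤ (∏ i ∈ s, (1 - y i)) ^ 2 := by
    rw [← Finset.prod_pow]
    exact Finset.prod_le_prod (fun i hi => by have := h1 i hi; linarith)
      (fun i hi => by nlinarith [sq_nonneg (y i)])
  have h3 : 1 - ∑ i ∈ s, y i ≤ ∏ i ∈ s, (1 - y i) := by
    clear h2
    induction s using Finset.induction_on with
    | empty => simp
    | insert a s ha ih =>
      rw [Finset.prod_insert ha, Finset.sum_insert ha]
      have ih := ih (fun i hi => h0 i (by simp [hi])) (fun i hi => h1 i (by simp [hi]))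
      have h4 : ∏ i ∈ s, (1 - y i) ≤ 1 := Finset.prod_le_one
        (fun i hi => by have := h1 i (by simp [hi]); linarith)
        (fun i hi => by have := h0 i (by simp [hi]); linarith)
      have := h0 a (by simp)
      nlinarith
  have h4 : ∏ i ∈ s, (1 - y i) ≤ 1 := Finset.prod_le_one (fun i hi => by have := h1 i hi; linarith)
    (fun i hi => by have := h0 i hi; linarith)
  nlinarith

end rank


section defs
variable {K : Type uK} [Field K] {r : ℕ}

/-- monomial in the generators -/
noncomputable def gm (γ : Fin r → K) (j : Fin r →₀ ℕ) : K := ∏ i, γ i ^ j i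

/-- evaluation at `(n, γ^n)` -/
noncomputable def ev (γ : Fin r → K) (n : ℕ) : MvPolynomial (Fin r) (Polynomial K) →+* K :=
  MvPolynomial.eval₂Hom (Polynomial.evalRingHom (n:K)) (fun i => γ i ^ n)

lemma gm_ne_zero {γ : Fin r → K} (hγ : ∀ i, γ i ≠ 0) (j : Fin r →₀ ℕ) : gm γ j ≠ 0 :=
  Finset.prod_ne_zero_iff.2 fun i _ => pow_ne_zero _ (hγ i)

lemma ev_monomial (γ : Fin r → K) (n : ℕ) (j : Fin r →₀ ℕ) (a : Polynomial K) :
    ev γ n (MvPolynomial.monomial j a) = a.eval (n:K) * gm γ j ^ n := by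
  rw [ev, MvPolynomial.eval₂Hom_monomial, Finsupp.prod_fintype _ _ (by simp)]
  simp [gm, ← Finset.prod_pow, ← pow_mul, mul_comm]

lemma ev_eq (γ : Fin r → K) (n : ℕ) (P : MvPolynomial (Fin r) (Polynomial K)) :
    ev γ n P = ∑ j ∈ P.support, (P.coeff j).eval (n:K) * gm γ j ^ n := by
  conv_lhs => rw [P.as_sum]
  rw [map_sum]
  simp only [ev_monomial]
end defs

namespace FFD
variable {k : Type uk} {K : Type uK} [Field k] [Field K] [Algebra k K] {X : FFD k K} {p : X.Pl} {r : ℕ}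

lemma v_gm {γ : Fin r → K} (hγ : ∀ i, γ i ≠ 0) (j : Fin r →₀ ℕ) :
    X.v p (gm γ j) = ∑ i, j i * X.v p (γ i) := by
  rw [gm, v_prod _ _ (fun i _ => pow_ne_zero _ (hγ i))]
  exact Finset.sum_congr rfl fun i _ => v_pow (hγ i) _

lemma v_gm_zero {γ : Fin r → K} (hγ : ∀ i, γ i ≠ 0) (h : ∀ i, X.v p (γ i) = 0) (j : Fin r →₀ ℕ) :
    X.v p (gm γ j) = 0 := by
  rw [v_gm hγ]; simp [h]

lemma G.ev0 {γ : Fin r → K} (hγ : ∀ i, γ i ≠ 0) (h : ∀ i, X.v p (γ i) = 0)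
    (P : MvPolynomial (Fin r) (Polynomial K)) (hP : ∀ j i, X.G p ((P.coeff j).coeff i) 0) (n : ℕ) :
    X.G p (ev γ n P) 0 := by
  rw [ev_eq]
  refine G.sum' _ _ fun j _ => ?_
  have := (G.eval0 _ (hP j) n).mul (G.self (X := X) (p := p) (gm γ j ^ n))
  rw [v_pow (gm_ne_zero hγ j), v_gm_zero hγ h] at this
  simpa using this

/-- bounding divisor for a finite set of polynomials -/
lemma exists_Bd_mv (s : Finset (MvPolynomial (Fin r) (Polynomial K))) :
    ∃ E : X.Pl →₀ ℕ, ∀ P ∈ s, ∀ j i, X.Bd E ((P.coeff j).coeff i) := by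
  obtain ⟨E, hE⟩ := exists_Bd_coeff (X := X) (s.biUnion fun P => P.support.image P.coeff)
  refine ⟨E, fun P hP j i => ?_⟩
  by_cases hj : P.coeff j = 0
  · rw [hj]; exact fun p => by simpa using G.zero
  · exact hE _ (Finset.mem_biUnion.2 ⟨P, hP, Finset.mem_image_of_mem _ (by simpa using hj)⟩) i

lemma Bd.G0 {E : X.Pl →₀ ℕ} {f : K} (h : X.Bd E f) (hp : p ∉ E.support) : X.G p f 0 := by
  have h1 := h p
  have : E p = 0 := by simpa using hp
  rw [this] at h1; simpa using h1

lemma exists_Bd_submodule (L : Submodule k K) [FiniteDimensional k L] :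
    ∃ E : X.Pl →₀ ℕ, ∀ f ∈ L, X.Bd E f := by
  obtain ⟨s, hs⟩ := Module.Finite.iff_fg.1 (inferInstance : FiniteDimensional k L)
  obtain ⟨E, hE⟩ := exists_Bd_finset (X := X) s
  refine ⟨E, fun f hf => ?_⟩
  rw [← hs] at hf
  refine Submodule.span_induction (p := fun y _ => X.Bd E y) ?_ ?_ ?_ ?_ hf
  · intro z hz; exact hE z hz
  · exact fun p => G.zero
  · intro x y _ _ hx hy; exact hx.add hy
  · intro c x _ hx; rw [Algebra.smul_def]; exact hx.smul c

lemma inj_sum {N : ℕ} {Y : Type*} [Fintype Y] (w : Y → ℤ) (b : ℤ) (hb : ∀ y, |w y| ≤ b)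
    (φ : Fin N → Y) (hφ : Function.Injective φ) :
    ∑ y, w y - (Fintype.card Y - N) * b ≤ ∑ s, w (φ s) := by
  have h1 : ∑ s, w (φ s) = ∑ y ∈ Finset.univ.image φ, w y :=
    (Finset.sum_image (fun a _ b _ h => hφ h)).symm
  have h2 := Finset.sum_add_sum_compl (Finset.univ.image φ) w
  have hc : ((Finset.univ.image φ)ᶜ.card : ℤ) = Fintype.card Y - N := by
    have h3 := Finset.card_add_card_compl (Finset.univ.image φ)
    rw [Finset.card_image_of_injective _ hφ, Finset.card_univ, Fintype.card_fin] at h3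
    omega
  have h4 : ∑ y ∈ (Finset.univ.image φ)ᶜ, w y ≤ ((Finset.univ.image φ)ᶜ.card : ℤ) * b := by
    rw [← nsmul_eq_mul]
    exact Finset.sum_le_card_nsmul _ _ _ fun y _ => (le_abs_self _).trans (hb y)
  rw [hc] at h4
  linarith

/-- local height of the generators -/
def kap (X : FFD k K) (γ : Fin r → K) (p : X.Pl) : ℤ := ∑ i, |X.v p (γ i)|

lemma abs_v_gm {γ : Fin r → K} (hγ : ∀ i, γ i ≠ 0) (j : Fin r →₀ ℕ) (m : ℕ) (hj : ∀ i, j i ≤ m) :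
    |X.v p (gm γ j)| ≤ m * X.kap γ p := by
  rw [v_gm hγ, kap, Finset.mul_sum]
  refine (Finset.abs_sum_le_sum_abs _ _).trans (Finset.sum_le_sum fun i _ => ?_)
  rw [abs_mul, Nat.abs_cast]
  exact mul_le_mul_of_nonneg_right (by exact_mod_cast hj i) (abs_nonneg _)

lemma basis_sub {V : Type*} [AddCommGroup V] [Module k V] [FiniteDimensional k V] (Q : Submodule k V) :
    ∃ bs : Fin (Module.finrank k Q) → V, LinearIndependent k bs ∧ ∀ s, bs s ∈ Q := by
  let bs := Module.finBasis k Q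
  exact ⟨fun s => (bs s : V), bs.linearIndependent.map' Q.subtype (Submodule.ker_subtype _), fun s => (bs s).2⟩

lemma ker_vecs {J I : Type*} [Fintype J] [Fintype I] (L L' : Submodule k K) [FiniteDimensional k L]
    [FiniteDimensional k L'] (M : J → I → K) (hmul : ∀ x ∈ L, ∀ j i, x * M j i ∈ L') :
    ∃ (N : ℕ) (bs : Fin N → J → L), LinearIndependent k bs ∧
      (∀ s i, ∑ j, (bs s j : K) * M j i = 0) ∧ N ≤ Fintype.card J * Module.finrank k L ∧
      Fintype.card J * Module.finrank k L ≤ N + Fintype.card I * Module.finrank k L' := by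
  let Φ : (J → L) →ₗ[k] (I → L') :=
    { toFun := fun v i => ⟨∑ j : J, (v j : K) * M j i,
        L'.sum_mem fun j _ => hmul _ (v j).2 _ _⟩
      map_add' := fun v w => by
        ext i; simp [add_mul, Finset.sum_add_distrib]
      map_smul' := fun c v => by
        ext i; simp [Finset.smul_sum] }
  have hrk := LinearMap.finrank_range_add_finrank_ker Φ
  have hker : ∀ v ∈ LinearMap.ker Φ, ∀ i, ∑ j, (v j : K) * M j i = 0 := by
    intro v hv i
    exact congrArg Subtype.val (congrFun (LinearMap.mem_ker.1 hv) i)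
  have hrg : Module.finrank k (LinearMap.range Φ) ≤ Module.finrank k (I → L') := Submodule.finrank_le _
  generalize LinearMap.ker Φ = Q at hrk hker
  have hdom : Module.finrank k (J → L) = Fintype.card J * Module.finrank k L := by
    rw [Module.finrank_pi_fintype]; simp
  have hcod : Module.finrank k (I → L') = Fintype.card I * Module.finrank k L' := by
    rw [Module.finrank_pi_fintype]; simp
  rw [hdom] at hrk
  rw [hcod] at hrg
  obtain ⟨bs, h1, h2⟩ := basis_sub Q
  exact ⟨Module.finrank k Q, bs, h1, fun s => hker _ (h2 s), by omega, by omega⟩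

set_option maxHeartbeats 1000000 in
lemma ram_core [CharZero K] (γ : Fin r → K) (hγ : ∀ i, γ i ≠ 0)
    (hind : ∀ j j' : Fin r →₀ ℕ, j ≠ j' → ∀ c : k, algebraMap k K c ≠ gm γ j / gm γ j')
    (S0 : Finset X.Pl) (hS0 : ∀ p ∉ S0, ∀ i, X.v p (γ i) = 0)
    (H G' : MvPolynomial (Fin r) (Polynomial K)) (m : ℕ)
    (bot : Finset (Fin r →₀ ℕ)) (δ : Polynomial K) (μ : (Fin r →₀ ℕ) → (Fin r →₀ ℕ) → Polynomial K)
    (A B : (Fin r →₀ ℕ) → MvPolynomial (Fin r) (Polynomial K)) (hδ : δ ≠ 0)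
    (hrel : ∀ j ∈ Finset.Iic (ex fun _ : Fin r => m), MvPolynomial.monomial j δ =
        ∑ i ∈ bot, MvPolynomial.monomial i (μ j i) + (A j * H + B j * G')) :
    ∃ (S : Finset X.Pl) (l C n0 : ℕ), S0 ⊆ S ∧ 0 < l ∧ ∀ n ≥ n0, ∀ T : Finset X.Pl, Disjoint S T →
      ∀ g : X.Pl → ℕ, (∀ p ∈ T, X.G p (ev γ n H) (g p) ∧ X.G p (ev γ n G') (g p)) →
      ∃ N : ℕ, N ≤ (m+1)^r * l ∧ (m+1)^r * l ≤ N + 2 * bot.card * l ∧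
        (N * ∑ p ∈ T, g p : ℤ) ≤ n * (((m+1)^r * l - N) * m * ∑ p ∈ S0, X.kap γ p) + N * C := by
  set J := Finset.Iic (ex fun _ : Fin r => m) with hJ
  have hJc : J.card = (m+1)^r := by rw [hJ, card_Iic_ex]; simp
  obtain ⟨L, L', hL, hL', hpos, hle, hmul⟩ := exists_growth X
    ((J ×ˢ bot).biUnion fun x => (μ x.1 x.2).support.image (μ x.1 x.2).coeff)
  set l := Module.finrank k L with hl
  have hmul' : ∀ x ∈ L, ∀ j ∈ J, ∀ i ∈ bot, ∀ n : ℕ, x * (μ j i).eval (n:K) ∈ L' := by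
    intro x hx j hj i hi n
    rw [Polynomial.eval_eq_sum, Polynomial.sum, Finset.mul_sum]
    refine L'.sum_mem fun t ht => ?_
    have h1 := hmul x hx ((μ j i).coeff t) (Finset.mem_biUnion.2 ⟨(j,i), Finset.mem_product.2 ⟨hj, hi⟩,
      Finset.mem_image_of_mem _ ht⟩)
    have : x * ((μ j i).coeff t * (n:K)^t) = ((n:k)^t) • (x * (μ j i).coeff t) := by
      rw [Algebra.smul_def]; simp; ring
    rw [this]; exact L'.smul_mem _ h1
  obtain ⟨E1, hE1⟩ := exists_Bd_submodule (X := X) L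
  obtain ⟨E2, hE2⟩ := exists_Bd_coeff (X := X) {δ}
  have hE2 : ∀ i, X.Bd E2 (δ.coeff i) := hE2 δ (by simp)
  obtain ⟨E3, hE3⟩ := exists_Bd_mv (X := X) (J.image A ∪ J.image B)
  set E := E1 + E2 + E3 with hE
  have hE1 : ∀ f ∈ L, X.Bd E f := fun f hf => (hE1 f hf).mono (by rw [hE, add_assoc]; exact le_self_add)
  have hE2 : ∀ i, X.Bd E (δ.coeff i) := fun i => (hE2 i).mono (by rw [hE, add_right_comm]; exact le_add_self)
  have hEA : ∀ j ∈ J, ∀ t i, X.Bd E (((A j).coeff t).coeff i) := fun j hj t i =>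
    (hE3 (A j) (Finset.mem_union_left _ (Finset.mem_image_of_mem _ hj)) t i).mono le_add_self
  have hEB : ∀ j ∈ J, ∀ t i, X.Bd E (((B j).coeff t).coeff i) := fun j hj t i =>
    (hE3 (B j) (Finset.mem_union_right _ (Finset.mem_image_of_mem _ hj)) t i).mono le_add_self
  set S := S0 ∪ (E.support ∪ X.c_fin.toFinset) with hS
  have hSS : S0 ⊆ S := Finset.subset_union_left
  have hSγ : ∀ p ∉ S, ∀ i, X.v p (γ i) = 0 := fun p hp => hS0 p fun h => hp (hSS h)
  have hSE : ∀ p ∉ S, p ∉ E.support := fun p hp h => hp (by rw [hS]; simp only [Finset.mem_union]; tauto)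
  have hSc : ∀ p ∉ S, X.c p = 0 := fun p hp => by
    by_contra h; exact hp (by rw [hS]; simp only [Finset.mem_union, Set.Finite.mem_toFinset, Set.mem_ofPred_eq]; tauto)
  obtain ⟨n1, hn1⟩ := ind J (gm γ) (fun j _ => gm_ne_zero hγ j) (fun i _ j _ => hind i j) E
  obtain ⟨n2, hn2⟩ := eval_ne_zero δ hδ
  refine ⟨S, l, ∑ p ∈ S, (2 * E p + (m+1)^r * l * (1 + X.c p)), max n1 n2, hSS, hpos, ?_⟩
  intro n hn T hT g hg
  have hδn : δ.eval (n:K) ≠ 0 := hn2 n (by omega)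
  have hδB : X.Bd E (δ.eval (n:K)) := Bd.eval _ hE2 n
  obtain ⟨N, bs, hbs, hker, hN1, hN2⟩ := ker_vecs (J := J) (I := bot) L L' (fun j i => (μ j i).eval (n:K))
    (fun x hx j i => hmul' x hx j j.2 i i.2 n)
  rw [Fintype.card_coe, hJc] at hN1 hN2
  rw [Fintype.card_coe] at hN2
  rw [← hl] at hN1 hN2
  have hrg2 : bot.card * Module.finrank k L' ≤ 2 * bot.card * l := by
    calc _ ≤ bot.card * (2 * l) := Nat.mul_le_mul_left _ hle
      _ = _ := by ring
  refine ⟨N, by omega, by omega, ?_⟩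
  let ℓ : Module.Basis (Fin l) k L := Module.finBasis k L
  let e : J × Fin l → K := fun y => δ.eval (n:K) * (ℓ y.2 : K) * gm γ y.1 ^ n
  let f : Fin N → K := fun s => δ.eval (n:K) * ∑ j : J, (bs s j : K) * gm γ j ^ n
  let cf : Fin N → J × Fin l → k := fun s y => ℓ.repr (bs s y.1) y.2
  have hfe : ∀ s, f s = ∑ y, algebraMap k K (cf s y) * e y := by
    intro s
    rw [Fintype.sum_prod_type]
    simp only [f, Finset.mul_sum]
    refine Finset.sum_congr rfl fun j _ => ?_
    have h1 : (bs s j : K) = ∑ a, algebraMap k K (cf s (j, a)) * (ℓ a : K) := by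
      have h0 := congrArg Subtype.val (ℓ.sum_repr (bs s j))
      rw [← h0]
      simp [Algebra.smul_def, cf, -Module.Basis.sum_repr]
    rw [h1, Finset.sum_mul, Finset.mul_sum]
    exact Finset.sum_congr rfl fun a _ => by simp only [e]; ring
  have hfH : ∀ s, f s = ∑ j : J, (bs s j : K) *
      (ev γ n (A j) * ev γ n H + ev γ n (B j) * ev γ n G') := by
    intro s
    have h1 : ∀ j : J, δ.eval (n:K) * gm γ j ^ n = ∑ i : bot, (μ j i).eval (n:K) * gm γ i ^ n +
        (ev γ n (A j) * ev γ n H + ev γ n (B j) * ev γ n G') := by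
      intro j
      have := congrArg (ev γ n) (hrel j j.2)
      rw [ev_monomial, map_add, map_sum, map_add, map_mul, map_mul] at this
      rw [this, ← Finset.sum_coe_sort bot]
      simp only [ev_monomial]
    have h2 : ∀ i : bot, ∑ j : J, (bs s j : K) * (μ j i).eval (n:K) = 0 := by
      intro i
      exact hker s i
    simp only [f, Finset.mul_sum]
    have h3 : ∀ j : J, δ.eval (n:K) * ((bs s j : K) * gm γ j ^ n) =
        ∑ i : bot, (bs s j : K) * (μ j i).eval (n:K) * gm γ i ^ n +
        (bs s j : K) * (ev γ n (A j) * ev γ n H + ev γ n (B j) * ev γ n G') := by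
      intro j
      rw [mul_left_comm, h1 j, mul_add, Finset.mul_sum]
      simp only [mul_assoc]
    simp only [h3, Finset.sum_add_distrib]
    rw [Finset.sum_comm]
    simp only [← Finset.sum_mul, h2]
    simp
  have hli : LinearIndependent k f := by
    rw [Fintype.linearIndependent_iff]
    intro c hc
    set x : J → L := ∑ s, c s • bs s with hx
    have hx1 : ∀ j : J, (x j : K) = ∑ s, c s • (bs s j : K) := by
      intro j; simp [hx, Finset.sum_apply]
    have hx0 : x = 0 := by
      have h1 : δ.eval (n:K) * ∑ j : J, (x j : K) * gm γ j ^ n = 0 := by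
        rw [← hc]
        simp only [hx1, f, Finset.mul_sum, Finset.sum_mul, Finset.smul_sum]
        rw [Finset.sum_comm]
        refine Finset.sum_congr rfl fun s _ => Finset.sum_congr rfl fun j _ => ?_
        simp only [Algebra.smul_def]; ring
      have h2 := (mul_eq_zero.1 h1).resolve_left hδn
      let a : (Fin r →₀ ℕ) → K := fun j => if hj : j ∈ J then (x ⟨j, hj⟩ : K) else 0
      have h3 := hn1 n (by omega) a (fun j hj => by
        simp only [a, hj, dif_pos]; exact hE1 _ (Subtype.mem _)) (by
        rw [← h2, ← Finset.sum_coe_sort J]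
        exact Finset.sum_congr rfl fun j _ => by simp [a])
      ext j
      have := h3 j j.2
      simpa [a] using this
    have := Fintype.linearIndependent_iff.1 hbs c hx0
    exact this
  have hW := wr_ne_zero (X := X) f hli
  have hT' : ∀ p ∈ T, p ∉ S := fun p hp h => (Finset.disjoint_left.1 hT h) hp
  have hout : ∀ p ∉ S, X.G p (X.wr f) 0 := by
    intro p hp
    simpa using wr_G0 f (hSc p hp) 0 (fun s => by
      simp only [f]
      have h1 : X.G p (∑ j : J, (bs s j : K) * gm γ j ^ n) 0 := by
        refine G.sum' _ _ fun j _ => ?_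
        have := ((hE1 _ (bs s j).2).G0 (hSE p hp)).mul (G.self (X := X) (p := p) (gm γ j ^ n))
        rw [v_pow (gm_ne_zero hγ _), v_gm_zero hγ (hSγ p hp)] at this
        simpa using this
      simpa using (hδB.G0 (hSE p hp)).mul h1)
  have hTg : ∀ p ∈ T, X.G p (X.wr f) (N * g p) := by
    intro p hp
    have hpS := hT' p hp
    refine wr_G0 f (hSc p hpS) (g p) fun s => ?_
    rw [hfH]
    refine G.sum' _ _ fun j _ => ?_
    have h1 := (hE1 _ (bs s j).2).G0 (hSE p hpS)
    have h2 := G.ev0 hγ (hSγ p hpS) (A j) (fun t i => (hEA j j.2 t i).G0 (hSE p hpS)) n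
    have h3 := G.ev0 hγ (hSγ p hpS) (B j) (fun t i => (hEB j j.2 t i).G0 (hSE p hpS)) n
    simpa using h1.mul (((h2.mul (hg p hp).1).add (h3.mul (hg p hp).2)))
  have hin : ∀ p ∈ S, X.G p (X.wr f) ((n * (l * ∑ j : J, X.v p (gm γ j) -
      ((m+1)^r * l - N) * (m * X.kap γ p)) - N * (2 * E p)) - N * N * (1 + X.c p)) := by
    intro p _
    refine wr_expand f e cf hfe (fun y => n * X.v p (gm γ y.1) - 2 * E p) _ ?_ ?_
    · intro y
      refine ((hδB p).mul (hE1 _ (ℓ y.2).2 p)).mul (G.self (X := X) (p := p) (gm γ y.1 ^ n)) |>.mono ?_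
      rw [v_pow (gm_ne_zero hγ _)]; linarith
    · intro φ hφ
      have h1 := inj_sum (fun y : J × Fin l => X.v p (gm γ y.1)) (m * X.kap γ p)
        (fun y => abs_v_gm hγ _ m fun i => by
          have := Finset.mem_Iic.1 y.1.2; exact this i) φ hφ
      rw [Fintype.sum_prod_type] at h1
      simp only [Finset.sum_const, Finset.card_univ, Fintype.card_fin, nsmul_eq_mul, Fintype.card_prod,
        Fintype.card_coe, hJc, ← Finset.mul_sum] at h1
      rw [Finset.sum_sub_distrib, ← Finset.mul_sum]
      simp only [Finset.sum_const, Finset.card_univ, Fintype.card_fin, nsmul_eq_mul]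
      push_cast at h1
      have h2 := mul_le_mul_of_nonneg_left h1 (show (0:ℤ) ≤ n by positivity)
      linarith
  have := sum_zero_le hW S T hT _ _ hout hTg hin
  have hsg : ∀ j, ∑ p ∈ S, X.v p (gm γ j) = 0 := fun j =>
    sum_finset (gm_ne_zero hγ j) S fun p hp => v_gm_zero hγ (hSγ p hp) j
  have hks : ∑ p ∈ S0, X.kap γ p = ∑ p ∈ S, X.kap γ p := by
    refine Finset.sum_subset hSS fun p _ hp => ?_
    simp [kap, hS0 p hp]
  have hNM : (N:ℤ) ≤ (m+1)^r * l := by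
    have : N ≤ (m+1)^r * l := by omega
    exact_mod_cast this
  rw [hks]
  simp only [Finset.sum_sub_distrib, ← Finset.mul_sum] at this
  rw [Finset.sum_comm] at this
  simp only [hsg, Finset.sum_const_zero, mul_zero, zero_sub] at this
  have h7 : (N:ℤ) * ∑ p ∈ S, (((m+1)^r * l * (1 + X.c p) : ℕ):ℤ) ≥ N * N * ∑ p ∈ S, (1 + X.c p : ℤ) := by
    push_cast
    rw [← Finset.mul_sum, mul_assoc (N:ℤ) (N:ℤ)]
    refine mul_le_mul_of_nonneg_left (mul_le_mul_of_nonneg_right hNM ?_) (by positivity)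
    exact Finset.sum_nonneg fun _ _ => by omega
  push_cast at h7 ⊢
  rw [Finset.sum_add_distrib, ← Finset.mul_sum]
  linarith

lemma card_bound (f : Fin r → ℕ) (m c : ℕ) (hm : ∀ i, 2 * f i ≤ m)
    (h : c + 2 * ∏ i, (m - f i + 1) ≤ (m + 1) ^ r + ∏ i, (m - 2 * f i + 1)) :
    (c:ℝ) * (m+1)^2 ≤ (m+1)^r * (∑ i, (f i:ℝ))^2 := by
  have hm1 : (0:ℝ) < m + 1 := by positivity
  have h1 := prod_ineq Finset.univ (fun i : Fin r => (f i:ℝ)/(m+1)) (fun i _ => by positivity)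
    (fun i _ => by
      rw [div_le_iff₀ hm1]
      have : (2 * f i : ℝ) ≤ m := by exact_mod_cast hm i
      linarith)
  have h2 : ((∏ i, (m - f i + 1) : ℕ):ℝ) = (m+1)^r * ∏ i : Fin r, (1 - (f i:ℝ)/(m+1)) := by
    have : ((m:ℝ)+1)^r = ∏ _i : Fin r, ((m:ℝ)+1) := by simp
    rw [this, ← Finset.prod_mul_distrib]
    push_cast
    refine Finset.prod_congr rfl fun i _ => ?_
    rw [Nat.cast_sub (by have := hm i; omega)]
    field_simp; ring
  have h3 : ((∏ i, (m - 2 * f i + 1) : ℕ):ℝ) = (m+1)^r * ∏ i : Fin r, (1 - 2 * ((f i:ℝ)/(m+1))) := by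
    have : ((m:ℝ)+1)^r = ∏ _i : Fin r, ((m:ℝ)+1) := by simp
    rw [this, ← Finset.prod_mul_distrib]
    push_cast
    refine Finset.prod_congr rfl fun i _ => ?_
    rw [Nat.cast_sub (hm i)]
    push_cast
    field_simp; ring
  have h4 : ((c + 2 * ∏ i, (m - f i + 1) : ℕ):ℝ) ≤ (((m + 1) ^ r + ∏ i, (m - 2 * f i + 1) : ℕ):ℝ) := by
    exact_mod_cast h
  rw [Nat.cast_add, Nat.cast_add, Nat.cast_mul, h2, h3] at h4
  push_cast at h4
  rw [← Finset.sum_div, div_pow, le_div_iff₀ (by positivity)] at h1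
  have h5 : (0:ℝ) ≤ (m+1)^r := by positivity
  have h6 := mul_le_mul_of_nonneg_left h1 h5
  have h7 : (c:ℝ) ≤ (m+1)^r * (1 - 2 * ∏ i : Fin r, (1 - (f i:ℝ)/(m+1)) + ∏ i : Fin r, (1 - 2 * ((f i:ℝ)/(m+1)))) := by
    linarith
  calc (c:ℝ) * (m+1)^2 ≤ _ := mul_le_mul_of_nonneg_right h7 (by positivity)
    _ ≤ _ := by linarith

lemma ram [CharZero K] (γ : Fin r → K) (hγ : ∀ i, γ i ≠ 0)
    (hind : ∀ j j' : Fin r →₀ ℕ, j ≠ j' → ∀ c : k, algebraMap k K c ≠ gm γ j / gm γ j')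
    (S0 : Finset X.Pl) (hS0 : ∀ p ∉ S0, ∀ i, X.v p (γ i) = 0)
    (H G' : MvPolynomial (Fin r) (Polynomial K)) (hH : H ≠ 0) (hrel : IsRelPrime H G')
    (hdeg : ∀ i, G'.degreeOf i ≤ H.degreeOf i) (ε : ℝ) (hε : 0 < ε) :
    ∃ (S : Finset X.Pl) (C n0 : ℕ), S0 ⊆ S ∧ ∀ n ≥ n0, ∀ T : Finset X.Pl, Disjoint S T →
      ∀ g : X.Pl → ℕ, (∀ p ∈ T, X.G p (ev γ n H) (g p) ∧ X.G p (ev γ n G') (g p)) →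
      (∑ p ∈ T, (g p : ℝ)) ≤ ε * n + C := by
  set F : ℝ := ∑ i, (H.degreeOf i : ℝ) with hF
  have hF0 : 0 ≤ F := Finset.sum_nonneg fun _ _ => by positivity
  set κ : ℝ := ((∑ p ∈ S0, X.kap γ p : ℤ):ℝ) with hκ
  have hκ0 : 0 ≤ κ := by
    rw [hκ]; exact_mod_cast Finset.sum_nonneg fun _ _ => Finset.sum_nonneg fun _ _ => abs_nonneg _
  obtain ⟨m, hm⟩ := exists_nat_ge (max (2 * F) (4 * F^2 * κ / ε))
  have hm1 : 2 * F ≤ m := (le_max_left _ _).trans hm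
  have hm2 : 4 * F^2 * κ ≤ ε * m := by
    have := (le_max_right _ _).trans hm
    rw [div_le_iff₀ hε] at this; linarith
  have hmi : ∀ i, 2 * H.degreeOf i ≤ m := by
    intro i
    have : (H.degreeOf i : ℝ) ≤ F := Finset.single_le_sum (f := fun i => (H.degreeOf i : ℝ))
      (fun _ _ => by positivity) (Finset.mem_univ i)
    have : (2 * H.degreeOf i : ℝ) ≤ m := by linarith
    exact_mod_cast this
  obtain ⟨bot, δ, μ, A, B, hδ, hr, hc⟩ := rank_lemma H G' hH hrel hdeg m hmi
  have hcb := card_bound _ m bot.card hmi hc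
  rw [← hF] at hcb
  obtain ⟨S, l, C, n0, hS, hl, h⟩ := ram_core γ hγ hind S0 hS0 H G' m bot δ μ A B hδ hr
  refine ⟨S, C, n0, hS, fun n hn T hT g hg => ?_⟩
  obtain ⟨N, hN1, hN2, hN3⟩ := h n hn T hT g hg
  have hN3' : (N:ℝ) * ∑ p ∈ T, (g p:ℝ) ≤ n * (((m+1)^r * l - N) * m * κ) + N * C := by
    rw [hκ]; exact_mod_cast hN3
  have hN2' : ((m:ℝ)+1)^r * l ≤ N + 2 * bot.card * l := by exact_mod_cast hN2
  set M : ℝ := ((m:ℝ)+1)^r with hM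
  have hM0 : 0 < M := by positivity
  have hl0 : (0:ℝ) < l := by exact_mod_cast hl
  set c : ℝ := (bot.card : ℝ)
  have hc0 : 0 ≤ c := by positivity
  have hm0 : (0:ℝ) ≤ m := by positivity
  have hc4 : 4 * c ≤ M := by
    have h1 : c * (m+1)^2 * 4 ≤ M * (m+1)^2 := by
      have : M * (4 * F^2) ≤ M * (m+1)^2 := mul_le_mul_of_nonneg_left (by nlinarith) hM0.le
      linarith
    have : (4 * c) * (m+1)^2 ≤ M * (m+1)^2 := by linarith
    exact le_of_mul_le_mul_right this (by positivity)
  have hcε : 4 * c * m * κ ≤ ε * M := by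
    have h1 : (4 * c * m * κ) * (m+1)^2 ≤ (ε * M) * (m+1)^2 := by
      calc (4 * c * m * κ) * (m+1)^2 = (c * (m+1)^2) * (4 * m * κ) := by ring
        _ ≤ (M * F^2) * (4 * m * κ) := mul_le_mul_of_nonneg_right hcb (by positivity)
        _ = (M * m) * (4 * F^2 * κ) := by ring
        _ ≤ (M * m) * (ε * m) := mul_le_mul_of_nonneg_left hm2 (by positivity)
        _ = (ε * M) * m^2 := by ring
        _ ≤ _ := mul_le_mul_of_nonneg_left (by nlinarith) (by positivity)
    exact le_of_mul_le_mul_right h1 (by positivity)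
  have hNl : M * l ≤ 2 * N := by
    have := mul_le_mul_of_nonneg_right hc4 hl0.le
    linarith
  have hN0 : (0:ℝ) < N := by have := mul_pos hM0 hl0; linarith
  have h5 : (M * l - N) * m * κ ≤ ε * N := by
    have h6 : (M * l - N) * (m * κ) ≤ (2 * c * l) * (m * κ) :=
      mul_le_mul_of_nonneg_right (by linarith) (by positivity)
    have h7 := mul_le_mul_of_nonneg_right hcε hl0.le
    have h8 := mul_le_mul_of_nonneg_left hNl hε.le
    linarith
  have h6 : (N:ℝ) * ∑ p ∈ T, (g p:ℝ) ≤ N * (ε * n + C) := by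
    have := mul_le_mul_of_nonneg_left h5 (show (0:ℝ) ≤ n by positivity)
    linarith
  exact le_of_mul_le_mul_left h6 hN0

end FFD

namespace FFD
variable {k : Type uk} {K : Type uK} [Field k] [Field K] [Algebra k K] {X : FFD k K} {p : X.Pl} {r : ℕ}

/-- coefficientwise derivative -/
noncomputable def pd (X : FFD k K) (a : Polynomial K) : Polynomial K :=
  ∑ i ∈ a.support, Polynomial.monomial i (X.D (a.coeff i))

lemma pd_coeff (a : Polynomial K) (i : ℕ) : (X.pd a).coeff i = X.D (a.coeff i) := by
  rw [pd, Polynomial.finsetSum_coeff]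
  simp only [Polynomial.coeff_monomial]
  rw [Finset.sum_ite_eq']
  split_ifs with h
  · rfl
  · rw [Polynomial.notMem_support_iff.1 h]; simp

lemma pd_add (a b : Polynomial K) : X.pd (a + b) = X.pd a + X.pd b := by
  ext i; simp [pd_coeff]

lemma pd_zero : X.pd (0 : Polynomial K) = 0 := by
  ext i; simp [pd_coeff]

lemma pd_mul (a b : Polynomial K) : X.pd (a * b) = X.pd a * b + a * X.pd b := by
  ext i
  simp only [pd_coeff, Polynomial.coeff_add, Polynomial.coeff_mul, map_sum, Derivation.leibniz,
    smul_eq_mul]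
  rw [← Finset.sum_add_distrib]
  exact Finset.sum_congr rfl fun _ _ => by ring

lemma pd_natDegree (a : Polynomial K) : (X.pd a).natDegree ≤ a.natDegree := by
  rw [Polynomial.natDegree_le_iff_coeff_eq_zero]
  intro i hi
  rw [pd_coeff, Polynomial.coeff_eq_zero_of_natDegree_lt hi, map_zero]

lemma D_natCast (n : ℕ) : X.D (n : K) = 0 := by
  simp

lemma pd_eval (a : Polynomial K) (n : ℕ) : X.D (a.eval (n:K)) = (X.pd a).eval (n:K) := by
  rw [Polynomial.eval_eq_sum, Polynomial.sum, pd, Polynomial.eval_finsetSum, map_sum]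
  refine Finset.sum_congr rfl fun i _ => ?_
  rw [Derivation.leibniz, Derivation.leibniz_pow, D_natCast]
  simp [mul_comm]

/-- logarithmic derivative of a monomial -/
noncomputable def ld (X : FFD k K) (γ : Fin r → K) (j : Fin r →₀ ℕ) : K := ∑ i, j i * (X.D (γ i) / γ i)

lemma ld_add (γ : Fin r → K) (j j' : Fin r →₀ ℕ) : X.ld γ (j + j') = X.ld γ j + X.ld γ j' := by
  simp [ld, add_mul, Finset.sum_add_distrib]

lemma D_prod_pow {ι : Type*} (s : Finset ι) (γ : ι → K) (hγ : ∀ i, γ i ≠ 0) (j : ι → ℕ) :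
    X.D (∏ i ∈ s, γ i ^ j i) = (∑ i ∈ s, j i * (X.D (γ i) / γ i)) * ∏ i ∈ s, γ i ^ j i := by
  induction s using Finset.induction_on with
  | empty => simp
  | insert a s ha ih =>
    rw [Finset.prod_insert ha, Finset.sum_insert ha, Derivation.leibniz, ih, Derivation.leibniz_pow]
    simp only [smul_eq_mul, nsmul_eq_mul]
    have := hγ a
    rcases Nat.eq_zero_or_pos (j a) with h | h
    · simp [h]
    · obtain ⟨t, ht⟩ := Nat.exists_eq_succ_of_ne_zero h.ne'
      rw [ht]; simp only [Nat.succ_sub_one]; rw [pow_succ]; field_simp; push_cast; ring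

lemma D_gm {γ : Fin r → K} (hγ : ∀ i, γ i ≠ 0) (j : Fin r →₀ ℕ) :
    X.D (gm γ j) = X.ld γ j * gm γ j := D_prod_pow _ γ hγ j

/-- twisted coefficient derivative -/
noncomputable def dc (X : FFD k K) (γ : Fin r → K) (j : Fin r →₀ ℕ) (a : Polynomial K) : Polynomial K :=
  X.pd a + Polynomial.X * Polynomial.C (X.ld γ j) * a

lemma dc_add (γ : Fin r → K) (j) (a b : Polynomial K) : X.dc γ j (a + b) = X.dc γ j a + X.dc γ j b := by
  simp only [dc, pd_add]; ring

lemma dc_zero (γ : Fin r → K) (j) : X.dc γ j (0 : Polynomial K) = 0 := by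
  simp [dc, pd_zero]

lemma dc_sum {ι : Type*} (s : Finset ι) (γ : Fin r → K) (j) (a : ι → Polynomial K) :
    X.dc γ j (∑ i ∈ s, a i) = ∑ i ∈ s, X.dc γ j (a i) := by
  induction s using Finset.induction_on with
  | empty => simp [dc_zero]
  | insert t s h ih => rw [Finset.sum_insert h, Finset.sum_insert h, dc_add, ih]

lemma dc_mul (γ : Fin r → K) (j j') (a b : Polynomial K) :
    X.dc γ (j + j') (a * b) = X.dc γ j a * b + a * X.dc γ j' b := by
  simp only [dc, pd_mul, ld_add, map_add]; ring

/-- the derivation on polynomials -/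
noncomputable def dp (X : FFD k K) (γ : Fin r → K) (P : MvPolynomial (Fin r) (Polynomial K)) :
    MvPolynomial (Fin r) (Polynomial K) :=
  ∑ j ∈ P.support, MvPolynomial.monomial j (X.dc γ j (P.coeff j))

lemma dp_coeff (γ : Fin r → K) (P) (j) : (X.dp γ P).coeff j = X.dc γ j (P.coeff j) := by
  rw [dp, MvPolynomial.coeff_sum]
  simp only [MvPolynomial.coeff_monomial]
  rw [Finset.sum_ite_eq']
  split_ifs with h
  · rfl
  · rw [MvPolynomial.notMem_support_iff.1 h, dc_zero]

lemma dp_mul (γ : Fin r → K) (P Q) : X.dp γ (P * Q) = X.dp γ P * Q + P * X.dp γ Q := by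
  ext1 j
  simp only [dp_coeff, MvPolynomial.coeff_add, MvPolynomial.coeff_mul, dc_sum]
  rw [← Finset.sum_add_distrib]
  refine Finset.sum_congr rfl fun x hx => ?_
  rw [← Finset.HasAntidiagonal.mem_antidiagonal.1 hx, dc_mul]

lemma dp_degreeOf (γ : Fin r → K) (P) (i) : (X.dp γ P).degreeOf i ≤ P.degreeOf i := by
  rw [MvPolynomial.degreeOf_le_iff]
  intro j hj
  refine MvPolynomial.monomial_le_degreeOf i ?_
  rw [MvPolynomial.mem_support_iff] at hj ⊢
  intro h
  exact hj (by rw [dp_coeff, h, dc_zero])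

lemma dp_ev {γ : Fin r → K} (hγ : ∀ i, γ i ≠ 0) (P) (n : ℕ) : X.D (ev γ n P) = ev γ n (X.dp γ P) := by
  rw [ev_eq, map_sum, dp, map_sum]
  refine Finset.sum_congr rfl fun j _ => ?_
  rw [ev_monomial, D_mul_pow _ _ (gm_ne_zero hγ j), pd_eval, D_gm hγ, dc]
  have := gm_ne_zero hγ j
  simp only [Polynomial.eval_add, Polynomial.eval_mul, Polynomial.eval_X, Polynomial.eval_C]
  field_simp

lemma deg_eq_C (P : MvPolynomial (Fin r) (Polynomial K)) (h : ∀ i, P.degreeOf i = 0) :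
    P = MvPolynomial.C (P.coeff 0) := by
  ext1 j
  by_cases hj : P.coeff j = 0
  · rw [hj]
    by_cases h0 : j = 0
    · subst h0; simp [hj]
    · rw [MvPolynomial.coeff_C, if_neg (Ne.symm h0)]
  · have : j = 0 := by
      ext i
      have := MvPolynomial.monomial_le_degreeOf i (MvPolynomial.mem_support_iff.2 hj)
      rw [h i] at this
      simpa using this
    rw [this]; simp

/-- a polynomial with two monomials does not divide its derivative -/
lemma not_dvd_dp {γ : Fin r → K} (hγ : ∀ i, γ i ≠ 0)
    (hind : ∀ j j' : Fin r →₀ ℕ, j ≠ j' → ∀ c : k, algebraMap k K c ≠ gm γ j / gm γ j')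
    (P) (hP : 1 < P.support.card) : ¬ P ∣ X.dp γ P := by
  rintro ⟨Q, hQ⟩
  have hP0 : P ≠ 0 := by rintro rfl; simp at hP
  obtain ⟨j1, h1, j2, h2, h12⟩ := Finset.one_lt_card.1 hP
  have hQC : ∃ μ, Q = MvPolynomial.C μ := by
    by_cases hQ0 : Q = 0
    · exact ⟨0, by simp [hQ0]⟩
    refine ⟨_, deg_eq_C Q fun i => ?_⟩
    have := dp_degreeOf (X := X) γ P i
    rw [hQ, MvPolynomial.degreeOf_mul_eq hP0 hQ0] at this
    omega
  obtain ⟨μ, rfl⟩ := hQC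
  have hco : ∀ j, X.dc γ j (P.coeff j) = P.coeff j * μ := fun j => by
    rw [← dp_coeff, hQ, mul_comm, MvPolynomial.coeff_C_mul, mul_comm]
  set a := P.coeff j1 with ha
  set b := P.coeff j2 with hb
  have ha0 : a ≠ 0 := MvPolynomial.mem_support_iff.1 h1
  have hb0 : b ≠ 0 := MvPolynomial.mem_support_iff.1 h2
  have h3 : X.dc γ j1 a * b = X.dc γ j2 b * a := by rw [hco, hco, ← ha, ← hb]; ring
  have hlam : X.ld γ j1 - X.ld γ j2 ≠ 0 := by
    intro h
    obtain ⟨c, hc⟩ := const_of_wr (X := X) (f := gm γ j1) (gm_ne_zero hγ j2) (by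
      rw [D_gm hγ, D_gm hγ]; linear_combination h * gm γ j1 * gm γ j2)
    refine hind j1 j2 h12 c ?_
    rw [eq_div_iff (gm_ne_zero hγ j2)]
    first | exact hc | exact hc.symm
  have h4 : Polynomial.X * Polynomial.C (X.ld γ j1 - X.ld γ j2) * (a * b) =
      X.pd b * a - X.pd a * b := by
    simp only [dc] at h3
    rw [map_sub]; linear_combination h3
  have h5 : (Polynomial.X * Polynomial.C (X.ld γ j1 - X.ld γ j2) * (a * b)).natDegree =
      1 + (a.natDegree + b.natDegree) := by
    rw [Polynomial.natDegree_mul (mul_ne_zero Polynomial.X_ne_zero (Polynomial.C_ne_zero.2 hlam)) (mul_ne_zero ha0 hb0), Polynomial.natDegree_mul ha0 hb0,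
      Polynomial.natDegree_mul_C hlam, Polynomial.natDegree_X]
  have h6 : (X.pd b * a - X.pd a * b).natDegree ≤ a.natDegree + b.natDegree := by
    refine (Polynomial.natDegree_sub_le _ _).trans (max_le ?_ ?_)
    · refine Polynomial.natDegree_mul_le.trans ?_
      have := pd_natDegree (X := X) b; omega
    · refine Polynomial.natDegree_mul_le.trans ?_
      have := pd_natDegree (X := X) a; omega
  rw [← h4, h5] at h6
  omega

lemma relprime_dp {γ : Fin r → K} (hγ : ∀ i, γ i ≠ 0)
    (hind : ∀ j j' : Fin r →₀ ℕ, j ≠ j' → ∀ c : k, algebraMap k K c ≠ gm γ j / gm γ j')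
    (s : Finset (MvPolynomial (Fin r) (Polynomial K))) (hs : ∀ P ∈ s, Prime P)
    (hs2 : ∀ P ∈ s, 1 < P.support.card) (hs3 : ∀ P ∈ s, ∀ Q ∈ s, P ∣ Q → P = Q) :
    IsRelPrime (∏ P ∈ s, P) (X.dp γ (∏ P ∈ s, P)) := by
  intro q hq1 hq2
  by_contra hu
  have hH0 : ∏ P ∈ s, P ≠ 0 := Finset.prod_ne_zero_iff.2 fun P hP => (hs P hP).ne_zero
  have hq0 : q ≠ 0 := fun h => hH0 (by rw [h] at hq1; exact zero_dvd_iff.1 hq1)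
  obtain ⟨π, hπ, hπq⟩ := WfDvdMonoid.exists_irreducible_factor hu hq0
  have hπp := hπ.prime
  obtain ⟨P, hP, hπP⟩ := hπp.exists_mem_finset_dvd (hπq.trans hq1)
  have hass : Associated π P := hπ.associated_of_dvd (hs P hP).irreducible hπP
  have h1 : P ∣ X.dp γ (∏ P ∈ s, P) := (hass.symm.dvd.trans hπq).trans hq2
  rw [← Finset.mul_prod_erase s (fun P => P) hP, dp_mul] at h1
  have h2 := (dvd_add_left (dvd_mul_right P _)).1 h1
  rcases (hs P hP).dvd_or_dvd h2 with h | h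
  · exact not_dvd_dp hγ hind P (hs2 P hP) h
  · obtain ⟨Q, hQ, hPQ⟩ := (hs P hP).exists_mem_finset_dvd h
    rw [Finset.mem_erase] at hQ
    exact hQ.1 (hs3 P hP Q hQ.2 hPQ).symm

lemma ev_ne_zero [CharZero K] {γ : Fin r → K} (hγ : ∀ i, γ i ≠ 0)
    (hind : ∀ j j' : Fin r →₀ ℕ, j ≠ j' → ∀ c : k, algebraMap k K c ≠ gm γ j / gm γ j')
    (X : FFD k K) (P) (hP : P ≠ 0) : ∃ n0 : ℕ, ∀ n ≥ n0, ev γ n P ≠ 0 := by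
  obtain ⟨E, hE⟩ := exists_Bd_coeff (X := X) (P.support.image P.coeff)
  obtain ⟨n1, h1⟩ := ind P.support (gm γ) (fun j _ => gm_ne_zero hγ j) (fun i _ j _ => hind i j) E
  obtain ⟨j, hj⟩ := MvPolynomial.ne_zero_iff.1 hP
  obtain ⟨n2, h2⟩ := eval_ne_zero (P.coeff j) hj
  refine ⟨max n1 n2, fun n hn h => ?_⟩
  rw [ev_eq] at h
  exact h2 n (by omega) (h1 n (by omega) (fun j => (P.coeff j).eval (n:K))
    (fun j hj => Bd.eval _ (hE _ (Finset.mem_image_of_mem _ hj)) n) h j (MvPolynomial.mem_support_iff.2 hj))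

lemma factorization (d : ℕ) (hd : 2 ≤ d) (F : MvPolynomial (Fin r) (Polynomial K)) (hF : F ≠ 0) :
    ∃ (c : Polynomial K) (j : Fin r →₀ ℕ) (Q : MvPolynomial (Fin r) (Polynomial K))
      (s : Finset (MvPolynomial (Fin r) (Polynomial K))) (e : MvPolynomial (Fin r) (Polynomial K) → ℕ),
      F = MvPolynomial.monomial j c * Q ^ d * ∏ P ∈ s, P ^ e P ∧ (∀ P ∈ s, Prime P) ∧
      (∀ P ∈ s, 1 < P.support.card) ∧ (∀ P ∈ s, ∀ Q ∈ s, P ∣ Q → P = Q) ∧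
      (∀ P ∈ s, 0 < e P ∧ e P < d) := by
  classical
  let _ : StrongNormalizationMonoid (MvPolynomial (Fin r) (Polynomial K)) := UniqueFactorizationMonoid.strongNormalizationMonoid
  set M := UniqueFactorizationMonoid.normalizedFactors F with hM
  have hpr : ∀ P ∈ M.toFinset, Prime P := fun P hP =>
    UniqueFactorizationMonoid.prime_of_normalized_factor P (Multiset.mem_toFinset.1 hP)
  obtain ⟨u, hu⟩ := UniqueFactorizationMonoid.prod_normalizedFactors hF
  rw [← hM, Finset.prod_multiset_count] at hu
  have h1 : ∏ P ∈ M.toFinset, P ^ M.count P = (∏ P ∈ M.toFinset, P ^ (M.count P / d)) ^ d *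
      ∏ P ∈ M.toFinset, P ^ (M.count P % d) := by
    rw [← Finset.prod_pow, ← Finset.prod_mul_distrib]
    refine Finset.prod_congr rfl fun P _ => ?_
    rw [← pow_mul, ← pow_add, mul_comm, Nat.div_add_mod]
  have h2 := Finset.prod_filter_mul_prod_filter_not M.toFinset
    (fun P => 0 < M.count P % d ∧ 1 < P.support.card) (fun P => P ^ (M.count P % d))
  have hmon : ∀ t : Finset (MvPolynomial (Fin r) (Polynomial K)), (∀ P ∈ t, ∃ j c, P ^ (M.count P % d) =
      MvPolynomial.monomial j c) → ∃ j c, ∏ P ∈ t, P ^ (M.count P % d) = MvPolynomial.monomial j c := by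
    intro t
    induction t using Finset.induction_on with
    | empty => exact fun _ => ⟨0, 1, by simp⟩
    | insert a t ha ih =>
      intro h
      obtain ⟨j, c, hj⟩ := ih fun P hP => h P (by simp [hP])
      obtain ⟨j', c', hj'⟩ := h a (by simp)
      exact ⟨j' + j, c' * c, by rw [Finset.prod_insert ha, hj, hj', MvPolynomial.monomial_mul]⟩
  obtain ⟨j, c, hjc⟩ := hmon (M.toFinset.filter fun P => ¬ (0 < M.count P % d ∧ 1 < P.support.card)) (by
    intro P hP
    rw [Finset.mem_filter] at hP
    by_cases h0 : 0 < M.count P % d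
    · have h3 : P.support.card ≤ 1 := by
        have := hP.2; push Not at this; exact this h0
      have : ∃ j c, P = MvPolynomial.monomial j c := by
        obtain ⟨j, hj⟩ := Finset.card_le_one_iff_subset_singleton.1 h3
        refine ⟨j, P.coeff j, ?_⟩
        ext1 i
        rw [MvPolynomial.coeff_monomial]
        split_ifs with h
        · rw [h]
        · by_contra h5
          exact h (Finset.mem_singleton.1 (hj (MvPolynomial.mem_support_iff.2 h5))).symm
      obtain ⟨j, c, h⟩ := this
      refine ⟨(M.count P % d) • j, c ^ (M.count P % d), ?_⟩
      generalize M.count P % d = t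
      rw [h, MvPolynomial.monomial_pow]
    · exact ⟨0, 1, by rw [Nat.eq_zero_of_not_pos h0]; simp⟩)
  obtain ⟨u', hu', huC⟩ := MvPolynomial.isUnit_iff_eq_C_of_isReduced.1 u.isUnit
  refine ⟨c * u', j, ∏ P ∈ M.toFinset, P ^ (M.count P / d), M.toFinset.filter fun P => 0 < M.count P % d ∧ 1 < P.support.card,
    fun P => M.count P % d, ?_, ?_, ?_, ?_, ?_⟩
  · rw [← hu, h1, ← h2, hjc, huC, mul_comm c u', ← MvPolynomial.C_mul_monomial]
    ring
  · intro P hP; exact hpr P (Finset.mem_filter.1 hP).1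
  · intro P hP; exact (Finset.mem_filter.1 hP).2.2
  · intro P hP Q hQ hPQ
    have h3 := (Finset.mem_filter.1 hP).1
    have h4 := (Finset.mem_filter.1 hQ).1
    have := (hpr P h3).irreducible.associated_of_dvd (hpr Q h4).irreducible hPQ
    exact UniqueFactorizationMonoid.mem_normalizedFactors_eq_of_associated (Multiset.mem_toFinset.1 h3)
      (Multiset.mem_toFinset.1 h4) this
  · intro P hP; exact ⟨(Finset.mem_filter.1 hP).2.1, Nat.mod_lt _ (by omega)⟩

end FFD

namespace FFD
variable {k : Type uk} {K : Type uK} [Field k] [Field K] [Algebra k K] {X : FFD k K} {p : X.Pl} {r : ℕ}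

lemma low' [CharZero K] {γ : Fin r → K} (hγ : ∀ i, γ i ≠ 0)
    (hind : ∀ j j' : Fin r →₀ ℕ, j ≠ j' → ∀ c : k, algebraMap k K c ≠ gm γ j / gm γ j')
    (P) (hP : 1 < P.support.card) (S : Finset X.Pl)
    (hSg : ∀ p ∉ S, ∀ i, X.v p (γ i) = 0) (hSc : ∀ p ∉ S, X.c p = 0)
    (hSA : ∀ p ∉ S, ∀ j i, X.G p ((P.coeff j).coeff i) 0) :
    ∃ (C : ℤ) (n0 : ℕ), ∀ n ≥ n0, ∑ p ∈ S, X.v p (ev γ n P) ≤ C - n := by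
  set e := P.support.equivFin.symm with he
  obtain ⟨C, n0, h⟩ := low (X := X) (fun t : Fin P.support.card => gm γ (e t)) (fun t => gm_ne_zero hγ _)
    (fun i j hij => hind _ _ fun h => hij (e.injective (Subtype.ext h)))
    (fun t => P.coeff (e t)) (fun t => MvPolynomial.mem_support_iff.1 (e t).2) hP S
    (fun p hp t => v_gm_zero hγ (hSg p hp) _) hSc (fun p hp t i => hSA p hp _ i)
  refine ⟨C, n0, fun n hn => ?_⟩
  have h1 := (h n hn).2
  have h2 : ev γ n P = ∑ t, (P.coeff (e t)).eval (n:K) * gm γ (e t) ^ n := by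
    rw [ev_eq, ← Finset.sum_coe_sort]
    exact (e.sum_comp fun j : P.support => (P.coeff j).eval (n:K) * gm γ j ^ n).symm
  rw [h2]; exact h1

lemma claimA [CharZero K] {γ : Fin r → K} (hγ : ∀ i, γ i ≠ 0)
    (hind : ∀ j j' : Fin r →₀ ℕ, j ≠ j' → ∀ c : k, algebraMap k K c ≠ gm γ j / gm γ j')
    (S0 : Finset X.Pl) (hS0 : ∀ p ∉ S0, ∀ i, X.v p (γ i) = 0) (d : ℕ) (hd : 2 ≤ d)
    (F : MvPolynomial (Fin r) (Polynomial K)) (hF : F ≠ 0)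
    (hinf : {n : ℕ | ∀ p ∉ S0, (d:ℤ) ∣ X.v p (ev γ n F)}.Infinite) :
    ∃ c j Q, F = MvPolynomial.monomial j c * Q ^ d := by
  obtain ⟨c, j, Q, s, e, hFe, hpr, hcard, hass, he⟩ := factorization d hd F hF
  rcases s.eq_empty_or_nonempty with rfl | ⟨P, hPs⟩
  · exact ⟨c, j, Q, by simpa using hFe⟩
  exfalso
  set H := ∏ P ∈ s, P with hH
  have hH0 : H ≠ 0 := Finset.prod_ne_zero_iff.2 fun P hP => (hpr P hP).ne_zero
  have hc0 : c ≠ 0 := by rintro rfl; simp at hFe; exact hF hFe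
  have hQ0 : Q ≠ 0 := by rintro rfl; rw [zero_pow (by omega)] at hFe; simp at hFe; exact hF hFe
  obtain ⟨S1, C1, n1, hS1, hram⟩ := ram γ hγ hind S0 hS0 H (X.dp γ H) hH0
    (relprime_dp hγ hind s hpr hcard hass) (dp_degreeOf γ H) (1/4) (by norm_num)
  obtain ⟨E1, hE1⟩ := exists_Bd_coeff (X := X) {c}
  have hE1 : ∀ i, X.Bd E1 (c.coeff i) := hE1 c (by simp)
  obtain ⟨E2, hE2⟩ := exists_Bd_mv (X := X) (insert Q s)
  set S := S1 ∪ (E1.support ∪ (E2.support ∪ X.c_fin.toFinset)) with hS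
  have hSγ : ∀ p ∉ S, ∀ i, X.v p (γ i) = 0 := fun p hp => hS0 p fun h => hp (by
    rw [hS]; exact Finset.mem_union_left _ (hS1 h))
  have hSE1 : ∀ p ∉ S, p ∉ E1.support := fun p hp h => hp (by rw [hS]; simp only [Finset.mem_union]; tauto)
  have hSE2 : ∀ p ∉ S, p ∉ E2.support := fun p hp h => hp (by rw [hS]; simp only [Finset.mem_union]; tauto)
  have hSc : ∀ p ∉ S, X.c p = 0 := fun p hp => by
    by_contra h; exact hp (by
      rw [hS]; simp only [Finset.mem_union, Set.Finite.mem_toFinset, Set.mem_ofPred_eq]; tauto)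
  obtain ⟨C2, n2, hlow⟩ := low' hγ hind P (hcard P hPs) S hSγ hSc
    (fun p hp j i => (hE2 P (by simp [hPs]) j i).G0 (hSE2 p hp))
  obtain ⟨n3, hn3⟩ := ev_ne_zero hγ hind X Q hQ0
  obtain ⟨n4, hn4⟩ := ev_ne_zero hγ hind X H hH0
  obtain ⟨n5, hn5⟩ := eval_ne_zero c hc0
  obtain ⟨n, hnI, hn⟩ := hinf.exists_gt (n1 + n2 + n3 + n4 + n5 + 2 * (C2.toNat + 2 * C1 + dg E1))
  have hn : n1 + n2 + n3 + n4 + n5 + 2 * (C2.toNat + 2 * C1 + dg E1) < n := hn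
  have hnI : ∀ p ∉ S0, (d:ℤ) ∣ X.v p (ev γ n F) := hnI
  have hQn := hn3 n (by omega)
  have hHn := hn4 n (by omega)
  have hcn := hn5 n (by omega)
  have hHprod : ev γ n H = ∏ P ∈ s, ev γ n P := by rw [hH, map_prod]
  have hPn : ∀ P ∈ s, ev γ n P ≠ 0 := by
    rw [hHprod] at hHn; exact Finset.prod_ne_zero_iff.1 hHn
  have hvP : ∀ p ∉ S, ∀ P ∈ s, 0 ≤ X.v p (ev γ n P) := fun p hp P hP =>
    (G.ev0 hγ (hSγ p hp) P (fun j i => (hE2 P (by simp [hP]) j i).G0 (hSE2 p hp)) n).le (hPn P hP)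
  have hvH : ∀ p, X.v p (ev γ n H) = ∑ P ∈ s, X.v p (ev γ n P) := fun p => by
    rw [hHprod, v_prod _ _ hPn]
  have hvF : ∀ p ∉ S, X.v p (ev γ n F) = X.v p (c.eval (n:K)) + d * X.v p (ev γ n Q) +
      ∑ P ∈ s, e P * X.v p (ev γ n P) := by
    intro p hp
    have h0 : ev γ n F = c.eval (n:K) * gm γ j ^ n * ev γ n Q ^ d * ∏ P ∈ s, ev γ n P ^ e P := by
      rw [hFe, map_mul, map_mul, map_pow, map_prod, ev_monomial]; simp
    have hg := pow_ne_zero n (gm_ne_zero hγ j)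
    rw [h0, X.v_mul, X.v_mul, X.v_mul, v_pow hQn, v_pow (gm_ne_zero hγ j), v_gm_zero hγ (hSγ p hp),
      v_prod _ _ (fun P hP => pow_ne_zero _ (hPn P hP))]
    · rw [mul_zero, add_zero]
      congr 1
      exact Finset.sum_congr rfl fun P hP => v_pow (hPn P hP) _
    · exact hcn
    · exact hg
    · exact mul_ne_zero hcn hg
    · exact pow_ne_zero _ hQn
    · exact mul_ne_zero (mul_ne_zero hcn hg) (pow_ne_zero _ hQn)
    · exact Finset.prod_ne_zero_iff.2 fun P hP => pow_ne_zero _ (hPn P hP)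
  set T := (X.fin _ (hPn P hPs)).toFinset \ S with hT
  have hTm : ∀ p, p ∈ T ↔ X.v p (ev γ n P) ≠ 0 ∧ p ∉ S := fun p => by simp [hT]
  have hTS : ∀ p ∈ T, p ∉ S := fun p hp => ((hTm p).1 hp).2
  let g : X.Pl → ℕ := fun p => (X.v p (ev γ n H) - 1).toNat
  have hPH : ∀ p ∈ T, 1 ≤ X.v p (ev γ n P) ∧ X.v p (ev γ n P) ≤ X.v p (ev γ n H) := by
    intro p hp
    have h1 := hvP p (hTS p hp)
    refine ⟨by have := ((hTm p).1 hp).1; have := h1 P hPs; omega, ?_⟩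
    rw [hvH]
    exact Finset.single_le_sum h1 hPs
  have hsumT : (n:ℤ) - C2 ≤ ∑ p ∈ T, X.v p (ev γ n P) := by
    have h1 := hlow n (by omega)
    have h2 := sum_finset (hPn P hPs) (S ∪ T) (by
      intro p hp
      rw [Finset.mem_union, hTm] at hp
      by_contra h; tauto)
    rw [Finset.sum_union (Finset.disjoint_left.2 fun p h1 h2 => hTS p h2 h1)] at h2
    linarith
  have hcv : ∀ p ∈ T, 0 ≤ X.v p (c.eval (n:K)) := fun p hp =>
    ((Bd.eval c hE1 n).G0 (hSE1 p (hTS p hp))).le hcn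
  have hpt : ∀ p ∈ T, X.v p (ev γ n P) ≤ 2 * g p + X.v p (c.eval (n:K)) := by
    intro p hp
    obtain ⟨h1, h2⟩ := hPH p hp
    have h3 := hcv p hp
    have hg : (g p : ℤ) = X.v p (ev γ n H) - 1 := Int.toNat_of_nonneg (by omega)
    rw [hg]
    by_contra hlt
    push Not at hlt
    have h4 : X.v p (ev γ n H) = 1 := by omega
    have h5 : X.v p (ev γ n P) = 1 := by omega
    have h6 : X.v p (c.eval (n:K)) = 0 := by omega
    have h7 : ∀ P' ∈ s, P' ≠ P → X.v p (ev γ n P') = 0 := by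
      intro P' hP' hne
      have h8 := Finset.add_sum_erase s (fun P => X.v p (ev γ n P)) hPs
      rw [← hvH, h4] at h8
      have h9 : ∑ P' ∈ s.erase P, X.v p (ev γ n P') = 0 := by linarith
      exact (Finset.sum_eq_zero_iff_of_nonneg (fun P' hP' => hvP p (hTS p hp) P'
        (Finset.mem_of_mem_erase hP'))).1 h9 P' (Finset.mem_erase.2 ⟨hne, hP'⟩)
    have h8 := hnI p (fun h => hTS p hp (by rw [hS]; exact Finset.mem_union_left _ (hS1 h)))
    rw [hvF p (hTS p hp), h6, Finset.sum_eq_single P (fun P' hP' hne => by rw [h7 P' hP' hne, mul_zero])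
      (fun h => absurd hPs h), h5, zero_add, mul_one] at h8
    have h9 := (dvd_add_right (dvd_mul_right (d:ℤ) _)).1 h8
    have h10 := Nat.le_of_dvd (he P hPs).1 (by exact_mod_cast h9)
    have := (he P hPs).2
    omega
  have hgT := hram n (by omega) T (Finset.disjoint_left.2 fun p h1 h2 => hTS p h2 (by
      rw [hS]; exact Finset.mem_union_left _ h1)) g (by
    intro p hp
    obtain ⟨h1, h2⟩ := hPH p hp
    have hg : (g p : ℤ) = X.v p (ev γ n H) - 1 := Int.toNat_of_nonneg (by omega)
    rw [hg]
    refine ⟨(G.self _).mono (by omega), ?_⟩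
    rw [← dp_ev hγ]
    have := (G.self (X := X) (p := p) (ev γ n H)).deriv
    rw [hSc p (hTS p hp)] at this
    simpa using this)
  have hcs := (Bd.eval c hE1 n).le_dg hcn T hcv
  have h1 := Finset.sum_le_sum hpt
  rw [Finset.sum_add_distrib, ← Finset.mul_sum] at h1
  have h2 : (n:ℤ) - C2 ≤ 2 * ∑ p ∈ T, (g p:ℤ) + dg E1 := by linarith
  have h3 : (n:ℝ) - C2 ≤ 2 * ∑ p ∈ T, (g p:ℝ) + dg E1 := by exact_mod_cast h2
  have h4 : (C2:ℝ) ≤ C2.toNat := by exact_mod_cast Int.self_le_toNat C2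
  have h5 : ((n1 + n2 + n3 + n4 + n5 + 2 * (C2.toNat + 2 * C1 + dg E1) : ℕ):ℝ) < n := by exact_mod_cast hn
  push_cast at h5
  have h6 : (0:ℝ) ≤ n1 + n2 + n3 + n4 + n5 := by positivity
  linarith

end FFD

namespace FFD
variable {k : Type uk} {K : Type uK} [Field k] [Field K] [Algebra k K] {X : FFD k K} {p : X.Pl} {r : ℕ}

lemma D_alg (c : k) : X.D (algebraMap k K c) = 0 := X.D.map_algebraMap c

lemma pd_zero_of_units [CharZero K] (P : Polynomial K) (hP : P.Monic) (S : Finset X.Pl)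
    (hI : {n : ℕ | P.eval (n:K) ≠ 0 ∧ ∀ p ∉ S, X.v p (P.eval (n:K)) = 0}.Infinite) : X.pd P = 0 := by
  set I := {n : ℕ | P.eval (n:K) ≠ 0 ∧ ∀ p ∉ S, X.v p (P.eval (n:K)) = 0} with hIdef
  obtain ⟨E, hE⟩ := exists_Bd_coeff (X := X) {P}
  have hE : ∀ i, X.Bd E (P.coeff i) := hE P (by simp)
  have hab : ∀ n ∈ I, ∀ p, X.v p (P.eval (n:K)) ∈ Finset.Icc (-(dg E:ℤ)) (dg E) := fun n hn p => by
    rw [Finset.mem_Icc, ← _root_.abs_le]; exact (Bd.eval P hE n).abs_le hn.1 p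
  have : Infinite I := hI.to_subtype
  obtain ⟨y, hy⟩ := Finite.exists_infinite_fiber
    (fun n : I => fun p : S => (⟨X.v p (P.eval ((n:ℕ):K)), hab n n.2 p⟩ : Finset.Icc (-(dg E:ℤ)) (dg E)))
  obtain ⟨⟨n0, hn0⟩⟩ := hy.nonempty
  set w := P.eval ((n0:ℕ):K) with hw
  have hw0 : w ≠ 0 := n0.2.1
  have hz : X.pd (Polynomial.C w⁻¹ * P) = 0 := by
    by_contra hne
    obtain ⟨N, hN⟩ := eval_ne_zero _ hne
    obtain ⟨⟨n, hn⟩, hnN⟩ : ∃ m : ((fun n : I => fun p : S => (⟨X.v p (P.eval ((n:ℕ):K)), hab n n.2 p⟩ : Finset.Icc (-(dg E:ℤ)) (dg E))) ⁻¹' {y}), N ≤ (m:I).1 := by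
      by_contra hcon
      push Not at hcon
      have : Function.Injective (fun m : ((fun n : I => fun p : S => (⟨X.v p (P.eval ((n:ℕ):K)), hab n n.2 p⟩ : Finset.Icc (-(dg E:ℤ)) (dg E))) ⁻¹' {y}) => (⟨(m:I).1, hcon m⟩ : Fin N)) := by
        intro a b h
        simp only [Fin.mk.injEq] at h
        exact Subtype.ext (Subtype.ext h)
      exact not_finite_iff_infinite.2 hy (Finite.of_injective _ this)
    apply hN n hnN
    rw [← pd_eval]
    have hc : ∃ c : k, algebraMap k K c = w⁻¹ * P.eval ((n:ℕ):K) := by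
      refine X.const_of _ (mul_ne_zero (inv_ne_zero hw0) n.2.1) fun p => ?_
      rw [X.v_mul _ _ _ (inv_ne_zero hw0) n.2.1, v_inv hw0]
      by_cases hp : p ∈ S
      · have h1 := congrFun (hn.trans hn0.symm) ⟨p, hp⟩
        simp only [Subtype.mk.injEq] at h1
        rw [h1]; simp [hw]
      · rw [n.2.2 p hp, hw, n0.2.2 p hp]; simp
    obtain ⟨c, hc⟩ := hc
    rw [Polynomial.eval_mul, Polynomial.eval_C, ← hc, D_alg]
  have h1 : X.D w⁻¹ = 0 := by
    have := congrArg (fun q => q.coeff P.natDegree) hz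
    simpa [pd_coeff, hP.coeff_natDegree] using this
  have h2 : X.pd (Polynomial.C w⁻¹) = 0 := by
    ext i; rw [pd_coeff, Polynomial.coeff_C]; split_ifs <;> simp [h1]
  rw [pd_mul, h2, zero_mul, zero_add] at hz
  exact (mul_eq_zero.1 hz).resolve_left (by simpa using hw0)

lemma pd_deg_lt (P : Polynomial K) (hP : P.Monic) (h : X.pd P ≠ 0) : (X.pd P).natDegree < P.natDegree := by
  refine lt_of_le_of_ne (pd_natDegree P) fun h1 => ?_
  have h2 : (X.pd P).leadingCoeff = 0 := by
    rw [Polynomial.leadingCoeff, h1, pd_coeff, hP.coeff_natDegree]; simp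
  exact h (Polynomial.leadingCoeff_eq_zero.1 h2)

lemma lift_const (P : Polynomial K) (h : X.pd P = 0) : ∃ R : Polynomial k, R.map (algebraMap k K) = P := by
  have : P ∈ Polynomial.lifts (algebraMap k K) := by
    rw [Polynomial.lifts_iff_coeff_lifts]
    intro i
    have := congrArg (fun q => q.coeff i) h
    simp only [pd_coeff, Polynomial.coeff_zero] at this
    exact X.ker _ this
  exact (Polynomial.mem_lifts _).1 this

lemma dvd_count [CharZero K] (s : Finset (Polynomial K)) (e : Polynomial K → ℕ) (κ : K) (hκ : κ ≠ 0)
    (hs : ∀ P ∈ s, P.Monic ∧ Irreducible P) (S0 : Finset X.Pl) (d : ℕ)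
    (hinf : {n : ℕ | ∀ p ∉ S0, (d:ℤ) ∣ X.v p (κ * ∏ P ∈ s, P.eval (n:K) ^ e P)}.Infinite)
    (P : Polynomial K) (hP : P ∈ s) (hpd : X.pd P ≠ 0) : d ∣ e P := by
  by_contra hnd
  apply hpd
  set Z := X.pd P * ∏ P' ∈ s.erase P, P' with hZ
  have hcop : IsCoprime P Z := by
    refine IsCoprime.mul_right ?_ (IsCoprime.prod_right fun P' hP' => ?_)
    · rw [(hs P hP).2.coprime_iff_not_dvd]
      intro h
      have := Polynomial.natDegree_le_of_dvd h hpd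
      have := pd_deg_lt P (hs P hP).1 hpd
      omega
    · rw [Finset.mem_erase] at hP'
      rw [(hs P hP).2.coprime_iff_not_dvd]
      intro h
      have h1 := (hs P hP).2.associated_of_dvd (hs P' hP'.2).2 h
      exact hP'.1 (Polynomial.eq_of_monic_of_associated (hs P hP).1 (hs P' hP'.2).1 h1).symm
  obtain ⟨a, b, hab⟩ := hcop
  obtain ⟨E, hE⟩ := exists_Bd_coeff (X := X) (insert a (insert b (insert (X.pd P) s)))
  set S := S0 ∪ (E.support ∪ (X.c_fin.toFinset ∪ (X.fin κ hκ).toFinset)) with hS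
  apply pd_zero_of_units P (hs P hP).1 S
  obtain ⟨N, hN⟩ := eval_ne_zero_finset s (fun P => P) (fun P hP => (hs P hP).1.ne_zero)
  have hsub : {n : ℕ | ∀ p ∉ S0, (d:ℤ) ∣ X.v p (κ * ∏ P ∈ s, P.eval (n:K) ^ e P)} \ {n | n < N} ⊆
      {n : ℕ | P.eval (n:K) ≠ 0 ∧ ∀ p ∉ S, X.v p (P.eval (n:K)) = 0} := by
    rintro n ⟨hn1, hn2⟩
    simp only [Set.mem_ofPred_eq, not_lt] at hn1 hn2
    have hne : ∀ P ∈ s, P.eval (n:K) ≠ 0 := fun P hP => hN n hn2 P hP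
    refine ⟨hne P hP, fun p hp => ?_⟩
    simp only [hS, Finset.mem_union, not_or, Set.Finite.mem_toFinset, Set.mem_ofPred_eq, not_not] at hp
    obtain ⟨hp0, hpE, hpc, hpκ⟩ := hp
    have hG : ∀ A ∈ insert a (insert b (insert (X.pd P) s)), X.G p (A.eval (n:K)) 0 := fun A hA =>
      (Bd.eval A (hE A hA) n).G0 hpE
    have hPv := (hG P (by simp [hP])).le (hne P hP)
    by_contra hv0
    have hv1 : 1 ≤ X.v p (P.eval (n:K)) := by omega
    have hZn : ¬ X.G p (Z.eval (n:K)) 1 := by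
      intro h
      have h1 : X.G p (1:K) 1 := by
        have h2 := congrArg (Polynomial.eval (n:K)) hab
        simp only [Polynomial.eval_add, Polynomial.eval_mul, Polynomial.eval_one] at h2
        rw [← h2]
        refine G.add ?_ ?_
        · exact ((hG a (by simp)).mul (Or.inr hv1)).mono (by simp)
        · have := ((hG b (by simp)).mul h).mono (m := 1) (by simp)
          simpa [hZ] using this
      have := h1.le one_ne_zero
      rw [v_one] at this; omega
    have hZev : Z.eval (n:K) = X.D (P.eval (n:K)) * ∏ P' ∈ s.erase P, P'.eval (n:K) := by
      rw [hZ, Polynomial.eval_mul, pd_eval, Polynomial.eval_prod]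
    have hothers0 : X.G p (∏ P' ∈ s.erase P, P'.eval (n:K)) 0 := by
      have := G.prod (X := X) (p := p) (s.erase P) (fun P' => P'.eval (n:K)) (fun _ => 0)
        (fun P' hP' => hG P' (by simp [Finset.mem_of_mem_erase hP']))
      simpa using this
    have hD0 : X.G p (X.D (P.eval (n:K))) 0 := by
      rw [pd_eval]; exact hG _ (by simp)
    have hv1' : X.v p (P.eval (n:K)) = 1 := by
      by_contra h
      apply hZn
      rw [hZev]
      have h1 : X.G p (X.D (P.eval (n:K))) 1 := by
        have := (G.self (X := X) (p := p) (P.eval (n:K))).deriv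
        exact this.mono (by rw [hpc]; push_cast; omega)
      exact (h1.mul hothers0).mono (by simp)
    have hoth : ∀ P' ∈ s.erase P, X.v p (P'.eval (n:K)) = 0 := by
      intro P' hP'
      by_contra h
      have h0 := (hG P' (by simp [Finset.mem_of_mem_erase hP'])).le (hne P' (Finset.mem_of_mem_erase hP'))
      apply hZn
      rw [hZev]
      have h1 : X.G p (∏ P' ∈ s.erase P, P'.eval (n:K)) 1 := by
        right
        rw [v_prod _ _ fun P' hP' => hne P' (Finset.mem_of_mem_erase hP')]
        refine le_trans (by omega : 1 ≤ X.v p (P'.eval (n:K))) (Finset.single_le_sum (f := fun P' : Polynomial K => X.v p (P'.eval (n:K))) (fun Q hQ => ?_) hP')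
        exact (hG Q (by simp [Finset.mem_of_mem_erase hQ])).le (hne Q (Finset.mem_of_mem_erase hQ))
      exact (hD0.mul h1).mono (by simp)
    have hfin := hn1 p hp0
    rw [X.v_mul p _ _ hκ (Finset.prod_ne_zero_iff.2 fun P hP => pow_ne_zero _ (hne P hP)), hpκ, zero_add,
      v_prod _ _ (fun P hP => pow_ne_zero _ (hne P hP)), ← Finset.add_sum_erase _ _ hP,
      Finset.sum_eq_zero (s := s.erase P), v_pow (hne P hP), hv1'] at hfin
    · apply hnd; exact_mod_cast (by simpa using hfin : (d:ℤ) ∣ (e P:ℤ))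
    · intro P' hP'; rw [v_pow (hne P' (Finset.mem_of_mem_erase hP')), hoth P' hP', mul_zero]
  exact (hinf.sdiff (Set.finite_lt_nat N)).mono hsub

lemma claimB [CharZero K] (c : Polynomial K) (hc : c ≠ 0) (S0 : Finset X.Pl) (d : ℕ)
    (hinf : {n : ℕ | ∀ p ∉ S0, (d:ℤ) ∣ X.v p (c.eval (n:K))}.Infinite) :
    ∃ (κ : K) (R : Polynomial k) (q : Polynomial K), c = Polynomial.C κ * R.map (algebraMap k K) * q ^ d := by
  set M := UniqueFactorizationMonoid.normalizedFactors c with hM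
  set s := M.toFinset with hs
  have hprod : c = Polynomial.C c.leadingCoeff * ∏ P ∈ s, P ^ M.count P := by
    rw [← Finset.prod_multiset_count]
    exact (Polynomial.leadingCoeff_mul_prod_normalizedFactors c).symm
  have hsP : ∀ P ∈ s, P.Monic ∧ Irreducible P := by
    intro P hP
    rw [hs, Multiset.mem_toFinset] at hP
    have h1 := UniqueFactorizationMonoid.irreducible_of_normalized_factor P hP
    exact ⟨(Polynomial.normalize_eq_self_iff_monic h1.ne_zero).1
      (UniqueFactorizationMonoid.normalize_normalized_factor P hP), h1⟩
  have hdv := dvd_count (X := X) s (fun P => M.count P) c.leadingCoeff (by simpa using hc) hsP S0 d (by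
    convert hinf using 6 with n p hp
    conv_rhs => rw [hprod]
    simp [Polynomial.eval_prod])
  have hR : ∀ P : Polynomial K, ∃ R : Polynomial k, X.pd P = 0 → R.map (algebraMap k K) = P := by
    intro P
    by_cases h : X.pd P = 0
    · obtain ⟨R, hR⟩ := lift_const P h; exact ⟨R, fun _ => hR⟩
    · exact ⟨0, fun h' => absurd h' h⟩
  choose R hR using hR
  refine ⟨c.leadingCoeff, ∏ P ∈ s with X.pd P = 0, R P ^ M.count P, ∏ P ∈ s with ¬ X.pd P = 0, P ^ (M.count P / d), ?_⟩
  conv_lhs => rw [hprod]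
  rw [mul_assoc, ← Finset.prod_filter_mul_prod_filter_not s (fun P => X.pd P = 0)]
  congr 2
  · rw [Polynomial.map_prod]
    refine Finset.prod_congr rfl fun P hP => ?_
    rw [Polynomial.map_pow, hR P (Finset.mem_filter.1 hP).2]
  · rw [← Finset.prod_pow]
    refine Finset.prod_congr rfl fun P hP => ?_
    rw [← pow_mul, Nat.div_mul_cancel]
    exact hdv P (Finset.mem_filter.1 hP).1 (Finset.mem_filter.1 hP).2

end FFD

namespace FFD
variable {k : Type uk} {K : Type uK} [Field k] [Field K] [Algebra k K] {X : FFD k K} {p : X.Pl} {r : ℕ}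

lemma exists_gens (X : FFD k K) {ℓ : ℕ} (β : Fin ℓ → Kˣ)
    (hΓ : ∀ γ : Kˣ, γ ∈ Subgroup.closure (Set.range β) → (∃ c : k, algebraMap k K c = γ) → γ = 1) :
    ∃ (r : ℕ) (γ : Fin r → Kˣ), (∀ z : Fin r → ℤ, (∃ c : k, algebraMap k K c = (∏ i, γ i ^ z i : Kˣ)) → z = 0) ∧
      ∀ i, ∃ z : Fin r → ℤ, β i = ∏ j, γ j ^ z j := by
  set Γ := Subgroup.closure (Set.range β) with hΓd
  have hfg : Group.FG Γ := (Group.fg_iff_subgroup_fg Γ).2 ⟨(Set.finite_range β).toFinset, by simp [hΓd]⟩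
  have h1 : AddGroup.FG (Additive Γ) := AddGroup.fg_iff_mul_fg.2 hfg
  have h2 : Module.Finite ℤ (Additive Γ) := Module.Finite.iff_addGroup_fg.2 h1
  have h3 : Module.IsTorsionFree ℤ (Additive Γ) := by
    have : IsMulTorsionFree Γ := by
      refine IsMulTorsionFree.of_not_isOfFinOrder  ?_
      intro a ha hfo
      apply ha
      obtain ⟨n, hn, hn1⟩ := isOfFinOrder_iff_pow_eq_one.1 hfo
      have h0 : ((a:Kˣ):K) ≠ 0 := Units.ne_zero _
      have : (a:Kˣ) = 1 := by
        refine hΓ a a.2 (X.const_of _ h0 fun p => ?_)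
        have h4 : ((a:Kˣ):K) ^ n = 1 := by
          have := congrArg (fun x : Γ => ((x:Kˣ):K)) hn1
          simpa using this
        have h5 := v_pow (X := X) (p := p) h0 n
        rw [h4, v_one] at h5
        have : (n:ℤ) ≠ 0 := by omega
        have := (mul_eq_zero.1 h5.symm).resolve_left this
        omega
      exact Subtype.ext this
    infer_instance
  have h4 : Module.Free ℤ (Additive Γ) := inferInstance
  let b := Module.finBasis ℤ (Additive Γ)
  refine ⟨_, fun i => ((b i).toMul : Γ), ?_, ?_⟩
  · intro z hz
    have h5 : (∏ i, (((b i).toMul : Γ) : Kˣ) ^ z i) = ((∑ i, z i • b i).toMul : Γ) := by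
      simp
    have h6 := hΓ _ (by rw [h5]; exact Subtype.prop _) hz
    rw [h5] at h6
    have h7 : (∑ i, z i • b i) = 0 := by
      exact Additive.toMul.injective (Subtype.ext h6)
    have := Fintype.linearIndependent_iff.1 b.linearIndependent z h7
    funext i; exact this i
  · intro i
    have hi : β i ∈ Γ := Subgroup.subset_closure ⟨i, rfl⟩
    refine ⟨fun j => b.repr (Additive.ofMul ⟨β i, hi⟩) j, ?_⟩
    have h5 := b.sum_repr (Additive.ofMul ⟨β i, hi⟩)
    have h6 := congrArg (fun x : Additive Γ => ((x.toMul : Γ) : Kˣ)) h5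
    refine Eq.trans ?_ (h6.symm.trans ?_)
    · rfl
    · simp only [toMul_sum, toMul_zsmul, Subgroup.val_finsetProd, Subgroup.coe_zpow]

lemma main [CharZero K] (X : FFD k K) 
    (d : ℕ) (hd : 2 ≤ d)
    (ℓ : ℕ) (B : Fin ℓ → Polynomial K) 
    (β : Fin ℓ → K) (hβ : ∀ i, β i ≠ 0)
    (b : ℕ → K) (hb : ∀ n : ℕ, b n = ∑ i, Polynomial.eval (n : K) (B i) * β i ^ n)
    (hΓ : ∀ γ : Kˣ, γ ∈ Subgroup.closure (Set.range fun i => Units.mk0 (β i) (hβ i)) →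
      (∃ c : k, algebraMap k K c = γ) → γ = 1)
    (hpow : {n : ℕ | ∃ y : K, y ^ d = b n}.Infinite) :
    ∃ (r : ℕ) (A : Fin r → Polynomial (AlgebraicClosure K))
      (α : Fin r → AlgebraicClosure K) (R : Polynomial k),
      (∀ i, α i ≠ 0) ∧
      ∀ m : ℕ,
        algebraMap K (AlgebraicClosure K) (b m) =
          algebraMap K (AlgebraicClosure K) (algebraMap k K (Polynomial.eval (m : k) R)) *
            (∑ i, Polynomial.eval ((m : AlgebraicClosure K)) (A i) * α i ^ m) ^ d := by
  obtain ⟨r, γu, hind0, hz⟩ := exists_gens X (fun i => Units.mk0 (β i) (hβ i)) hΓ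
  choose z hz using hz
  set γ : Fin r → K := fun i => γu i with hγd
  have hγ : ∀ i, γ i ≠ 0 := fun i => Units.ne_zero _
  have hind : ∀ j j' : Fin r →₀ ℕ, j ≠ j' → ∀ c : k, algebraMap k K c ≠ gm γ j / gm γ j' := by
    intro j j' hjj c hc
    have h1 := hind0 (fun i => (j i : ℤ) - j' i) ⟨c, by
      rw [hc, gm, gm, ← Finset.prod_div_distrib, Units.coe_prod]
      refine Finset.prod_congr rfl fun i _ => ?_
      rw [Units.val_zpow_eq_zpow_val, zpow_sub₀ (hγ i)]; simp [hγd]⟩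
    apply hjj
    ext i
    have := congrFun h1 i
    simp at this; omega
  let N : ℕ := ∑ i, ∑ j, (z i j).natAbs
  have hN : ∀ i j, -(N:ℤ) ≤ z i j := by
    intro i j
    have h1 : (z i j).natAbs ≤ N :=
      (Finset.single_le_sum (f := fun j => (z i j).natAbs) (fun _ _ => Nat.zero_le _) (Finset.mem_univ j)).trans
      (Finset.single_le_sum (f := fun i => ∑ j, (z i j).natAbs) (fun _ _ => Nat.zero_le _) (Finset.mem_univ i))
    omega
  set g : K := ∏ i, γ i ^ (-(N:ℤ)) with hg
  have hg0 : g ≠ 0 := Finset.prod_ne_zero_iff.2 fun i _ => zpow_ne_zero _ (hγ i)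
  let J : Fin ℓ → (Fin r →₀ ℕ) := fun i => ex fun j => (z i j + N).toNat
  have hJ : ∀ i, β i = gm γ (J i) * g := by
    intro i
    have h1 := congrArg (fun x : Kˣ => (x:K)) (hz i)
    simp only [Units.val_mk0] at h1
    rw [h1, gm, hg, ← Finset.prod_mul_distrib, Units.coe_prod]
    refine Finset.prod_congr rfl fun j _ => ?_
    rw [Units.val_zpow_eq_zpow_val, ← zpow_natCast, ← zpow_add₀ (hγ j)]
    congr 1
    simp only [J, ex_apply]
    have := hN i j
    omega
  let F : MvPolynomial (Fin r) (Polynomial K) := ∑ i, MvPolynomial.monomial (J i) (B i)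
  have hbF : ∀ n, b n = ev γ n F * g ^ n := by
    intro n
    rw [hb, map_sum, Finset.sum_mul]
    refine Finset.sum_congr rfl fun i _ => ?_
    rw [ev_monomial, hJ i, mul_pow]; ring
  by_cases hF : F = 0
  · refine ⟨0, fun _ => 0, fun _ => 1, 0, fun i => i.elim0, fun m => ?_⟩
    rw [hbF, hF]; simp
  let S0 : Finset X.Pl := Finset.univ.biUnion fun i => (X.fin (γ i) (hγ i)).toFinset
  have hS0 : ∀ p ∉ S0, ∀ i, X.v p (γ i) = 0 := by
    intro p hp i
    by_contra h
    exact hp (Finset.mem_biUnion.2 ⟨i, Finset.mem_univ _, by simpa using h⟩)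
  have hvg : ∀ p ∉ S0, X.v p g = 0 := by
    intro p hp
    rw [hg, v_prod _ _ fun i _ => zpow_ne_zero _ (hγ i)]
    refine Finset.sum_eq_zero fun i _ => ?_
    rw [v_zpow (hγ i), hS0 p hp i, mul_zero]
  obtain ⟨n0, hn0⟩ := ev_ne_zero hγ hind X F hF
  have hinf0 : {n : ℕ | ev γ n F ≠ 0 ∧ ∀ p ∉ S0, (d:ℤ) ∣ X.v p (ev γ n F)}.Infinite := by
    refine (hpow.sdiff (Set.finite_lt_nat n0)).mono ?_
    rintro n ⟨⟨y, hy⟩, hn⟩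
    simp only [Set.mem_ofPred_eq, not_lt] at hn
    have h1 := hn0 n hn
    refine ⟨h1, fun p hp => ?_⟩
    have hgn := pow_ne_zero n hg0
    rw [hbF] at hy
    have hy0 : y ≠ 0 := by
      rintro rfl
      rw [zero_pow (by omega)] at hy
      exact mul_ne_zero h1 hgn hy.symm
    have h2 := congrArg (X.v p) hy
    rw [v_pow hy0, X.v_mul _ _ _ h1 hgn, v_pow hg0, hvg p hp, mul_zero, add_zero] at h2
    exact ⟨_, h2.symm⟩
  obtain ⟨c, j, Q, hFQ⟩ := claimA hγ hind S0 hS0 d hd F hF (hinf0.mono fun n hn => hn.2)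
  have hc0 : c ≠ 0 := by rintro rfl; simp at hFQ; exact hF hFQ
  have hFn : ∀ n, ev γ n F = c.eval (n:K) * gm γ j ^ n * ev γ n Q ^ d := by
    intro n; rw [hFQ, map_mul, map_pow, ev_monomial]
  obtain ⟨κ, R, q, hcq⟩ := claimB (X := X) c hc0 S0 d (hinf0.mono (by
    rintro n ⟨h1, h2⟩ p hp
    have h3 := h2 p hp
    rw [hFn] at h1 h3
    have h4 := left_ne_zero_of_mul (left_ne_zero_of_mul h1)
    have h5 := right_ne_zero_of_mul (left_ne_zero_of_mul h1)
    have h6 := right_ne_zero_of_mul h1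
    have h7 : ev γ n Q ≠ 0 := by rintro h; rw [h, zero_pow (by omega)] at h6; exact h6 rfl
    rw [X.v_mul _ _ _ (mul_ne_zero h4 h5) h6, X.v_mul _ _ _ h4 h5, v_pow (gm_ne_zero hγ j),
      v_gm_zero hγ (hS0 p hp), v_pow h7, mul_zero, add_zero] at h3
    exact (dvd_add_left (dvd_mul_right (d:ℤ) _)).1 h3))
  set L := AlgebraicClosure K
  let φ := algebraMap K L
  obtain ⟨κ', hκ'⟩ := IsAlgClosed.exists_pow_nat_eq (φ κ) (n := d) (by omega)
  obtain ⟨α, hα⟩ := IsAlgClosed.exists_pow_nat_eq (φ (gm γ j * g)) (n := d) (by omega)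
  have hα0 : α ≠ 0 := by
    rintro rfl
    rw [zero_pow (by omega)] at hα
    exact mul_ne_zero (gm_ne_zero hγ j) hg0 (by simpa using hα.symm)
  let e := Q.support.equivFin.symm
  refine ⟨Q.support.card, fun i => Polynomial.C κ' * (q * Q.coeff (e i)).map φ, fun i => α * φ (gm γ (e i)), R,
    fun i => mul_ne_zero hα0 (by simpa using gm_ne_zero hγ _), fun m => ?_⟩
  have hmφ : ∀ P : Polynomial K, Polynomial.eval (m:L) (P.map φ) = φ (P.eval (m:K)) := by
    intro P
    rw [Polynomial.eval_map, ← Polynomial.eval₂_at_apply]; simp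
  have hsum : ∑ i, Polynomial.eval (m:L) (Polynomial.C κ' * (q * Q.coeff (e i)).map φ) * (α * φ (gm γ (e i))) ^ m =
      κ' * α ^ m * φ (q.eval (m:K)) * φ (ev γ m Q) := by
    rw [e.sum_comp (fun j : Q.support => Polynomial.eval (m:L) (Polynomial.C κ' * (q * Q.coeff j).map φ) * (α * φ (gm γ j)) ^ m),
      Finset.sum_coe_sort Q.support (fun j => Polynomial.eval (m:L) (Polynomial.C κ' * (q * Q.coeff j).map φ) * (α * φ (gm γ j)) ^ m),
      ev_eq, map_sum, Finset.mul_sum]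
    refine Finset.sum_congr rfl fun j _ => ?_
    rw [Polynomial.eval_mul, Polynomial.eval_C, hmφ, Polynomial.eval_mul, map_mul, map_mul, map_pow, mul_pow]
    ring
  have hRm : (R.map (algebraMap k K)).eval (m:K) = algebraMap k K (R.eval (m:k)) := by
    rw [Polynomial.eval_map, ← Polynomial.eval₂_at_apply]; simp
  rw [hsum, hbF, hFn, hcq]
  simp only [Polynomial.eval_mul, Polynomial.eval_C, Polynomial.eval_pow, hRm]
  have hαm : (α ^ m) ^ d = φ (gm γ j) ^ m * φ g ^ m := by
    rw [← pow_mul, mul_comm m, pow_mul, hα, map_mul, mul_pow]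
  rw [mul_pow, mul_pow, mul_pow, hκ', hαm]
  change φ _ = φ _ * _
  simp only [map_mul, map_pow]
  ring

end FFD


section ffield
open IntermediateField
open scoped IntermediateField.algebraAdjoinAdjoin
variable {k : Type uk} {K : Type uK} [Field k] [Field K] [Algebra k K]

lemma ff_essFin (hK : ∃ t : K, Transcendental k t ∧ FiniteDimensional (IntermediateField.adjoin k {t}) K) :
    Algebra.EssFiniteType k K := by
  obtain ⟨t, -, h⟩ := hK
  have h1 : Algebra.EssFiniteType k (IntermediateField.adjoin k {t}) :=
    IntermediateField.essFiniteType_iff.2 (IntermediateField.fg_adjoin_of_finite (Set.finite_singleton t))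
  exact Algebra.EssFiniteType.comp k (IntermediateField.adjoin k {t}) K

lemma ff_fin (hK : ∃ t : K, Transcendental k t ∧ FiniteDimensional (IntermediateField.adjoin k {t}) K)
    (f : K) (hf : Transcendental k f) : FiniteDimensional (IntermediateField.adjoin k {f}) K := by
  have h0 := ff_essFin hK
  obtain ⟨t, ht, h⟩ := hK
  have h1 : Algebra.IsAlgebraic (Algebra.adjoin k {t}) K :=
    Algebra.IsAlgebraic.trans (Algebra.adjoin k {t}) (IntermediateField.adjoin k {t}) K
  have h2 : Algebra.trdeg k K ≤ 1 := by
    have := Algebra.IsAlgebraic.trdeg_le_cardinalMk k ({t} : Set K)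
    simpa using this
  have h3 : AlgebraicIndependent k (fun _ : Unit => f) := algebraicIndependent_unique_type_iff.2 hf
  have h4 : IsTranscendenceBasis k (fun _ : Unit => f) :=
    AlgebraicIndependent.isTranscendenceBasis_of_lift_trdeg_le_of_finite h3 (by simpa using h2)
  have h5 := h4.isAlgebraic_field
  rw [Set.range_const] at h5
  have h6 : Algebra.EssFiniteType (IntermediateField.adjoin k {f}) K := Algebra.EssFiniteType.of_comp k _ K
  exact Algebra.finite_of_essFiniteType_of_isAlgebraic

lemma const_or_trans [IsAlgClosed k] (f : K) : (∃ c : k, algebraMap k K c = f) ∨ Transcendental k f := by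
  by_cases h : IsAlgebraic k f
  · left
    have h1 := IsAlgClosed.degree_eq_one_of_irreducible k (minpoly.irreducible h.isIntegral)
    exact minpoly.mem_range_of_degree_eq_one k f h1
  · exact Or.inr h

end ffield


section places
open IsDedekindDomain WithZero
variable (k : Type uk) {K : Type uK} [Field k] [Field K] [Algebra k K]

/-- normalized discrete valuations on `K`, trivial on `k` -/
structure IsPlace (v : K → ℤ) : Prop where
  zero : v 0 = 0
  mul : ∀ f g : K, f ≠ 0 → g ≠ 0 → v (f * g) = v f + v g
  add : ∀ f g : K, f ≠ 0 → g ≠ 0 → f + g ≠ 0 → min (v f) (v g) ≤ v (f + g)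
  const : ∀ c : k, c ≠ 0 → v (algebraMap k K c) = 0
  unif : ∃ f : K, f ≠ 0 ∧ v f = 1

variable {k} {v : K → ℤ}

lemma IsPlace.one (hv : IsPlace k v) : v 1 = 0 := by simpa using hv.const 1 one_ne_zero

lemma IsPlace.inv (hv : IsPlace k v) {f : K} (hf : f ≠ 0) : v f⁻¹ = - v f := by
  have := hv.mul f f⁻¹ hf (inv_ne_zero hf)
  rw [mul_inv_cancel₀ hf, hv.one] at this
  omega

lemma IsPlace.div (hv : IsPlace k v) {f g : K} (hf : f ≠ 0) (hg : g ≠ 0) : v (f / g) = v f - v g := by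
  rw [div_eq_mul_inv, hv.mul _ _ hf (inv_ne_zero hg), hv.inv hg]; ring

lemma IsPlace.pow (hv : IsPlace k v) {f : K} (hf : f ≠ 0) (n : ℕ) : v (f ^ n) = n * v f := by
  induction n with
  | zero => simp [hv.one]
  | succ n ih => rw [pow_succ, hv.mul _ _ (pow_ne_zero _ hf) hf, ih]; push_cast; ring

lemma IsPlace.zpow (hv : IsPlace k v) {f : K} (hf : f ≠ 0) (n : ℤ) : v (f ^ n) = n * v f := by
  cases n with
  | ofNat n => simpa using hv.pow hf n
  | negSucc n => rw [zpow_negSucc, hv.inv (pow_ne_zero _ hf), hv.pow hf, Int.negSucc_eq]; push_cast; ring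

/-- the valuation ring -/
def IsPlace.ring (hv : IsPlace k v) : Subalgebra k K where
  carrier := {f | f = 0 ∨ 0 ≤ v f}
  mul_mem' := by
    intro a b ha hb
    by_cases h1 : a = 0
    · left; simp [h1]
    by_cases h2 : b = 0
    · left; simp [h2]
    right
    rw [hv.mul a b h1 h2]
    exact add_nonneg (ha.resolve_left h1) (hb.resolve_left h2)
  add_mem' := by
    intro a b ha hb
    by_cases h1 : a = 0
    · simpa [h1] using hb
    by_cases h2 : b = 0
    · simpa [h2] using ha
    by_cases h3 : a + b = 0
    · exact Or.inl h3
    · exact Or.inr ((le_min (ha.resolve_left h1) (hb.resolve_left h2)).trans (hv.add a b h1 h2 h3))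
  algebraMap_mem' := by
    intro c
    by_cases h : c = 0
    · left; simp [h]
    · right; rw [hv.const c h]

lemma IsPlace.mem_ring (hv : IsPlace k v) (f : K) : f ∈ hv.ring ↔ f = 0 ∨ 0 ≤ v f := Iff.rfl

/-- integral elements are in the valuation ring -/
lemma IsPlace.integral (hv : IsPlace k v) {x : K} (hx : IsIntegral hv.ring x) : x ∈ hv.ring := by
  let W : ValuationSubring K := 
    { hv.ring.toSubring with
      mem_or_inv_mem' := by
        intro x
        by_cases h : x = 0
        · left; exact Or.inl h
        by_cases h2 : 0 ≤ v x
        · left; exact Or.inr h2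
        · right; right; rw [hv.inv h]; omega }
  have h1 : IsIntegral W x := by
    obtain ⟨p, hp, hpx⟩ := hx
    exact ⟨p, hp, hpx⟩
  have := (IsIntegrallyClosed.isIntegral_iff (R := W) (K := K)).1 h1
  obtain ⟨y, rfl⟩ := this
  exact y.2

variable {B : Type uK} [CommRing B] [IsDedekindDomain B] [Algebra B K] [IsFractionRing B K]

/-- additive valuation of a height one prime -/
noncomputable def vP (K : Type uK) [Field K] [Algebra B K] [IsFractionRing B K] (P : HeightOneSpectrum B) (g : K) : ℤ := - log (P.valuation K g)

lemma val_ne (P : HeightOneSpectrum B) {g : K} (hg : g ≠ 0) : P.valuation K g ≠ 0 := by simpa using hg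

lemma vP_nonneg (P : HeightOneSpectrum B) {g : K} (hg : g ≠ 0) : 0 ≤ vP K P g ↔ P.valuation K g ≤ 1 := by
  rw [vP, ← log_le_log (val_ne P hg) one_ne_zero, log_one]; omega

lemma vP_pos (P : HeightOneSpectrum B) {b : B} (hb : b ≠ 0) : 0 < vP K P (algebraMap B K b) ↔ b ∈ P.asIdeal := by
  have hb' : algebraMap B K b ≠ 0 := by simpa using hb
  rw [← HeightOneSpectrum.valuation_lt_one_iff_mem (K := K), vP, ← log_lt_log (val_ne P hb') one_ne_zero, log_one]; omega

lemma vP_place [Algebra k B] [IsScalarTower k B K] (P : HeightOneSpectrum B) : IsPlace k (vP K P) where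
  zero := by simp [vP]
  mul f g hf hg := by
    rw [vP, map_mul, log_mul (val_ne P hf) (val_ne P hg), vP, vP]; ring
  add f g hf hg hfg := by
    have h := (P.valuation K).map_add f g
    rw [vP, vP, vP]
    rcases le_max_iff.1 h with h | h
    · rw [← log_le_log (val_ne P hfg) (val_ne P hf)] at h
      exact (min_le_left _ _).trans (by omega)
    · rw [← log_le_log (val_ne P hfg) (val_ne P hg)] at h
      exact (min_le_right _ _).trans (by omega)
  const c hc := by
    have h1 : IsUnit (algebraMap k B c) := (IsUnit.mk0 c hc).map _
    have h2 : algebraMap k B c ∉ P.asIdeal := fun h => P.isPrime.ne_top (Ideal.eq_top_of_isUnit_mem _ h h1)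
    have := (HeightOneSpectrum.valuation_eq_one_iff_notMem (K := K) P).2 h2
    rw [vP, IsScalarTower.algebraMap_apply k B K, this]; simp
  unif := by
    obtain ⟨π, hπ⟩ := P.valuation_exists_uniformizer K
    refine ⟨π, ?_, ?_⟩
    · rintro rfl; rw [map_zero] at hπ; exact exp_ne_zero hπ.symm
    · rw [vP, hπ]; simp

lemma vP_inj (P Q : HeightOneSpectrum B) (h : vP K P = vP K Q) : P = Q := by
  ext b
  by_cases hb : b = 0
  · simp [hb]
  rw [← vP_pos (K := K) P hb, ← vP_pos (K := K) Q hb, h]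

lemma place_vP (hv : IsPlace k v) (hB : ∀ b : B, algebraMap B K b ∈ hv.ring) :
    ∃ P : HeightOneSpectrum B, v = vP K P := by
  let I : Ideal B :=
    { carrier := {b | b = 0 ∨ 0 < v (algebraMap B K b)}
      zero_mem' := Or.inl rfl
      add_mem' := by
        intro a b ha hb
        by_cases h1 : a = 0
        · simpa [h1] using hb
        by_cases h2 : b = 0
        · simpa [h2] using ha
        by_cases h3 : a + b = 0
        · exact Or.inl h3
        · right
          rw [map_add]
          refine lt_of_lt_of_le (lt_min (ha.resolve_left h1) (hb.resolve_left h2)) (hv.add _ _ ?_ ?_ ?_)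
          · simpa using h1
          · simpa using h2
          · rw [← map_add]; exact (map_ne_zero_iff _ (FaithfulSMul.algebraMap_injective B K)).2 h3
      smul_mem' := by
        intro a b hb
        by_cases h1 : a = 0
        · left; simp [h1]
        by_cases h2 : b = 0
        · left; simp [h2]
        right
        rw [smul_eq_mul, map_mul, hv.mul _ _ (by simpa using h1) (by simpa using h2)]
        have h3 := (hB a).resolve_left (by simpa using h1)
        have h4 := hb.resolve_left h2
        omega }
  have hI : ∀ b, b ∈ I ↔ b = 0 ∨ 0 < v (algebraMap B K b) := fun b => Iff.rfl
  have hIp : I.IsPrime := by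
    refine ⟨?_, ?_⟩
    · rw [Ideal.ne_top_iff_one, hI]; simp [hv.one]
    · intro a b hab
      by_cases h1 : a = 0
      · left; exact Or.inl h1
      by_cases h2 : b = 0
      · right; exact Or.inl h2
      have h5 := ((hI _).1 hab).resolve_left (mul_ne_zero h1 h2)
      rw [map_mul, hv.mul _ _ (by simpa using h1) (by simpa using h2)] at h5
      have h3 := (hB a).resolve_left (by simpa using h1)
      have h4 := (hB b).resolve_left (by simpa using h2)
      rw [hI, hI]
      by_contra hcon
      push Not at hcon
      omega
  have hI0 : I ≠ ⊥ := by
    intro h0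
    have h1 : ∀ b : B, b ≠ 0 → v (algebraMap B K b) = 0 := by
      intro b hb
      have h2 : b ∉ I := by rw [h0]; simpa using hb
      rw [hI] at h2
      push Not at h2
      have h3 := (hB b).resolve_left (by simpa using hb)
      omega
    obtain ⟨f, hf, hf1⟩ := hv.unif
    obtain ⟨a, s, hs, rfl⟩ := IsFractionRing.div_surjective (A := B) f
    have hs0 : s ≠ 0 := nonZeroDivisors.ne_zero hs
    have ha0 : a ≠ 0 := by rintro rfl; simp at hf
    rw [hv.div (by simpa using ha0) (by simpa using hs0), h1 a ha0, h1 s hs0] at hf1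
    omega
  refine ⟨⟨I, hIp, hI0⟩, ?_⟩
  set P : HeightOneSpectrum B := ⟨I, hIp, hI0⟩ with hP
  have hu : ∀ s : B, s ∉ I → s ≠ 0 ∧ v (algebraMap B K s) = 0 := by
    intro s hs
    rw [hI] at hs
    push Not at hs
    have h3 := (hB s).resolve_left (by simpa using hs.1)
    exact ⟨hs.1, by omega⟩
  have hint : ∀ g : K, g ≠ 0 → 0 ≤ vP K P g → 0 ≤ v g := by
    intro g hg hg0
    rw [vP_nonneg P hg] at hg0
    obtain ⟨a, s, has⟩ := P.exists_primeCompl_mul_eq_of_integer g hg0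
    have h1 := hu s s.2
    have hs : algebraMap B K s ≠ 0 := by simpa using h1.1
    have h2 : algebraMap B K a ≠ 0 := by rw [← has]; exact mul_ne_zero hg hs
    have h3 := (hB a).resolve_left h2
    rw [← has, hv.mul _ _ hg hs, h1.2] at h3
    omega
  have hint0 : ∀ g : K, g ≠ 0 → vP K P g = 0 → v g = 0 := by
    intro g hg hg0
    have h1 := hint g hg (by omega)
    have h2 := hint g⁻¹ (inv_ne_zero hg) (by
      rw [vP, map_inv₀, log_inv]; rw [vP] at hg0; omega)
    rw [hv.inv hg] at h2; omega
  obtain ⟨π, hπ⟩ := P.valuation_exists_uniformizer K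
  have hπ0 : π ≠ 0 := by rintro rfl; rw [map_zero] at hπ; exact exp_ne_zero hπ.symm
  have hπ1 : vP K P π = 1 := by rw [vP, hπ]; simp
  have hgen : ∀ g : K, g ≠ 0 → v g = vP K P g * v π := by
    intro g hg
    have h1 := hint0 (g * (π ^ (vP K P g))⁻¹) (mul_ne_zero hg (inv_ne_zero (zpow_ne_zero _ hπ0))) (by
      rw [vP, map_mul, map_inv₀, map_zpow₀, log_mul (val_ne P hg) (inv_ne_zero (zpow_ne_zero _ (val_ne P hπ0))), log_inv, log_zpow]
      have : log (P.valuation K π) = -1 := by rw [hπ]; simp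
      rw [this]; simp [vP])
    rw [hv.mul _ _ hg (inv_ne_zero (zpow_ne_zero _ hπ0)), hv.inv (zpow_ne_zero _ hπ0), hv.zpow hπ0] at h1
    linarith
  have hπv : v π = 1 := by
    have h1 := hint π hπ0 (by omega)
    obtain ⟨f, hf, hf1⟩ := hv.unif
    have := hgen f hf
    rw [hf1] at this
    have h3 := Int.eq_one_or_neg_one_of_mul_eq_one' this.symm
    omega
  funext g
  by_cases hg : g = 0
  · simp [hg, hv.zero, vP]
  · rw [hgen g hg, hπv, mul_one]

/-- local denominators -/
lemma place_denom (hv : IsPlace k v) (P : HeightOneSpectrum B) (hP : v = vP K P) (g : K) (hg : g ≠ 0) (h : 0 ≤ v g) :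
    ∃ a s : B, algebraMap B K s ≠ 0 ∧ v (algebraMap B K s) = 0 ∧ g = algebraMap B K a / algebraMap B K s := by
  rw [hP, vP_nonneg P hg] at h
  obtain ⟨a, s, has⟩ := P.exists_primeCompl_mul_eq_of_integer g h
  have hs : algebraMap B K s ≠ 0 := by
    simp only [ne_eq, FaithfulSMul.algebraMap_eq_zero_iff]
    rintro h0
    exact s.2 (by rw [h0]; exact P.asIdeal.zero_mem)
  refine ⟨a, s, hs, ?_, ?_⟩
  · have := (HeightOneSpectrum.valuation_eq_one_iff_notMem (K := K) P).2 s.2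
    rw [hP, vP, this]; simp
  · rw [eq_div_iff hs]; exact has

end places


section chart
open IsDedekindDomain WithZero
open IntermediateField
open scoped IntermediateField.algebraAdjoinAdjoin
variable {k : Type uk} {K : Type uK} [Field k] [Field K] [Algebra k K]

lemma adj_surj (f : K) (a : Algebra.adjoin k {f}) : ∃ q : Polynomial k, (a : K) = Polynomial.aeval f q := by
  obtain ⟨q, hq⟩ := (Algebra.adjoin_singleton_eq_range_aeval k f).le a.2
  exact ⟨q, hq.symm⟩

lemma adj_pid (f : K) : IsPrincipalIdealRing (Algebra.adjoin k {f}) := by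
  let φ : Polynomial k →+* Algebra.adjoin k {f} :=
    (Polynomial.aeval (⟨f, Algebra.self_mem_adjoin_singleton k f⟩ : Algebra.adjoin k {f})).toRingHom
  refine IsPrincipalIdealRing.of_surjective φ fun a => ?_
  obtain ⟨q, hq⟩ := adj_surj f a
  refine ⟨q, Subtype.ext ?_⟩
  rw [hq]
  exact (Polynomial.aeval_algHom_apply (Algebra.adjoin k {f}).val (⟨f, Algebra.self_mem_adjoin_singleton k f⟩ : Algebra.adjoin k {f}) q).symm

lemma adj_res (f : K) (hf : Transcendental k f) :
    Function.Bijective (algebraMap k (Algebra.adjoin k {f} ⧸ Ideal.span {(⟨f, Algebra.self_mem_adjoin_singleton k f⟩ : Algebra.adjoin k {f})})) := by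
  set x : Algebra.adjoin k {f} := ⟨f, Algebra.self_mem_adjoin_singleton k f⟩ with hx
  have hnt : Nontrivial (Algebra.adjoin k {f} ⧸ Ideal.span {x}) := by
    rw [Ideal.Quotient.nontrivial_iff]
    intro h
    have h1 : (1 : Algebra.adjoin k {f}) ∈ Ideal.span {x} := by rw [h]; trivial
    obtain ⟨a, ha⟩ := Ideal.mem_span_singleton.1 h1
    obtain ⟨q, hq⟩ := adj_surj f a
    have h2 : (1:K) = f * Polynomial.aeval f q := by
      rw [← hq]
      exact congrArg Subtype.val ha
    have h3 : Polynomial.aeval f (Polynomial.X * q - 1) = 0 := by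
      simp [← h2]
    have h4 : (Polynomial.X * q - 1 : Polynomial k) = 0 := by
      by_contra h5
      exact hf ⟨_, h5, h3⟩
    have h5 := congrArg (Polynomial.eval 0) h4
    simp at h5
  refine ⟨RingHom.injective _, fun y => ?_⟩
  obtain ⟨a, rfl⟩ := Ideal.Quotient.mk_surjective y
  obtain ⟨q, hq⟩ := adj_surj f a
  refine ⟨q.coeff 0, ?_⟩
  rw [IsScalarTower.algebraMap_apply k (Algebra.adjoin k {f}) (Algebra.adjoin k {f} ⧸ Ideal.span {x}), Ideal.Quotient.algebraMap_eq, Ideal.Quotient.eq, Ideal.mem_span_singleton]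
  refine ⟨-(Polynomial.aeval x q.divX), Subtype.ext ?_⟩
  have h1 := congrArg (Polynomial.aeval f) (Polynomial.divX_mul_X_add q)
  have h2 : ((Polynomial.aeval x q.divX : Algebra.adjoin k {f}) : K) = Polynomial.aeval f q.divX :=
    (Polynomial.aeval_algHom_apply (Algebra.adjoin k {f}).val x q.divX).symm
  simp only [map_add, map_mul, Polynomial.aeval_X, Polynomial.aeval_C] at h1
  change algebraMap k K _ - (a : K) = f * (-((Polynomial.aeval x q.divX : Algebra.adjoin k {f}) : K))
  rw [hq, ← h1, h2]
  ring

/-- the ring of the chart -/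
noncomputable abbrev Ch (k : Type uk) {K : Type uK} [Field k] [Field K] [Algebra k K] (f : K) : Subalgebra (Algebra.adjoin k {f}) K :=
  integralClosure (Algebra.adjoin k {f}) K

lemma ch_ded [CharZero k] (f : K) (hfin : FiniteDimensional (IntermediateField.adjoin k {f}) K) :
    IsDedekindDomain (Ch k f) ∧ IsFractionRing (Ch k f) K ∧ Module.Finite (Algebra.adjoin k {f}) (Ch k f) := by
  have := adj_pid (k := k) f
  have : CharZero (IntermediateField.adjoin k {f}) := algebraRat.charZero _
  refine ⟨?_, ?_, ?_⟩
  · exact integralClosure.isDedekindDomain (Algebra.adjoin k {f}) (IntermediateField.adjoin k {f}) K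
  · exact integralClosure.isFractionRing_of_finite_extension (IntermediateField.adjoin k {f}) K
  · exact IsIntegralClosure.finite (Algebra.adjoin k {f}) (IntermediateField.adjoin k {f}) K (Ch k f)

lemma ch_mem {v : K → ℤ} (hv : IsPlace k v) (f : K) (hf : f ∈ hv.ring) (b : Ch k f) : (b : K) ∈ hv.ring := by
  have hle : Algebra.adjoin k {f} ≤ hv.ring := Algebra.adjoin_le (by simpa using hf)
  refine hv.integral ?_
  obtain ⟨q, hq, hqb⟩ := b.2
  refine ⟨q.map (Subalgebra.inclusion hle).toRingHom, hq.map _, ?_⟩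
  rw [Polynomial.eval₂_map]
  exact hqb

end chart


section ram
open IsDedekindDomain WithZero
variable {k : Type uk} [Field k]

lemma iner_one [IsAlgClosed k] {A B : Type uK} [CommRing A] [CommRing B] [Algebra A B] [Algebra k A]
    [Module.Finite A B] (p : Ideal A) [p.IsMaximal]
    (hk : Function.Bijective (algebraMap k (A ⧸ p))) (P : Ideal B) [P.IsPrime] [P.LiesOver p] :
    Ideal.inertiaDeg' p P = 1 := by
  rw [Ideal.inertiaDeg'_algebraMap]
  let _ := Ideal.Quotient.field p
  have : IsAlgClosed (A ⧸ p) := by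
    refine IsAlgClosed.of_exists_root _ fun q _ hq => ?_
    let e := RingEquiv.ofBijective _ hk
    have h1 : (q.map (e.symm : (A ⧸ p) →+* k)).degree ≠ 0 := by
      rw [Polynomial.degree_map]
      exact (Polynomial.degree_pos_of_irreducible hq).ne'
    obtain ⟨z, hz⟩ := IsAlgClosed.exists_root _ h1
    refine ⟨e z, ?_⟩
    rw [Polynomial.IsRoot.def, Polynomial.eval_map] at hz
    have h2 := congrArg e hz
    have h3 := Polynomial.hom_eval₂ q (e.symm : (A ⧸ p) →+* k) (e : k →+* (A ⧸ p)) z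
    rw [map_zero] at h2
    change (e : k →+* (A ⧸ p)) _ = 0 at h2
    rw [h2] at h3
    have h4 : (e : k →+* (A ⧸ p)).comp (e.symm : (A ⧸ p) →+* k) = RingHom.id _ := by ext; simp
    rw [h4] at h3
    exact h3.symm
  have h := IsAlgClosed.algebraMap_bijective_of_isIntegral (k := A ⧸ p) (K := B ⧸ P)
  rw [← (LinearEquiv.ofBijective (Algebra.linearMap (A ⧸ p) (B ⧸ P)) h).finrank_eq]
  exact Module.finrank_self _

lemma ram_sum [IsAlgClosed k] {A B F L : Type uK} [CommRing A] [CommRing B] [Field F] [Field L] [IsDedekindDomain A] [IsDedekindDomain B]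
    [Algebra A B] [Algebra k A] [Module.Finite A B] [Algebra A F] [IsFractionRing A F] [Algebra B L] [IsFractionRing B L]
    [Algebra F L] [Algebra A L] [IsScalarTower A B L] [IsScalarTower A F L] [Module.IsTorsionFree A B]
    (x : A) (hx : x ≠ 0) (hk : Function.Bijective (algebraMap k (A ⧸ Ideal.span {x}))) :
    ∃ T : Finset (HeightOneSpectrum B), (∀ P, P ∈ T ↔ algebraMap A B x ∈ P.asIdeal) ∧
      ∑ P ∈ T, vP L P (algebraMap A L x) = Module.finrank F L := by
  have hmax : (Ideal.span {x}).IsMaximal := by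
    refine Ideal.Quotient.maximal_of_isField _ ?_
    exact MulEquiv.isField (Field.toIsField k) (RingEquiv.ofBijective _ hk).symm.toMulEquiv
  set p : Ideal A := Ideal.span {x} with hp
  have hp0 : p ≠ ⊥ := by rw [hp]; simpa using hx
  have hsum := Ideal.sum_ramification_inertia B F L hp0
  let v : HeightOneSpectrum A := ⟨p, hmax.isPrime, hp0⟩
  have hlies : ∀ P : HeightOneSpectrum B, algebraMap A B x ∈ P.asIdeal ↔ P.asIdeal.LiesOver p := by
    intro P
    constructor
    · intro h
      refine ⟨hmax.eq_of_le (Ideal.IsPrime.under A P.asIdeal).ne_top ?_⟩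
      rw [hp, Ideal.span_singleton_le_iff_mem]
      exact h
    · intro h
      have : x ∈ P.asIdeal.under A := by rw [← h.over]; exact Ideal.mem_span_singleton_self x
      exact this
  have hinj : Function.Injective (fun P : HeightOneSpectrum B => P.asIdeal) := fun P Q h => HeightOneSpectrum.ext h
  refine ⟨(IsDedekindDomain.primesOverFinset p B).preimage (fun P => P.asIdeal) hinj.injOn, ?_, ?_⟩
  · intro P
    rw [Finset.mem_preimage, IsDedekindDomain.mem_primesOverFinset_iff hp0, hlies]
    exact ⟨fun h => h.2, fun h => ⟨P.isPrime, h⟩⟩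
  · rw [← hsum, Nat.cast_sum]
    rw [← Finset.sum_preimage (fun P : HeightOneSpectrum B => P.asIdeal) _ hinj.injOn]
    · refine Finset.sum_congr rfl fun P hP => ?_
      rw [Finset.mem_preimage, IsDedekindDomain.mem_primesOverFinset_iff hp0] at hP
      have h1 : P.asIdeal.LiesOver p := hP.2
      have h1' : P.asIdeal.LiesOver v.asIdeal := hP.2
      have h2 := HeightOneSpectrum.intValuation_liesOver v P x
      rw [HeightOneSpectrum.intValuation_singleton v hx rfl] at h2
      have h4 := P.isPrime
      rw [iner_one p hk, mul_one, vP, IsScalarTower.algebraMap_apply A B L, HeightOneSpectrum.valuation_of_algebraMap, ← h2, log_pow]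
      simp [v]
    · intro P hP hP2
      exfalso
      apply hP2
      have h5 := (IsDedekindDomain.mem_primesOverFinset_iff hp0 B).1 hP
      have h6 := h5.2
      refine ⟨⟨P, h5.1, ?_⟩, rfl⟩
      exact Ideal.ne_bot_of_liesOver_of_ne_bot hp0 P
end ram

section zeros
open IsDedekindDomain WithZero
open IntermediateField
open scoped IntermediateField.algebraAdjoinAdjoin
variable {k : Type uk} {K : Type uK} [Field k] [Field K] [Algebra k K]

lemma zeros [IsAlgClosed k] [CharZero k] (f : K) (hf : Transcendental k f)
    (hfin : FiniteDimensional (IntermediateField.adjoin k {f}) K) :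
    ∃ T : Finset {v : K → ℤ // IsPlace k v}, (∀ p, p ∈ T ↔ 0 < p.1 f) ∧
      ∑ p ∈ T, p.1 f = Module.finrank (IntermediateField.adjoin k {f}) K := by
  obtain ⟨h1, h2, h3⟩ := ch_ded f hfin
  have := adj_pid (k := k) f
  have hf0 : f ≠ 0 := by rintro rfl; exact hf isAlgebraic_zero
  set x : Algebra.adjoin k {f} := ⟨f, Algebra.self_mem_adjoin_singleton k f⟩ with hx
  have hst : IsScalarTower (Algebra.adjoin k {f}) (Ch k f) K := IsScalarTower.of_algebraMap_eq (fun _ => rfl)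
  obtain ⟨T, hT, hs⟩ := ram_sum (k := k) (A := Algebra.adjoin k {f}) (B := Ch k f) (F := IntermediateField.adjoin k {f}) (L := K)
    x (fun h => hf0 (congrArg Subtype.val h)) (adj_res f hf)
  let e : HeightOneSpectrum (Ch k f) → {v : K → ℤ // IsPlace k v} := fun P => ⟨vP K P, vP_place P⟩
  have he : Function.Injective e := fun P Q h => vP_inj P Q (congrArg Subtype.val h)
  have hxB : algebraMap (Algebra.adjoin k {f}) (Ch k f) x ≠ 0 := fun h => hf0 (congrArg Subtype.val h)
  refine ⟨T.map ⟨e, he⟩, ?_, ?_⟩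
  · intro p
    rw [Finset.mem_map]
    constructor
    · rintro ⟨P, hP, rfl⟩
      exact (vP_pos (K := K) P hxB).2 ((hT P).1 hP)
    · intro hp
      obtain ⟨P, hP⟩ := place_vP p.2 (B := Ch k f) (fun b => ch_mem p.2 f (Or.inr hp.le) b)
      refine ⟨P, (hT P).2 ((vP_pos (K := K) P hxB).1 ?_), Subtype.ext hP.symm⟩
      rw [← hP]; exact hp
  · rw [Finset.sum_map]
    exact hs

end zeros


section plsum
open IntermediateField
variable {k : Type uk} {K : Type uK} [Field k] [Field K] [Algebra k K]

lemma trans_inv (f : K) (hf : Transcendental k f) : Transcendental k f⁻¹ := by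
  intro h
  exact hf (by simpa using h.inv)

lemma adjoin_inv (f : K) : IntermediateField.adjoin k {f⁻¹} = IntermediateField.adjoin k {f} := by
  apply le_antisymm
  · rw [IntermediateField.adjoin_simple_le_iff]
    exact inv_mem (IntermediateField.mem_adjoin_simple_self k f)
  · rw [IntermediateField.adjoin_simple_le_iff]
    have := inv_mem (IntermediateField.mem_adjoin_simple_self k f⁻¹)
    simpa using this

lemma pl_fin_sum [IsAlgClosed k] [CharZero k] (hK : ∃ t : K, Transcendental k t ∧ FiniteDimensional (IntermediateField.adjoin k {t}) K)
    (f : K) (hf : f ≠ 0) : {p : {v : K → ℤ // IsPlace k v} | p.1 f ≠ 0}.Finite ∧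
      ∑ᶠ p : {v : K → ℤ // IsPlace k v}, p.1 f = 0 := by
  rcases const_or_trans (k := k) f with ⟨c, rfl⟩ | htr
  · have hc : c ≠ 0 := by rintro rfl; simp at hf
    have h : ∀ p : {v : K → ℤ // IsPlace k v}, p.1 (algebraMap k K c) = 0 := fun p => p.2.const c hc
    constructor
    · simp [h]
    · simp [h]
  · obtain ⟨T, hT, hs⟩ := zeros f htr (ff_fin hK f htr)
    obtain ⟨T', hT', hs'⟩ := zeros f⁻¹ (trans_inv f htr) (ff_fin hK _ (trans_inv f htr))
    rw [adjoin_inv] at hs'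
    have hT'' : ∀ p, p ∈ T' ↔ p.1 f < 0 := fun p => by
      rw [hT', p.2.inv hf]; omega
    have hsub : {p : {v : K → ℤ // IsPlace k v} | p.1 f ≠ 0} ⊆ ↑(T ∪ T') := by
      intro p hp
      have hp' : p.1 f ≠ 0 := hp
      rw [Finset.mem_coe, Finset.mem_union, hT, hT'']
      omega
    refine ⟨(Finset.finite_toSet _).subset hsub, ?_⟩
    rw [finsum_eq_sum_of_support_subset _ hsub, Finset.sum_union]
    · rw [hs, ← hs', ← Finset.sum_add_distrib]
      refine Finset.sum_eq_zero fun p hp => ?_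
      rw [p.2.inv hf]; ring
    · rw [Finset.disjoint_left]
      intro p h1 h2
      rw [hT] at h1; rw [hT''] at h2; omega

lemma pl_ne [IsAlgClosed k] [CharZero k] (hK : ∃ t : K, Transcendental k t ∧ FiniteDimensional (IntermediateField.adjoin k {t}) K) :
    Nonempty {v : K → ℤ // IsPlace k v} := by
  obtain ⟨t, ht, hfin⟩ := hK
  obtain ⟨T, hT, hs⟩ := zeros t ht hfin
  have hpos : 0 < Module.finrank (IntermediateField.adjoin k {t}) K := Module.finrank_pos
  by_contra hcon
  have : T = ∅ := by
    ext p; exact absurd ⟨p⟩ hcon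
  rw [this] at hs
  simp at hs
  omega

lemma pl_res [IsAlgClosed k] [CharZero k] (hK : ∃ t : K, Transcendental k t ∧ FiniteDimensional (IntermediateField.adjoin k {t}) K)
    {v : K → ℤ} (hv : IsPlace k v) (f : K) (hf : f ≠ 0) (h0 : 0 ≤ v f) :
    ∃ c : k, algebraMap k K c = f ∨ 0 < v (f - algebraMap k K c) := by
  rcases const_or_trans (k := k) f with ⟨c, h⟩ | htr
  · exact ⟨c, Or.inl h⟩
  by_contra hcon
  push Not at hcon
  have hfm : f ∈ hv.ring := Or.inr h0
  have hne : ∀ c : k, f - algebraMap k K c ≠ 0 := fun c h => (hcon c).1 (sub_eq_zero.1 h).symm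
  have hlin : ∀ c : k, v (f - algebraMap k K c) = 0 := by
    intro c
    have h1 : f - algebraMap k K c ∈ hv.ring := sub_mem hfm (algebraMap_mem _ _)
    have h2 := h1.resolve_left (hne c)
    have h3 := (hcon c).2
    omega
  have hinv : ∀ q : Polynomial k, (Polynomial.aeval f q)⁻¹ ∈ hv.ring := by
    intro q
    by_cases hq : q = 0
    · left; simp [hq]
    have hsp := (IsAlgClosed.splits q).eq_prod_roots
    rw [hsp, map_mul, Polynomial.aeval_C, map_multiset_prod, mul_inv]
    refine mul_mem ?_ ?_
    · rw [← map_inv₀]; exact algebraMap_mem _ _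
    · rw [← Multiset.prod_map_inv]
      refine multiset_prod_mem _ ?_
      intro y hy
      simp only [Multiset.map_map, Multiset.mem_map, Function.comp] at hy
      obtain ⟨c, -, rfl⟩ := hy
      right
      simp only [map_sub, Polynomial.aeval_X, Polynomial.aeval_C]
      rw [hv.inv (hne c), hlin c]; simp
  have hpol : ∀ q : Polynomial k, (Polynomial.aeval f q) ∈ hv.ring := by
    intro q
    exact (Algebra.adjoin_le (S := hv.ring) (by simpa using hfm)) (Polynomial.aeval_mem_adjoin_singleton k f)
  have hE : ∀ y ∈ IntermediateField.adjoin k {f}, y ∈ hv.ring := by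
    intro y hy
    rw [IntermediateField.mem_adjoin_simple_iff] at hy
    obtain ⟨r, s, rfl⟩ := hy
    rw [div_eq_mul_inv]
    exact mul_mem (hpol r) (hinv s)
  have hfin := ff_fin hK f htr
  have hall : ∀ y : K, y ∈ hv.ring := by
    intro y
    refine hv.integral ?_
    obtain ⟨q, hq, hqy⟩ := (Algebra.IsIntegral.isIntegral (R := IntermediateField.adjoin k {f}) y)
    let φ : IntermediateField.adjoin k {f} →+* hv.ring :=
      (algebraMap (IntermediateField.adjoin k {f}) K).codRestrict hv.ring (fun z => hE z z.2)
    refine ⟨q.map φ, hq.map _, ?_⟩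
    rw [Polynomial.eval₂_map]
    exact hqy
  obtain ⟨u, hu, hu1⟩ := hv.unif
  have := (hall u⁻¹).resolve_left (inv_ne_zero hu)
  rw [hv.inv hu] at this
  omega

end plsum


section deriv
open IntermediateField
variable {k : Type uk} {K : Type uK} [Field k] [Field K] [Algebra k K]

lemma der_exists [CharZero k] (hK : ∃ t : K, Transcendental k t ∧ FiniteDimensional (IntermediateField.adjoin k {t}) K) :
    ∃ D : Derivation k K K, ∃ t, D t ≠ 0 := by
  have h0 := ff_essFin hK
  obtain ⟨t, ht, -⟩ := hK
  by_contra hcon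
  push Not at hcon
  have h1 : ∀ x : K, KaehlerDifferential.D k K x = 0 := by
    intro x
    by_contra hx
    apply hx
    rw [← Module.forall_dual_apply_eq_zero_iff K]
    intro φ
    exact hcon (φ.compDer (KaehlerDifferential.D k K)) x
  have h2 : Subsingleton (KaehlerDifferential k K) := by
    refine ⟨fun a b => ?_⟩
    have : (⊤ : Submodule K (KaehlerDifferential k K)) = ⊥ := by
      rw [← KaehlerDifferential.span_range_derivation, Submodule.span_eq_bot]
      rintro _ ⟨x, rfl⟩
      exact h1 x
    have h3 : ∀ a : KaehlerDifferential k K, a = 0 := fun a => by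
      have : a ∈ (⊤ : Submodule K (KaehlerDifferential k K)) := trivial
      rwa [‹(⊤ : Submodule K (KaehlerDifferential k K)) = ⊥›, Submodule.mem_bot] at this
    rw [h3 a, h3 b]
  have h3 : Algebra.FormallyUnramified k K := ⟨h2⟩
  have h4 : Algebra.IsSeparable k K := Algebra.FormallyUnramified.isSeparable k K
  exact ht (Algebra.IsAlgebraic.isAlgebraic t)

lemma der_ker [IsAlgClosed k] [CharZero k] (hK : ∃ t : K, Transcendental k t ∧ FiniteDimensional (IntermediateField.adjoin k {t}) K)
    (D : Derivation k K K) (hD : ∃ t, D t ≠ 0) (g : K) (hg : D g = 0) : ∃ c : k, algebraMap k K c = g := by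
  refine (const_or_trans (k := k) g).resolve_right fun htr => ?_
  obtain ⟨t, ht⟩ := hD
  have hfin := ff_fin hK g htr
  have hpol : ∀ q : Polynomial k, D (Polynomial.aeval g q) = 0 := by
    intro q
    rw [Derivation.map_aeval, hg, smul_zero]
  have hE : ∀ y ∈ IntermediateField.adjoin k {g}, D y = 0 := by
    intro y hy
    rw [IntermediateField.mem_adjoin_simple_iff] at hy
    obtain ⟨r, s, rfl⟩ := hy
    rw [Derivation.leibniz_div, hpol, hpol]
    simp
  have : CharZero (IntermediateField.adjoin k {g}) := algebraRat.charZero _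
  have h1 : Algebra.FormallyUnramified (IntermediateField.adjoin k {g}) K :=
    Algebra.FormallyUnramified.of_isSeparable _ K
  let L : K →ₗ[IntermediateField.adjoin k {g}] K :=
    { toFun := D
      map_add' := D.map_add
      map_smul' := by
        intro z y
        rw [Algebra.smul_def, D.leibniz, hE (algebraMap _ K z) z.2]
        simp [Algebra.smul_def] }
  let D' : Derivation (IntermediateField.adjoin k {g}) K K := Derivation.mk' L (fun a b => D.leibniz a b)
  have h2 : D' t = 0 := by
    rw [← D'.liftKaehlerDifferential_comp_D t, Subsingleton.elim (KaehlerDifferential.D _ K t) 0, map_zero]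
  exact ht h2

end deriv


section bound
open IntermediateField
open scoped IntermediateField.algebraAdjoinAdjoin
variable {k : Type uk} {K : Type uK} [Field k] [Field K] [Algebra k K]

/-- elements with pole order at most `n` -/
def IsPlace.bd {v : K → ℤ} (hv : IsPlace k v) (n : ℕ) : Submodule hv.ring K where
  carrier := {f | f = 0 ∨ -(n:ℤ) ≤ v f}
  zero_mem' := Or.inl rfl
  add_mem' := by
    intro a b ha hb
    by_cases h1 : a = 0
    · simpa [h1] using hb
    by_cases h2 : b = 0
    · simpa [h2] using ha
    by_cases h3 : a + b = 0
    · exact Or.inl h3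
    · exact Or.inr ((le_min (ha.resolve_left h1) (hb.resolve_left h2)).trans (hv.add a b h1 h2 h3))
  smul_mem' := by
    rintro ⟨r, hr⟩ x hx
    change r * x = 0 ∨ _ ≤ v (r * x)
    by_cases h1 : r = 0
    · left; simp [h1]
    by_cases h2 : x = 0
    · left; simp [h2]
    right
    rw [hv.mul _ _ h1 h2]
    have h3 := hr.resolve_left h1
    have h4 := hx.resolve_left h2
    omega

lemma IsPlace.bd_mul {v : K → ℤ} (hv : IsPlace k v) {n : ℕ} {r x : K} (hr : r ∈ hv.ring) (hx : x ∈ hv.bd n) : r * x ∈ hv.bd n :=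
  (hv.bd n).smul_mem (⟨r, hr⟩ : hv.ring) hx

lemma chart_c [IsAlgClosed k] [CharZero k] (hK : ∃ t : K, Transcendental k t ∧ FiniteDimensional (IntermediateField.adjoin k {t}) K)
    (D : Derivation k K K) (f : K) (hf : Transcendental k f) :
    ∃ c : {v : K → ℤ // IsPlace k v} → ℕ, {p | c p ≠ 0}.Finite ∧
      ∀ p : {v : K → ℤ // IsPlace k v}, 0 ≤ p.1 f → ∀ g : K, g ≠ 0 → 0 ≤ p.1 g → D g ∈ p.2.bd (c p) := by
  obtain ⟨h1, h2, h3⟩ := ch_ded f (ff_fin hK f hf)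
  obtain ⟨G, hG⟩ := h3
  let S : Finset K := insert (D f) (G.image fun b : Ch k f => D (b : K))
  let c : {v : K → ℤ // IsPlace k v} → ℕ := fun p => ∑ s ∈ S, (p.1 s).natAbs
  have hcS : ∀ p : {v : K → ℤ // IsPlace k v}, ∀ s ∈ S, s ∈ p.2.bd (c p) := by
    intro p s hs
    right
    have : (p.1 s).natAbs ≤ c p := Finset.single_le_sum (f := fun s => (p.1 s).natAbs) (fun _ _ => Nat.zero_le _) hs
    omega
  refine ⟨c, ?_, ?_⟩
  · refine Set.Finite.subset (S.finite_toSet.biUnion (t := fun s => {p : {v : K → ℤ // IsPlace k v} | p.1 s ≠ 0}) ?_) ?_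
    · intro s _
      by_cases hs : s = 0
      · have : {p : {v : K → ℤ // IsPlace k v} | p.1 s ≠ 0} = ∅ := by
          ext p; simp [hs, p.2.zero]
        rw [this]; exact Set.finite_empty
      · exact (pl_fin_sum hK s hs).1
    · intro p hp
      by_contra hcon
      apply hp
      refine Finset.sum_eq_zero fun s hs => ?_
      by_contra h4
      apply hcon
      refine Set.mem_biUnion (x := s) hs ?_
      intro h5
      exact h4 (by rw [h5]; rfl)
  · intro p hp g hg0 hg
    have hmem : ∀ b : Ch k f, (b : K) ∈ p.2.ring := ch_mem p.2 f (Or.inr hp)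
    have hpol : ∀ q : Polynomial k, Polynomial.aeval f q ∈ p.2.ring := by
      intro q
      have hfm : f ∈ p.2.ring := Or.inr hp
      exact (Algebra.adjoin_le (S := p.2.ring) (by simpa using hfm)) (Polynomial.aeval_mem_adjoin_singleton k f)
    have hDb : ∀ b : Ch k f, D (b : K) ∈ p.2.bd (c p) := by
      intro b
      have hb : b ∈ Submodule.span (Algebra.adjoin k {f}) (G : Set (Ch k f)) := by rw [hG]; trivial
      induction hb using Submodule.span_induction with
      | mem x hx =>
        refine hcS p _ (Finset.mem_insert_of_mem (Finset.mem_image_of_mem _ hx))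
      | zero => simp
      | add x y _ _ hx hy =>
        rw [Subalgebra.coe_add, map_add]
        exact add_mem hx hy
      | smul a x _ hx =>
        obtain ⟨q, hq⟩ := adj_surj f a
        have : ((a • x : Ch k f) : K) = Polynomial.aeval f q * (x : K) := by
          rw [← hq]; rfl
        rw [this, D.leibniz, Derivation.map_aeval]
        simp only [smul_eq_mul]
        refine add_mem (p.2.bd_mul (hpol q) hx) (p.2.bd_mul (hmem x) (p.2.bd_mul (hpol _) ?_))
        exact hcS p _ (Finset.mem_insert_self _ _)
    obtain ⟨P, hP⟩ := place_vP p.2 (B := Ch k f) hmem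
    obtain ⟨a, s, hs, hs0, rfl⟩ := place_denom p.2 P hP g hg0 hg
    rw [Derivation.leibniz_div]
    have hsi : (algebraMap (Ch k f) K s)⁻¹ ∈ p.2.ring := by
      right; rw [p.2.inv hs, hs0]; simp
    simp only [smul_eq_mul]
    refine p.2.bd_mul (pow_mem hsi 2) (sub_mem (p.2.bd_mul (hmem s) (hDb a)) (p.2.bd_mul (hmem a) (hDb s)))

theorem exists_FFD [IsAlgClosed k] [CharZero k] (hK : ∃ t : K, Transcendental k t ∧ FiniteDimensional (IntermediateField.adjoin k {t}) K) :
    Nonempty (FFD k K) := by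
  obtain ⟨D, hD⟩ := der_exists hK
  obtain ⟨t, ht, -⟩ := id hK
  have ht0 : t ≠ 0 := by rintro rfl; exact ht isAlgebraic_zero
  obtain ⟨c1, hc1, h1⟩ := chart_c hK D t ht
  obtain ⟨c2, hc2, h2⟩ := chart_c hK D t⁻¹ (trans_inv t ht)
  refine ⟨{
    Pl := {v : K → ℤ // IsPlace k v}
    v := fun p => p.1
    v_mul := fun p => p.2.mul
    v_add := fun p => p.2.add
    v_const := fun p => p.2.const
    unif := fun p => p.2.unif
    fin := fun f hf => (pl_fin_sum hK f hf).1
    sum := fun f hf => (pl_fin_sum hK f hf).2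
    ne := pl_ne hK
    res := fun p f hf h => pl_res hK p.2 f hf h
    D := D
    ker := fun f hf => der_ker hK D hD f hf
    c := fun p => c1 p + c2 p
    c_fin := (hc1.union hc2).subset ?_
    hc := ?_ }⟩
  · intro p hp
    by_contra hcon
    apply hp
    have h3 : c1 p = 0 := by by_contra h; exact hcon (Or.inl h)
    have h4 : c2 p = 0 := by by_contra h; exact hcon (Or.inr h)
    simp [h3, h4]
  · intro p f hf h0
    by_cases h : 0 ≤ p.1 t
    · rcases h1 p h f hf h0 with h3 | h3
      · exact Or.inl h3
      · right; push_cast; omega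
    · rcases h2 p (by rw [p.2.inv ht0]; omega) f hf h0 with h3 | h3
      · exact Or.inl h3
      · right; push_cast; omega

end bound

/-- **Pisot's d-th root conjecture for function fields** (Theorem 1.2).
`K` is the function field of a smooth projective curve over an algebraically closed
field `k` of characteristic zero (encoded: `K` is a finitely generated extension of `k`
of transcendence degree one).  If `b(n) = Σ B_i(n) β_i^n` is an exponential polynomial
over `K` whose group `Γ = ⟨β_1,…,β_ℓ⟩` satisfies `Γ ∩ k^* = {1}` and `b(n)` is a `d`-th
power in `K` for infinitely many `n`, then `b(m) = R(m)·a(m)^d` for all `m`, where `R ∈ k[T]`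
and `a(m) = Σ A_i(m) α_i^m` is an exponential polynomial over the algebraic closure of `K`. -/
theorem pisot_dth_root
    (k K : Type*) [Field k] [Field K] [Algebra k K] [IsAlgClosed k] [CharZero k]
    (hK : ∃ t : K, Transcendental k t ∧
      FiniteDimensional (IntermediateField.adjoin k {t}) K)
    (d : ℕ) (hd : 2 ≤ d)
    (ℓ : ℕ) (B : Fin ℓ → Polynomial K) (hB : ∀ i, B i ≠ 0)
    (β : Fin ℓ → K) (hβ : ∀ i, β i ≠ 0)
    (b : ℕ → K) (hb : ∀ n : ℕ, b n = ∑ i, Polynomial.eval (n : K) (B i) * β i ^ n)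
    (hΓ : ∀ γ : Kˣ, γ ∈ Subgroup.closure (Set.range fun i => Units.mk0 (β i) (hβ i)) →
      IsConst k (γ : K) → γ = 1)
    (hpow : {n : ℕ | ∃ y : K, y ^ d = b n}.Infinite) :
    ∃ (r : ℕ) (A : Fin r → Polynomial (AlgebraicClosure K))
      (α : Fin r → AlgebraicClosure K) (R : Polynomial k),
      (∀ i, α i ≠ 0) ∧
      ∀ m : ℕ,
        algebraMap K (AlgebraicClosure K) (b m) =
          algebraMap K (AlgebraicClosure K) (algebraMap k K (Polynomial.eval (m : k) R)) *
            (∑ i, Polynomial.eval ((m : AlgebraicClosure K)) (A i) * α i ^ m) ^ d := by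
  have : CharZero K := charZero_of_injective_algebraMap (algebraMap k K).injective
  obtain ⟨X⟩ := exists_FFD hK
  exact FFD.main X d hd ℓ B β hβ b hb hΓ hpow

end FunctionFieldGCD
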